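/- Assume p̄ ≠ 1/2. Then: (Transience) if p̄ > 1/2 then P_η(lim_{n→∞} X_n = +∞) = 1 for every initial distribution η on R, and if p̄ < 1/2 then P_η(lim_{n→∞} X_n = −∞) = 1 for every η. (Ballisticity) for every η there is a deterministic v₀ with P_η(lim_{n→∞} X_n/n = v₀) = 1, and v₀ > 0 if p̄ > 1/2 while v₀ < 0 if p̄ < 1/2. (Gaussian limit) for every η there is a constant b = b(K,𝐩,η) > 0 such that lim_{n→∞} P_η((X_n − n v₀)/(b√n) ≤ x) = Φ(x), where Φ is the standard normal distribution function. -/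

import Mathlib

open MeasureTheory Filter Set Matrix ProbabilityTheory
open scoped Classical

noncomputable section

/-- `K` is a (row-)stochastic matrix. -/
def IsStochastic {n : Type*} [Fintype n] (K : Matrix n n ℝ) : Prop :=
  (∀ i j, 0 ≤ K i j) ∧ ∀ i, ∑ j, K i j = 1

/-- `v` is a probability (row) vector. -/
def IsProbVec {n : Type*} [Fintype n] (v : n → ℝ) : Prop :=
  (∀ i, 0 ≤ v i) ∧ ∑ i, v i = 1

/-- `μ` is a stationary distribution for `K`, i.e. `μ K = μ`. -/
def IsStationaryDist {n : Type*} [Fintype n] (K : Matrix n n ℝ) (μ : n → ℝ) : Prop :=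
  IsProbVec μ ∧ Matrix.vecMul μ K = μ

/-- `μ` is the unique stationary distribution of `K` (equivalent, for a finite chain, to `K`
having a unique closed irreducible subset). -/
def HasUniqueStationaryDist {n : Type*} [Fintype n] (K : Matrix n n ℝ) (μ : n → ℝ) : Prop :=
  IsStationaryDist K μ ∧ ∀ μ' : n → ℝ, IsStationaryDist K μ' → μ' = μ

/-- `(Pm, Rc, ξ)` is the averaged law of a Markovian cookie environment together with its
coin tosses: the site processes `(Rc x, ξ x)`, `x ∈ ℤ`, are i.i.d., at each site
`Rc x` is a Markov chain with transition matrix `K` and initial distribution `η`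
(0-based indexing: `Rc x j` is `R^x_{j+1}` of the paper), and conditionally on the
environment the `ξ x j` are independent Bernoulli with success probability `p (Rc x j)`.
This is expressed through the finite-dimensional cylinder probabilities, which
characterize the joint law. -/
def IsCookieEnv {N : ℕ} {Ω : Type*} [MeasurableSpace Ω] (Pm : Measure Ω)
    (K : Matrix (Fin N) (Fin N) ℝ) (p η : Fin N → ℝ)
    (Rc : ℤ → ℕ → Ω → Fin N) (ξ : ℤ → ℕ → Ω → Bool) : Prop :=
  (∀ x j, Measurable (Rc x j)) ∧ (∀ x j, Measurable (ξ x j)) ∧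
    ∀ (S : Finset ℤ) (m : ℕ) (f : ℤ → ℕ → Fin N) (b : ℤ → ℕ → Bool),
      (Pm {ω | ∀ x ∈ S, ∀ j ≤ m, Rc x j ω = f x j ∧ ξ x j ω = b x j}).toReal =
        ∏ x ∈ S,
          (η (f x 0) * (∏ j ∈ Finset.range m, K (f x j) (f x (j + 1))) *
            ∏ j ∈ Finset.range (m + 1), (if b x j then p (f x j) else 1 - p (f x j)))

/-- The history (most recent position first) of the excited random walk driven by the
coin tosses `ξ`: from position `x`, if `x` has been visited `j` times before, the walk
steps right iff `ξ x j` (so `ξ x j` is the outcome of the `(j+1)`-st cookie at `x`). -/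
def walkHist (ξ : ℤ → ℕ → Bool) : ℕ → List ℤ
  | 0 => [0]
  | k + 1 =>
    let h := walkHist ξ k
    let x := h.headI
    (x + (if ξ x (h.tail.count x) then 1 else -1)) :: h

/-- The excited random walk driven by the coin tosses `ξ`, started at `0`. -/
def walk (ξ : ℤ → ℕ → Bool) (k : ℕ) : ℤ := (walkHist ξ k).headI

/-- The standard normal distribution function `Φ`. -/
def stdGaussianCDF (x : ℝ) : ℝ :=
  ∫ z in Set.Iic x, (1 / Real.sqrt (2 * Real.pi)) * Real.exp (-(z ^ 2) / 2)

/-! ### Counting successes and failures in a cookie stack -/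

/-- The number of successes among the first `n` tosses of the stack `b`. -/
def succCount (b : ℕ → Bool) (n : ℕ) : ℕ := Nat.count (fun j => b j = true) n

/-- The number of failures among the first `n` tosses of the stack `b`. -/
def failCount (b : ℕ → Bool) (n : ℕ) : ℕ := Nat.count (fun j => b j = false) n

/-- The number of failures before success number `z` (numbered from zero). -/
def failsBefore (b : ℕ → Bool) (z : ℕ) : ℕ := Nat.nth (fun j => b j = true) z - z

lemma succCount_zero (b : ℕ → Bool) : succCount b 0 = 0 := Nat.count_zero _

lemma failCount_zero (b : ℕ → Bool) : failCount b 0 = 0 := Nat.count_zero _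

lemma succCount_succ (b : ℕ → Bool) (n : ℕ) :
    succCount b (n + 1) = succCount b n + if b n = true then 1 else 0 :=
  Nat.count_succ _ _

lemma failCount_succ (b : ℕ → Bool) (n : ℕ) :
    failCount b (n + 1) = failCount b n + if b n = true then 0 else 1 := by
  unfold failCount
  rw [Nat.count_succ]
  cases b n <;> simp

lemma succCount_add_failCount (b : ℕ → Bool) (n : ℕ) : succCount b n + failCount b n = n := by
  induction n with
  | zero => simp [succCount_zero, failCount_zero]
  | succ n ih =>
    rw [succCount_succ, failCount_succ]
    split_ifs <;> omega

lemma failCount_mono (b : ℕ → Bool) : Monotone (failCount b) := Nat.count_monotone _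

lemma succCount_mono (b : ℕ → Bool) : Monotone (succCount b) := Nat.count_monotone _

/-- Success number `z` happens right after the failures preceding it. -/
lemma nth_success {b : ℕ → Bool} (hb : {j | b j = true}.Infinite) (z : ℕ) :
    succCount b (z + failsBefore b z) = z ∧ failCount b (z + failsBefore b z) = failsBefore b z ∧
      b (z + failsBefore b z) = true := by
  have h1 : succCount b (Nat.nth (fun j => b j = true) z) = z := Nat.count_nth_of_infinite hb z
  have h2 := succCount_add_failCount b (Nat.nth (fun j => b j = true) z)
  have h3 : z + failsBefore b z = Nat.nth (fun j => b j = true) z := by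
    unfold failsBefore; omega
  rw [h3]
  exact ⟨h1, by unfold failsBefore; omega, Nat.nth_mem_of_infinite hb z⟩

lemma failCount_le_failsBefore {b : ℕ → Bool} (hb : {j | b j = true}.Infinite) {n z : ℕ}
    (h : succCount b n ≤ z) : failCount b n ≤ failsBefore b z := by
  have h1 := (Nat.count_le_iff_le_nth hb).1 h
  have h3 := nth_success hb z
  rw [← h3.2.1]
  apply failCount_mono
  unfold failsBefore; omega

lemma failsBefore_le_failCount {b : ℕ → Bool} (hb : {j | b j = true}.Infinite) {n z : ℕ}
    (h : z < succCount b n) : failsBefore b z ≤ failCount b n := by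
  have h1 := (Nat.lt_nth_iff_count_lt hb).1 h
  have h3 := nth_success hb z
  rw [← h3.2.1]
  apply failCount_mono
  by_contra hc
  unfold failsBefore at hc
  have := succCount_mono b (show n ≤ z + failsBefore b z by unfold failsBefore; omega)
  omega

lemma failCount_eq_failsBefore {b : ℕ → Bool} (hb : {j | b j = true}.Infinite) {n z : ℕ}
    (h : succCount b n = z + 1) (hlast : b (n - 1) = true) : failCount b n = failsBefore b z := by
  rcases n with _ | n
  · simp [succCount_zero] at h
  simp only [Nat.add_sub_cancel] at hlast
  rw [succCount_succ, if_pos hlast] at h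
  refine le_antisymm ?_ (failsBefore_le_failCount hb (by rw [succCount_succ, if_pos hlast]; omega))
  rw [failCount_succ, if_pos hlast]
  exact failCount_le_failsBefore hb (by omega)

lemma failsBefore_mono {b : ℕ → Bool} (hb : {j | b j = true}.Infinite) :
    Monotone (failsBefore b) := by
  intro y z hyz
  rw [← (nth_success hb y).2.1]
  exact failCount_le_failsBefore hb ((nth_success hb y).1.le.trans hyz)

/-! ### Edge crossings of the walk -/

lemma walkHist_succ (ξ : ℤ → ℕ → Bool) (k : ℕ) :
    walkHist ξ (k + 1) = walk ξ (k + 1) :: walkHist ξ k := rfl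

lemma walkHist_eq_cons (ξ : ℤ → ℕ → Bool) (k : ℕ) :
    walkHist ξ k = walk ξ k :: (walkHist ξ k).tail := by
  cases k <;> rfl

/-- The number of visits to `x` strictly before time `k`. -/
def visits (ξ : ℤ → ℕ → Bool) (k : ℕ) (x : ℤ) : ℕ := (walkHist ξ k).tail.count x

/-- The number of right steps from `x` among the first `k` steps. -/
def rightSteps (ξ : ℤ → ℕ → Bool) (k : ℕ) (x : ℤ) : ℕ := succCount (ξ x) (visits ξ k x)

/-- The number of left steps from `x` among the first `k` steps. -/
def leftSteps (ξ : ℤ → ℕ → Bool) (k : ℕ) (x : ℤ) : ℕ := failCount (ξ x) (visits ξ k x)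

lemma walk_zero (ξ : ℤ → ℕ → Bool) : walk ξ 0 = 0 := rfl

lemma walk_succ (ξ : ℤ → ℕ → Bool) (k : ℕ) :
    walk ξ (k + 1) = walk ξ k + if ξ (walk ξ k) (visits ξ k (walk ξ k)) = true then 1 else -1 :=
  rfl

lemma visits_zero (ξ : ℤ → ℕ → Bool) (x : ℤ) : visits ξ 0 x = 0 := rfl

lemma visits_succ (ξ : ℤ → ℕ → Bool) (k : ℕ) (x : ℤ) :
    visits ξ (k + 1) x = visits ξ k x + if x = walk ξ k then 1 else 0 := by
  unfold visits
  rw [walkHist_succ, List.tail_cons]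
  conv_lhs => rw [walkHist_eq_cons]
  rw [List.count_cons]
  simp only [beq_iff_eq, eq_comm (a := x)]

lemma rightSteps_succ (ξ : ℤ → ℕ → Bool) (k : ℕ) (x : ℤ) :
    rightSteps ξ (k + 1) x = rightSteps ξ k x +
      if x = walk ξ k ∧ ξ (walk ξ k) (visits ξ k (walk ξ k)) = true then 1 else 0 := by
  unfold rightSteps
  rw [visits_succ]
  by_cases h : x = walk ξ k
  · subst h; simp [succCount_succ]
  · simp [h]

lemma leftSteps_succ (ξ : ℤ → ℕ → Bool) (k : ℕ) (x : ℤ) :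
    leftSteps ξ (k + 1) x = leftSteps ξ k x +
      if x = walk ξ k ∧ ¬ ξ (walk ξ k) (visits ξ k (walk ξ k)) = true then 1 else 0 := by
  unfold leftSteps
  rw [visits_succ]
  by_cases h : x = walk ξ k
  · subst h
    by_cases h2 : ξ (walk ξ k) (visits ξ k (walk ξ k)) = true <;> simp [failCount_succ, h2]
  · simp [h]

lemma rightSteps_add_leftSteps (ξ : ℤ → ℕ → Bool) (k : ℕ) (x : ℤ) :
    rightSteps ξ k x + leftSteps ξ k x = visits ξ k x := succCount_add_failCount _ _

/-- Conservation of flow across the edge from `x` to `x + 1`. -/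
lemma rightSteps_sub_leftSteps (ξ : ℤ → ℕ → Bool) (k : ℕ) (x : ℤ) :
    (rightSteps ξ k x : ℤ) - leftSteps ξ k (x + 1) =
      if 0 ≤ x ∧ x < walk ξ k then 1 else if walk ξ k ≤ x ∧ x < 0 then -1 else 0 := by
  induction k with
  | zero =>
    simp only [rightSteps, leftSteps, visits_zero, succCount_zero, failCount_zero, walk_zero]
    split_ifs <;> omega
  | succ k ih =>
    rw [rightSteps_succ, leftSteps_succ, walk_succ]
    generalize ξ (walk ξ k) (visits ξ k (walk ξ k)) = c
    generalize walk ξ k = y at *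
    cases c <;> simp only [Bool.false_eq_true, not_true, not_false_eq_true, and_true, and_false,
      if_true, if_false] <;> push_cast <;> split_ifs at ih ⊢ <;> omega

/-- The last departure from a site to the left of the walk was a right step. -/
lemma last_departure (ξ : ℤ → ℕ → Bool) (k : ℕ) (x : ℤ) (hx : x < walk ξ k) :
    visits ξ k x = 0 ∨ ξ x (visits ξ k x - 1) = true := by
  induction k with
  | zero => left; exact visits_zero ξ x
  | succ k ih =>
    rw [walk_succ] at hx
    rw [visits_succ]
    by_cases h : x = walk ξ k
    · right
      subst h
      simp only [if_true, Nat.add_sub_cancel]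
      by_contra hc
      rw [if_neg hc] at hx
      omega
    · simp only [h, if_false, add_zero]
      apply ih
      split_ifs at hx <;> omega

lemma sum_visits_le (ξ : ℤ → ℕ → Bool) (n : ℕ) (B : ℤ) (M : ℕ) :
    ∑ k ∈ Finset.range M, visits ξ n (B - k) ≤ n := by
  induction n with
  | zero => simp [visits_zero]
  | succ n ih =>
    simp only [visits_succ, Finset.sum_add_distrib]
    have : ∑ k ∈ Finset.range M, (if B - (k : ℤ) = walk ξ n then 1 else 0) ≤ 1 := by
      rw [Finset.sum_ite, Finset.sum_const_zero, add_zero, Finset.sum_const, smul_eq_mul, mul_one,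
        Finset.card_le_one]
      intro a ha c hc
      simp only [Finset.mem_filter] at ha hc
      omega
    omega

lemma sum_visits_eq (ξ : ℤ → ℕ → Bool) (n : ℕ) (B : ℤ) (M : ℕ)
    (h : ∀ j < n, B - M < walk ξ j ∧ walk ξ j ≤ B) :
    ∑ k ∈ Finset.range M, visits ξ n (B - k) = n := by
  induction n with
  | zero => simp [visits_zero]
  | succ n ih =>
    simp only [visits_succ, Finset.sum_add_distrib]
    rw [ih fun j hj => h j (by omega)]
    have h0 := h n (by omega)
    rw [Finset.sum_eq_single_of_mem (B - walk ξ n).toNat]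
    · rw [if_pos (by omega)]
    · rw [Finset.mem_range]; omega
    · intro c _ hc
      rw [if_neg (by omega)]

lemma abs_walk_le (ξ : ℤ → ℕ → Bool) (n : ℕ) : |walk ξ n| ≤ n := by
  induction n with
  | zero => simp [walk_zero]
  | succ n ih =>
    rw [walk_succ]
    rw [abs_le] at *
    push_cast
    split_ifs <;> omega

lemma visits_pos_of_lt (ξ : ℤ → ℕ → Bool) (n : ℕ) {x : ℤ} (h : visits ξ n x ≠ 0) :
    ∃ j < n, walk ξ j = x := by
  induction n with
  | zero => exact absurd (visits_zero ξ x) h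
  | succ n ih =>
    rw [visits_succ] at h
    by_cases hx : x = walk ξ n
    · exact ⟨n, by omega, hx.symm⟩
    · rw [if_neg hx, add_zero] at h
      obtain ⟨j, hj, hjx⟩ := ih h
      exact ⟨j, by omega, hjx⟩

lemma leftSteps_eq_zero (ξ : ℤ → ℕ → Bool) (n : ℕ) {x : ℤ} (h : ∀ j < n, walk ξ j ≠ x) :
    leftSteps ξ n x = 0 := by
  have : visits ξ n x = 0 := by
    by_contra hc
    obtain ⟨j, hj, hjx⟩ := visits_pos_of_lt ξ n hc
    exact h j hj hjx
  simp [leftSteps, this, failCount_zero]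

/-! ### The branching process of left steps -/

/-- The branching process with immigration which explores the left steps from the sites
`m - 1, m - 2, …`. -/
def branching (ξ : ℤ → ℕ → Bool) (m : ℤ) : ℕ → ℕ
  | 0 => 0
  | k + 1 => failsBefore (ξ (m - 1 - k)) (branching ξ m k)

section Comparison

variable {ξ : ℤ → ℕ → Bool}

lemma branching_le_leftSteps (hξ : ∀ x, {j | ξ x j = true}.Infinite) {n m : ℕ}
    (h : (m : ℤ) ≤ walk ξ n) : ∀ k ≤ m, branching ξ m k ≤ leftSteps ξ n (m - k) := by
  intro k hk
  induction k with
  | zero => exact Nat.zero_le _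
  | succ k ih =>
    have ih := ih (by omega)
    have hf := rightSteps_sub_leftSteps ξ n (m - 1 - k)
    rw [if_pos (by omega), show (m : ℤ) - 1 - k + 1 = m - k by ring] at hf
    rw [show (m : ℤ) - (k + 1 : ℕ) = m - 1 - k by push_cast; ring]
    refine (failsBefore_mono (hξ _) ih).trans (failsBefore_le_failCount (hξ _) ?_)
    change _ < rightSteps ξ n (m - 1 - k)
    omega

/-- If the walk is above level `m` at time `n`, then the branching process is small. -/
lemma sum_branching_le (hξ : ∀ x, {j | ξ x j = true}.Infinite) {n m : ℕ}
    (h : (m : ℤ) ≤ walk ξ n) :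
    m + 2 * ∑ k ∈ Finset.range (m + 1), branching ξ m k ≤ n := by
  have h1 := sum_visits_le ξ n m (m + 2)
  simp only [← rightSteps_add_leftSteps, Finset.sum_add_distrib] at h1
  rw [Finset.sum_range_succ', Finset.sum_range_succ (fun k : ℕ => leftSteps ξ n (m - k))] at h1
  have h2 : ∑ k ∈ Finset.range (m + 1), rightSteps ξ n (m - (k + 1 : ℕ)) =
      ∑ k ∈ Finset.range (m + 1), leftSteps ξ n (m - k) + m := by
    have : ∀ k ∈ Finset.range (m + 1), rightSteps ξ n (m - (k + 1 : ℕ)) =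
        leftSteps ξ n (m - k) + if k < m then 1 else 0 := by
      intro k hk
      rw [Finset.mem_range] at hk
      have hf := rightSteps_sub_leftSteps ξ n (m - (k + 1 : ℕ))
      rw [show (m : ℤ) - (k + 1 : ℕ) + 1 = m - k by push_cast; ring] at hf
      push_cast at hf ⊢
      split_ifs at hf ⊢ <;> omega
    rw [Finset.sum_congr rfl this, Finset.sum_add_distrib, Finset.sum_range_succ
      (fun k => if k < m then 1 else 0), if_neg (lt_irrefl _),
      Finset.sum_congr rfl fun k hk => if_pos (Finset.mem_range.1 hk)]
    simp
  have h3 : ∑ k ∈ Finset.range (m + 1), branching ξ m k ≤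
      ∑ k ∈ Finset.range (m + 1), leftSteps ξ n (m - k) :=
    Finset.sum_le_sum fun k hk =>
      branching_le_leftSteps hξ h k (by rw [Finset.mem_range] at hk; omega)
  omega

lemma leftSteps_le_branching (hξ : ∀ x, {j | ξ x j = true}.Infinite) {n m : ℕ}
    (h : ∀ j ≤ n, walk ξ j < m) (k : ℕ) : leftSteps ξ n (m - k) ≤ branching ξ m k := by
  induction k with
  | zero =>
    rw [leftSteps_eq_zero ξ n fun j hj => by have := h j hj.le; push_cast; omega]
    exact Nat.zero_le _
  | succ k ih =>
    have hf := rightSteps_sub_leftSteps ξ n (m - 1 - k)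
    have hn := h n le_rfl
    rw [show (m : ℤ) - 1 - k + 1 = m - k by ring] at hf
    rw [show (m : ℤ) - (k + 1 : ℕ) = m - 1 - k by push_cast; ring]
    refine le_trans ?_ (failsBefore_mono (hξ _) ih)
    rcases Nat.lt_or_ge (leftSteps ξ n (m - k)) (rightSteps ξ n (m - 1 - k)) with hlt | hle
    · have hcase : 0 ≤ (m : ℤ) - 1 - k ∧ (m : ℤ) - 1 - k < walk ξ n := by
        by_contra hc
        rw [if_neg hc] at hf
        split_ifs at hf <;> omega
      rw [if_pos hcase] at hf
      rcases last_departure ξ n _ hcase.2 with h0 | h0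
      · simp [leftSteps, h0, failCount_zero]
      · refine (failCount_eq_failsBefore (hξ _) ?_ h0).le
        change rightSteps ξ n (m - 1 - k) = _
        omega
    · exact failCount_le_failsBefore (hξ _) hle

lemma leftSteps_eq_zero_of_le {n : ℕ} {x y : ℤ}
    (hx : x ≤ 0) (h0 : leftSteps ξ n x = 0) (hyx : y ≤ x) : leftSteps ξ n y = 0 := by
  have key : ∀ i : ℕ, leftSteps ξ n (x - i) = 0 := by
    intro i
    induction i with
    | zero => simpa using h0
    | succ i ih =>
      have hf := rightSteps_sub_leftSteps ξ n (x - (i + 1 : ℕ))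
      rw [show x - ((i + 1 : ℕ) : ℤ) + 1 = x - i by push_cast; ring, ih, if_neg (by omega)] at hf
      have hr : rightSteps ξ n (x - (i + 1 : ℕ)) = 0 := by split_ifs at hf <;> omega
      have hw : ¬ walk ξ n ≤ x - (i + 1 : ℕ) := by
        intro hc
        rw [if_pos ⟨hc, by omega⟩] at hf
        omega
      rcases last_departure ξ n (x - (i + 1 : ℕ)) (by omega) with h | h
      · rw [leftSteps, h, failCount_zero]
      · have hv : visits ξ n (x - (i + 1 : ℕ)) = 0 := by
          by_contra hv
          obtain ⟨v, hv⟩ := Nat.exists_eq_succ_of_ne_zero hv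
          rw [rightSteps, hv, Nat.succ_eq_add_one, succCount_succ] at hr
          rw [hv, Nat.succ_sub_one] at h
          rw [if_pos h] at hr
          omega
        rw [leftSteps, hv, failCount_zero]
  have := key (x - y).toNat
  rwa [show x - ((x - y).toNat : ℤ) = y by omega] at this

/-- If the walk stays below level `m` up to time `n`, then the branching process is large. -/
lemma le_sum_branching (hξ : ∀ x, {j | ξ x j = true}.Infinite) {n m r : ℕ}
    (h : ∀ j ≤ n, walk ξ j < m) (hr : ∃ t, m ≤ t ∧ t ≤ m + r ∧ branching ξ m t = 0) :
    n ≤ m + 2 * ∑ k ∈ Finset.range (m + r + 1), branching ξ m k := by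
  obtain ⟨t, hmt, htr, ht⟩ := hr
  have hzero : ∀ k, t ≤ k → leftSteps ξ n (m - k) = 0 := fun k hk =>
    leftSteps_eq_zero_of_le (x := m - t) (by omega)
      (Nat.le_zero.1 (ht ▸ leftSteps_le_branching hξ h t)) (by omega)
  have hsum := sum_visits_eq ξ n (m - 1) (n + m + t) fun j hj => by
    have h1 := abs_le.1 (abs_walk_le ξ j)
    have h2 := h j hj.le
    push_cast
    omega
  simp only [← rightSteps_add_leftSteps, Finset.sum_add_distrib] at hsum
  have h1 : ∑ k ∈ Finset.range (n + m + t), rightSteps ξ n (m - 1 - k) ≤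
      ∑ k ∈ Finset.range (n + m + t), leftSteps ξ n (m - k) + m := by
    have : ∀ k ∈ Finset.range (n + m + t), rightSteps ξ n (m - 1 - k) ≤
        leftSteps ξ n (m - k) + if k < m then 1 else 0 := by
      intro k _
      have hf := rightSteps_sub_leftSteps ξ n (m - 1 - k)
      rw [show (m : ℤ) - 1 - k + 1 = m - k by ring] at hf
      split_ifs at hf ⊢ <;> omega
    refine (Finset.sum_le_sum this).trans ?_
    rw [Finset.sum_add_distrib, Finset.sum_ite, Finset.sum_const_zero, add_zero, Finset.sum_const,
      smul_eq_mul, mul_one]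
    gcongr
    refine (Finset.card_le_card (t := Finset.range m) fun k hk => ?_).trans (by simp)
    simp only [Finset.mem_filter] at hk
    exact Finset.mem_range.2 hk.2
  have h2 : ∑ k ∈ Finset.range (n + m + t), leftSteps ξ n (m - 1 - k) ≤
      ∑ k ∈ Finset.range (n + m + t), leftSteps ξ n (m - k) := by
    have e := Finset.sum_range_succ' (fun k : ℕ => leftSteps ξ n (m - k)) (n + m + t)
    rw [Finset.sum_range_succ, hzero (n + m + t) (by omega)] at e
    rw [add_zero] at e
    rw [e]
    refine le_trans (le_of_eq ?_) (Nat.le_add_right _ _)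
    refine Finset.sum_congr rfl fun k _ => ?_
    congr 1
    push_cast
    ring
  have h3 : ∑ k ∈ Finset.range (n + m + t), leftSteps ξ n (m - k) ≤
      ∑ k ∈ Finset.range (m + r + 1), branching ξ m k := by
    rw [← Finset.sum_subset (s₁ := Finset.range t) (Finset.range_subset_range.2 (by omega))
      fun k _ hk => hzero k (by simpa using hk)]
    exact (Finset.sum_le_sum fun k _ => leftSteps_le_branching hξ h k).trans
      (Finset.sum_le_sum_of_subset (Finset.range_subset_range.2 (by omega)))
  omega

/-- Every site between the present position of the walk and its past maximum has been
left to the left. -/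
lemma leftSteps_pos {n k : ℕ} (hkn : k ≤ n) {x : ℤ} (hx : x ≤ walk ξ k) (hxn : walk ξ n < x) :
    0 < leftSteps ξ n x := by
  have hf := rightSteps_sub_leftSteps ξ n (x - 1)
  rw [sub_add_cancel, if_neg (by omega)] at hf
  by_cases h0 : x ≤ 0
  · rw [if_pos (by omega)] at hf
    omega
  · rw [if_neg (by omega)] at hf
    have hk := rightSteps_sub_leftSteps ξ k (x - 1)
    rw [if_pos (by omega)] at hk
    have hmono : rightSteps ξ k (x - 1) ≤ rightSteps ξ n (x - 1) :=
      monotone_nat_of_le_succ (f := fun i => rightSteps ξ i (x - 1))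
        (fun i => by rw [rightSteps_succ]; omega) hkn
    omega

/-- If the walk backtracks by more than `r` from a level at least `m` before time `n`, then the
branching process started from level `n + 1` has a long excursion. -/
lemma branching_pos (hξ : ∀ x, {j | ξ x j = true}.Infinite) {n k m r : ℕ} (hkn : k ≤ n)
    (hk : (m : ℤ) ≤ walk ξ k) (hn : walk ξ n < (m : ℤ) - r) :
    ∀ i, n + 1 - m ≤ i → i ≤ n + 1 - m + r → branching ξ (n + 1 : ℕ) i ≠ 0 := by
  intro i hi1 hi2
  have hmk := (abs_le.1 (abs_walk_le ξ k)).2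
  have h1 := leftSteps_le_branching hξ (n := n) (m := n + 1) (fun j hj => by
    have := (abs_le.1 (abs_walk_le ξ j)).2
    push_cast
    omega) i
  have h2 := leftSteps_pos (ξ := ξ) hkn (x := (n + 1 : ℕ) - i) (by omega) (by omega)
  omega

end Comparison

/-- The lower bound for the walk in terms of the branching processes. -/
lemma walk_lt_imp {ξ : ℤ → ℕ → Bool} (hξ : ∀ x, {j | ξ x j = true}.Infinite) {n m r : ℕ}
    (h : walk ξ n < (m : ℤ) - r) :
    n ≤ m + 2 * ∑ k ∈ Finset.range (m + r + 1), branching ξ m k ∨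
      (∀ i, m ≤ i → i ≤ m + r → branching ξ m i ≠ 0) ∨
      (∀ i, n + 1 - m ≤ i → i ≤ n + 1 - m + r → branching ξ (n + 1 : ℕ) i ≠ 0) := by
  by_cases hmax : ∀ j ≤ n, walk ξ j < m
  · by_cases hz : ∃ t, m ≤ t ∧ t ≤ m + r ∧ branching ξ m t = 0
    · exact Or.inl (le_sum_branching hξ hmax hz)
    · refine Or.inr (Or.inl fun i h1 h2 h3 => hz ⟨i, h1, h2, h3⟩)
  · push Not at hmax
    obtain ⟨k, hk, hmk⟩ := hmax
    exact Or.inr (Or.inr (branching_pos hξ hk hmk h))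

/-! ### Reflection -/

/-- Reflecting the cookie stacks reflects the walk. -/
lemma walk_reflect (ξ : ℤ → ℕ → Bool) (n : ℕ) :
    walk (fun x j => !ξ (-x) j) n = -walk ξ n ∧
      ∀ x, visits (fun x j => !ξ (-x) j) n x = visits ξ n (-x) := by
  induction n with
  | zero => exact ⟨rfl, fun x => rfl⟩
  | succ n ih =>
    refine ⟨?_, fun x => ?_⟩
    · rw [walk_succ, walk_succ, ih.1, ih.2, neg_neg]
      cases ξ (walk ξ n) (visits ξ n (walk ξ n)) <;> simp <;> ring
    · rw [visits_succ, visits_succ, ih.1, ih.2]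
      simp [neg_eq_iff_eq_neg]

/-! ### Markov chains on countable state spaces -/

/-- `Z` is a Markov chain with transition kernel `κ` under `P`. -/
structure IsMarkovChain {Ω α : Type*} [MeasurableSpace Ω] [MeasurableSpace α] (P : Measure Ω)
    (κ : Kernel α α) (Z : ℕ → Ω → α) : Prop where
  measurable : ∀ k, Measurable (Z k)
  step : ∀ k (w : ℕ → α), P {ω | ∀ i ≤ k + 1, Z i ω = w i} =
    P {ω | ∀ i ≤ k, Z i ω = w i} * κ (w k) {w (k + 1)}

/-- A function of the first `k + 1` states factors through the path. -/
lemma exists_path_factor {Ω α β : Type*} [Nonempty β] {Z : ℕ → Ω → α} {k : ℕ} {Φ : Ω → β}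
    (hΦ : ∀ ω ω', (∀ i ≤ k, Z i ω = Z i ω') → Φ ω = Φ ω') :
    ∃ Ψ : (Fin (k + 1) → α) → β, ∀ ω, Ψ (fun i => Z i ω) = Φ ω := by
  refine ⟨Function.extend (fun ω (i : Fin (k + 1)) => Z i ω) Φ fun _ => Classical.arbitrary β,
    fun ω => Function.FactorsThrough.extend_apply (f := fun ω (i : Fin (k + 1)) => Z i ω) ?_ _ ω⟩
  intro ω ω' hω
  exact hΦ ω ω' fun i hi => congrFun hω ⟨i, by omega⟩

section ChainStep

variable {Ω α : Type*} [MeasurableSpace Ω] [MeasurableSpace α] [Countable α]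
  [MeasurableSingletonClass α] {P : Measure Ω} [IsProbabilityMeasure P] {κ : Kernel α α}
  [IsMarkovKernel κ] {Z : ℕ → Ω → α}

lemma IsMarkovChain.map_path (h : IsMarkovChain P κ Z) (k : ℕ) :
    P.map (fun ω => ((fun i : Fin (k + 1) => Z i ω), Z (k + 1) ω)) =
      P.map (fun ω (i : Fin (k + 1)) => Z i ω) ⊗ₘ
        κ.comap (fun w : Fin (k + 1) → α => w (Fin.last k)) (measurable_of_countable _) := by
  have hpath : Measurable (fun ω (i : Fin (k + 1)) => Z i ω) :=
    measurable_pi_lambda _ fun i => h.measurable i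
  have : IsProbabilityMeasure (P.map (fun ω (i : Fin (k + 1)) => Z i ω)) :=
    Measure.isProbabilityMeasure_map hpath.aemeasurable
  refine Measure.ext_of_singleton fun ⟨w, y⟩ => ?_
  rw [Measure.map_apply (hpath.prodMk (h.measurable _)) (measurableSet_singleton _),
    ← singleton_prod_singleton,
    Measure.compProd_apply_prod (measurableSet_singleton _) (measurableSet_singleton _),
    lintegral_singleton, Measure.map_apply hpath (measurableSet_singleton _), Kernel.comap_apply,
    mul_comm]
  have h1 := h.step k (fun i => if hi : i < k + 1 then w ⟨i, hi⟩ else y)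
  simp only [lt_irrefl, dite_false] at h1
  rw [dif_pos (Nat.lt_succ_self k)] at h1
  convert h1 using 2
  · ext ω
    simp only [mem_preimage, mem_prod, mem_singleton_iff, mem_ofPred_eq]
    constructor
    · rintro ⟨rfl, rfl⟩ i hi
      split_ifs with h2
      · rfl
      · rw [show i = k + 1 by omega]
    · intro h2
      refine ⟨funext fun i => ?_, ?_⟩
      · rw [h2 i (by omega), dif_pos i.2]
      · rw [h2 (k + 1) le_rfl, dif_neg (lt_irrefl _)]
  · congr 1
    ext ω
    simp only [mem_preimage, mem_singleton_iff, mem_ofPred_eq]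
    constructor
    · rintro rfl i hi
      rw [dif_pos (by omega)]
    · intro h2
      exact funext fun i => by rw [h2 i (by omega), dif_pos i.2]
  · rfl

lemma IsMarkovChain.lintegral_step (h : IsMarkovChain P κ Z) (k : ℕ) (Φ : Ω → α → ENNReal)
    (hΦ : ∀ ω ω', (∀ i ≤ k, Z i ω = Z i ω') → Φ ω = Φ ω') :
    ∫⁻ ω, Φ ω (Z (k + 1) ω) ∂P = ∫⁻ ω, ∫⁻ y, Φ ω y ∂κ (Z k ω) ∂P := by
  obtain ⟨Ψ, hΨ⟩ := exists_path_factor hΦ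
  have hpath : Measurable (fun ω (i : Fin (k + 1)) => Z i ω) :=
    measurable_pi_lambda _ fun i => h.measurable i
  have : IsProbabilityMeasure (P.map (fun ω (i : Fin (k + 1)) => Z i ω)) :=
    Measure.isProbabilityMeasure_map hpath.aemeasurable
  simp only [← hΨ]
  have h1 := lintegral_map (μ := P) (f := fun q : (Fin (k + 1) → α) × α => Ψ q.1 q.2)
    (measurable_of_countable _) (hpath.prodMk (h.measurable (k + 1)))
  rw [h.map_path, Measure.lintegral_compProd (measurable_of_countable _),
    lintegral_map (measurable_of_countable _) hpath] at h1
  exact h1.symm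

lemma IsMarkovChain.integral_step {E : Type*} [NormedAddCommGroup E] [NormedSpace ℝ E]
    [MeasurableSpace E] [BorelSpace E] [SecondCountableTopology E]
    (h : IsMarkovChain P κ Z) (k : ℕ) (Φ : Ω → α → E)
    (hΦ : ∀ ω ω', (∀ i ≤ k, Z i ω = Z i ω') → Φ ω = Φ ω')
    (h_int : Integrable (fun ω => Φ ω (Z (k + 1) ω)) P) :
    ∫ ω, Φ ω (Z (k + 1) ω) ∂P = ∫ ω, ∫ y, Φ ω y ∂κ (Z k ω) ∂P := by
  obtain ⟨Ψ, hΨ⟩ := exists_path_factor hΦ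
  have hpath : Measurable (fun ω (i : Fin (k + 1)) => Z i ω) :=
    measurable_pi_lambda _ fun i => h.measurable i
  have : IsProbabilityMeasure (P.map (fun ω (i : Fin (k + 1)) => Z i ω)) :=
    Measure.isProbabilityMeasure_map hpath.aemeasurable
  simp only [← hΨ] at h_int ⊢
  have hm : Measurable (fun q : (Fin (k + 1) → α) × α => Ψ q.1 q.2) := measurable_of_countable _
  have hpair := hpath.prodMk (h.measurable (k + 1))
  have h1 := integral_map (μ := P) hpair.aemeasurable (f := fun q => Ψ q.1 q.2)
    hm.aestronglyMeasurable
  have h2 : Integrable (fun q : (Fin (k + 1) → α) × α => Ψ q.1 q.2)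
      (P.map (fun ω => ((fun i : Fin (k + 1) => Z i ω), Z (k + 1) ω))) :=
    (integrable_map_measure hm.aestronglyMeasurable hpair.aemeasurable).2 h_int
  rw [h.map_path] at h1 h2
  rw [Measure.integral_compProd h2, integral_map hpath.aemeasurable
    (measurable_of_countable _).aestronglyMeasurable] at h1
  exact h1.symm

end ChainStep

/-! ### Drift conditions -/

/-- The weight `V` satisfies a geometric drift condition for the kernel `κ`. -/
structure Drift (κ : Kernel ℕ ℕ) (V : ℕ → ℝ) : Prop where
  one_le : ∀ z, 1 ≤ V z
  tendsto : Tendsto V atTop atTop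
  integrable : ∀ z, Integrable V (κ z)
  le : ∃ C, ∀ z, ∫ y, V y ∂κ z ≤ V z / 2 + C

lemma Drift.integrable_of_le {E : Type*} [NormedAddCommGroup E] [MeasurableSpace E] [BorelSpace E]
    [SecondCountableTopology E] {κ : Kernel ℕ ℕ} {V : ℕ → ℝ} (h : Drift κ V) {f : ℕ → E} {c : ℝ}
    (hf : ∀ z, ‖f z‖ ≤ c * V z) (z : ℕ) : Integrable f (κ z) :=
  ((h.integrable z).const_mul c).mono' (measurable_of_countable f).aestronglyMeasurable
    (ae_of_all _ hf)

section DriftLemmas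

variable {κ : Kernel ℕ ℕ} [IsMarkovKernel κ] {V : ℕ → ℝ}

lemma Drift.lintegral_le {Ω : Type*} [MeasurableSpace Ω] {P : Measure Ω} [IsProbabilityMeasure P]
    (h : Drift κ V) :
    ∃ C : ℝ, 1 ≤ C ∧ ∀ Z : ℕ → Ω → ℕ, IsMarkovChain P κ Z → (∀ ω, Z 0 ω = 0) →
      ∀ k, ∫⁻ ω, ENNReal.ofReal (V (Z k ω)) ∂P ≤ ENNReal.ofReal C := by
  obtain ⟨C, hC⟩ := h.le
  have hV0 := h.one_le 0
  have hCm := le_max_left C 0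
  have hCm0 := le_max_right C 0
  refine ⟨V 0 + 2 * max C 0, by linarith, fun Z hZ hZ0 k => ?_⟩
  induction k with
  | zero =>
    simp only [hZ0, lintegral_const, measure_univ, mul_one]
    exact ENNReal.ofReal_le_ofReal (by linarith)
  | succ k ih =>
    rw [hZ.lintegral_step k (fun _ y => ENNReal.ofReal (V y)) fun _ _ _ => rfl]
    have h1 : ∀ z, ∫⁻ y, ENNReal.ofReal (V y) ∂κ z ≤
        ENNReal.ofReal (1 / 2) * ENNReal.ofReal (V z) + ENNReal.ofReal (max C 0) := by
      intro z
      have := h.one_le z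
      rw [← ofReal_integral_eq_lintegral_ofReal (h.integrable z)
        (ae_of_all _ fun y => zero_le_one.trans (h.one_le y)),
        ← ENNReal.ofReal_mul (by norm_num), ← ENNReal.ofReal_add (by positivity) hCm0]
      exact ENNReal.ofReal_le_ofReal (by linarith [hC z])
    refine (lintegral_mono fun ω => h1 (Z k ω)).trans ?_
    rw [lintegral_add_right _ measurable_const, lintegral_const_mul' _ _ ENNReal.ofReal_ne_top,
      lintegral_const, measure_univ, mul_one]
    calc _ ≤ ENNReal.ofReal (1 / 2) * ENNReal.ofReal (V 0 + 2 * max C 0) +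
          ENNReal.ofReal (max C 0) := by gcongr
      _ = ENNReal.ofReal (1 / 2 * (V 0 + 2 * max C 0) + max C 0) := by
        rw [← ENNReal.ofReal_mul (by norm_num), ← ENNReal.ofReal_add (by positivity) hCm0]
      _ ≤ _ := ENNReal.ofReal_le_ofReal (by linarith)

lemma Drift.integrable_comp {Ω E : Type*} [MeasurableSpace Ω] {P : Measure Ω}
    [IsProbabilityMeasure P] [NormedAddCommGroup E] [MeasurableSpace E] [BorelSpace E]
    [SecondCountableTopology E] (h : Drift κ V)
    {Z : ℕ → Ω → ℕ} (hZ : IsMarkovChain P κ Z) (hZ0 : ∀ ω, Z 0 ω = 0)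
    {f : ℕ → E} {c : ℝ} (hf : ∀ z, ‖f z‖ ≤ c * V z) (k : ℕ) :
    Integrable (fun ω => f (Z k ω)) P := by
  obtain ⟨C, -, hC⟩ := h.lintegral_le (P := P)
  have hm : Measurable fun ω => V (Z k ω) := (measurable_of_countable V).comp (hZ.measurable k)
  have h1 : Integrable (fun ω => V (Z k ω)) P := by
    refine ⟨hm.aestronglyMeasurable, ?_⟩
    rw [hasFiniteIntegral_iff_ofReal (ae_of_all _ fun ω => zero_le_one.trans (h.one_le _))]
    exact (hC Z hZ hZ0 k).trans_lt ENNReal.ofReal_lt_top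
  exact (h1.const_mul c).mono'
    ((measurable_of_countable f).comp (hZ.measurable k)).aestronglyMeasurable
    (ae_of_all _ fun ω => hf _)

lemma Drift.integral_comp_le {Ω : Type*} [MeasurableSpace Ω] {P : Measure Ω}
    [IsProbabilityMeasure P] (h : Drift κ V) :
    ∃ C : ℝ, 1 ≤ C ∧ ∀ Z : ℕ → Ω → ℕ, IsMarkovChain P κ Z → (∀ ω, Z 0 ω = 0) →
      ∀ k, ∫ ω, V (Z k ω) ∂P ≤ C := by
  obtain ⟨C, hC1, hC⟩ := h.lintegral_le (P := P)
  refine ⟨C, hC1, fun Z hZ hZ0 k => ?_⟩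
  rw [integral_eq_lintegral_of_nonneg_ae (ae_of_all _ fun ω => zero_le_one.trans (h.one_le _))
    ((measurable_of_countable V).comp (hZ.measurable k)).aestronglyMeasurable]
  exact ENNReal.toReal_le_of_le_ofReal (by linarith) (hC Z hZ hZ0 k)

/-- The killed kernel contracts a modification of the weight. -/
lemma Drift.exists_killed (h : Drift κ V) (h0 : ∀ z, κ z {0} ≠ 0) :
    ∃ A ρ : ℝ, 0 ≤ A ∧ 0 < ρ ∧ ρ < 1 ∧
      ∀ z, ∫ y in {0}ᶜ, (A + V y) ∂κ z ≤ ρ * (A + V z) := by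
  obtain ⟨C, hC⟩ := h.le
  have hCm := le_max_left C 0
  have hCm0 := le_max_right C 0
  set D := max C 0 with hD
  obtain ⟨z₀, hz₀⟩ := eventually_atTop.1 (h.tendsto.eventually_ge_atTop (4 * D + 4))
  obtain ⟨δ, hδ0, hδ1, hδ⟩ : ∃ δ : ℝ, 0 < δ ∧ δ ≤ 1 ∧ ∀ z < z₀, δ ≤ (κ z).real {0} := by
    obtain ⟨δ, hδ0, hδ⟩ : ∃ δ : ℝ, 0 < δ ∧ ∀ z ∈ Finset.range z₀, δ ≤ (κ z).real {0} := by
      induction Finset.range z₀ using Finset.induction_on with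
      | empty => exact ⟨1, one_pos, by simp⟩
      | insert a s _ ih =>
        obtain ⟨δ, hδ, hs⟩ := ih
        have ha : 0 < (κ a).real {0} :=
          ENNReal.toReal_pos (h0 a) (measure_ne_top _ _)
        refine ⟨min δ ((κ a).real {0}), lt_min hδ ha, fun z hz => ?_⟩
        rcases Finset.mem_insert.1 hz with rfl | hz
        · exact min_le_right _ _
        · exact (min_le_left _ _).trans (hs z hz)
    exact ⟨min δ 1, lt_min hδ0 one_pos, min_le_right _ _, fun z hz =>
      (min_le_left _ _).trans (hδ z (Finset.mem_range.2 hz))⟩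
  have hA : 0 ≤ 2 * D / δ := by positivity
  set A := 2 * D / δ with hAdef
  have hAδ : A * δ = 2 * D := by rw [hAdef]; field_simp
  set ρ := max (3 / 4) (max (1 - δ / 2) (1 - 1 / (A + 1))) with hρdef
  have hρ1 : 3 / 4 ≤ ρ := le_max_left _ _
  have hρ2 : 1 - δ / 2 ≤ ρ := (le_max_left _ _).trans (le_max_right _ _)
  have hρ3 : 1 - 1 / (A + 1) ≤ ρ := (le_max_right _ _).trans (le_max_right _ _)
  refine ⟨A, ρ, hA, by linarith, ?_, fun z => ?_⟩
  · refine max_lt (by norm_num) (max_lt (by linarith) ?_)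
    have : 0 < 1 / (A + 1) := by positivity
    linarith
  have hVz := h.one_le z
  have hi : IntegrableOn V {0}ᶜ (κ z) := (h.integrable z).integrableOn
  rw [integral_add (integrable_const _).integrableOn hi, setIntegral_const, smul_eq_mul]
  have h1 : ∫ y in {0}ᶜ, V y ∂κ z ≤ V z / 2 + D :=
    (setIntegral_le_integral (h.integrable z)
      (ae_of_all _ fun y => zero_le_one.trans (h.one_le y))).trans ((hC z).trans (by linarith))
  have h2 : (κ z).real {0}ᶜ = 1 - (κ z).real {0} := by
    rw [measureReal_compl (measurableSet_singleton 0), probReal_univ]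
  rw [h2]
  rcases lt_or_ge z z₀ with hz | hz
  · have h3 := hδ z hz
    have h4 : (1 - (κ z).real {0}) * A ≤ (1 - δ) * A := by gcongr
    have h5 : (1 - δ / 2) * A ≤ ρ * A := by gcongr
    nlinarith
  · have h3 := hz₀ z hz
    have h4 : (1 - (κ z).real {0}) * A ≤ 1 * A := by
      gcongr
      linarith [measureReal_nonneg (μ := κ z) (s := {0})]
    have h5 : (1 - ρ) * A ≤ 1 := by
      have : (1 - ρ) * (A + 1) ≤ 1 := by
        have h6 : (1 - ρ) * (A + 1) ≤ 1 / (A + 1) * (A + 1) := by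
          gcongr
          linarith
        rwa [one_div_mul_cancel (by positivity)] at h6
      have h7 : ρ ≤ 1 := max_le (by norm_num) (max_le (by linarith)
        (by have : 0 < 1 / (A + 1) := by positivity
            linarith))
      nlinarith
    nlinarith

/-- Long excursions away from zero are exponentially unlikely. -/
lemma Drift.excursion_le {Ω : Type*} [MeasurableSpace Ω] {P : Measure Ω} [IsProbabilityMeasure P]
    (h : Drift κ V) (h0 : ∀ z, κ z {0} ≠ 0) :
    ∃ C ρ : ℝ, 0 ≤ C ∧ 0 < ρ ∧ ρ < 1 ∧ ∀ Z : ℕ → Ω → ℕ, IsMarkovChain P κ Z → (∀ ω, Z 0 ω = 0) →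
      ∀ k r, P.real {ω | ∀ i, k ≤ i → i ≤ k + r → Z i ω ≠ 0} ≤ C * ρ ^ r := by
  obtain ⟨A, ρ, hA, hρ0, hρ1, hQ⟩ := h.exists_killed h0
  obtain ⟨C, hC1, hC⟩ := h.lintegral_le (P := P)
  have hW : ∀ z, 0 ≤ A + V z := fun z => by linarith [h.one_le z]
  refine ⟨A + C, ρ, by linarith, hρ0, hρ1, fun Z hZ hZ0 k r => ?_⟩
  have key : ∫⁻ ω, (if ∀ i, k ≤ i → i ≤ k + r → Z i ω ≠ 0 then
      ENNReal.ofReal (A + V (Z (k + r) ω)) else 0) ∂P ≤ ENNReal.ofReal ((A + C) * ρ ^ r) := by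
    induction r with
    | zero =>
      calc _ ≤ ∫⁻ ω, (ENNReal.ofReal A + ENNReal.ofReal (V (Z k ω))) ∂P := by
            refine lintegral_mono fun ω => ?_
            dsimp only
            split_ifs
            · exact ENNReal.ofReal_add_le
            · exact bot_le
        _ ≤ ENNReal.ofReal A + ENNReal.ofReal C := by
            rw [lintegral_add_left measurable_const, lintegral_const, measure_univ, mul_one]
            gcongr
            exact hC Z hZ hZ0 k
        _ = _ := by rw [← ENNReal.ofReal_add hA (by linarith), pow_zero, mul_one]
    | succ r ih =>
      have h1 := hZ.lintegral_step (k + r) (fun ω y =>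
        if ∀ i, k ≤ i → i ≤ k + r → Z i ω ≠ 0 then
          (if y ≠ 0 then ENNReal.ofReal (A + V y) else 0) else 0) (by
            intro ω ω' hω
            have : (∀ i, k ≤ i → i ≤ k + r → Z i ω ≠ 0) ↔
                (∀ i, k ≤ i → i ≤ k + r → Z i ω' ≠ 0) :=
              forall_congr' fun i => forall_congr' fun _ => forall_congr' fun hi => by rw [hω i hi]
            simp only [this])
      have h2 : ∀ ω, (if ∀ i, k ≤ i → i ≤ k + (r + 1) → Z i ω ≠ 0 then
          ENNReal.ofReal (A + V (Z (k + (r + 1)) ω)) else 0) =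
          if ∀ i, k ≤ i → i ≤ k + r → Z i ω ≠ 0 then
          (if Z (k + r + 1) ω ≠ 0 then ENNReal.ofReal (A + V (Z (k + r + 1) ω)) else 0) else 0 := by
        intro ω
        rw [← ite_and, ← add_assoc]
        congr 1
        refine propext ⟨fun hh => ⟨fun i h1 h2 => hh i h1 (by omega),
          hh _ (by omega) (by omega)⟩, fun hh i h1 h2 => ?_⟩
        rcases Nat.lt_or_ge i (k + r + 1) with h3 | h3
        · exact hh.1 i h1 (by omega)
        · rw [show i = k + r + 1 by omega]
          exact hh.2
      rw [lintegral_congr h2, h1]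
      have h3 : ∀ z, ∫⁻ y, (if y ≠ 0 then ENNReal.ofReal (A + V y) else 0) ∂κ z ≤
          ENNReal.ofReal ρ * ENNReal.ofReal (A + V z) := by
        intro z
        rw [← ENNReal.ofReal_mul hρ0.le]
        refine le_trans (le_of_eq ?_) (ENNReal.ofReal_le_ofReal (hQ z))
        rw [ofReal_integral_eq_lintegral_ofReal
          (show Integrable (fun y => A + V y) (κ z) from
            (integrable_const A).add (h.integrable z)).integrableOn (ae_of_all _ hW),
          ← lintegral_indicator (measurableSet_singleton 0).compl]
        refine lintegral_congr fun y => ?_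
        by_cases hy : y = 0 <;> simp [hy]
      calc _ ≤ ∫⁻ ω, ENNReal.ofReal ρ * (if ∀ i, k ≤ i → i ≤ k + r → Z i ω ≠ 0 then
            ENNReal.ofReal (A + V (Z (k + r) ω)) else 0) ∂P := by
            refine lintegral_mono fun ω => ?_
            dsimp only
            split_ifs
            · exact h3 _
            · simp
        _ ≤ ENNReal.ofReal ρ * ENNReal.ofReal ((A + C) * ρ ^ r) := by
            rw [lintegral_const_mul' _ _ ENNReal.ofReal_ne_top]
            gcongr
        _ = _ := by rw [← ENNReal.ofReal_mul hρ0.le]; congr 1; ring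
  have hS : MeasurableSet {ω | ∀ i, k ≤ i → i ≤ k + r → Z i ω ≠ 0} := by
    have : {ω | ∀ i, k ≤ i → i ≤ k + r → Z i ω ≠ 0} =
        ⋂ i ∈ Finset.Icc k (k + r), Z i ⁻¹' {0}ᶜ := by
      ext ω
      simp
    rw [this]
    exact Finset.measurableSet_biInter _ fun i _ =>
      hZ.measurable i (measurableSet_singleton 0).compl
  refine ENNReal.toReal_le_of_le_ofReal (by positivity) (le_trans ?_ key)
  rw [← lintegral_indicator_one hS]
  refine lintegral_mono fun ω => ?_
  by_cases hω : ∀ i, k ≤ i → i ≤ k + r → Z i ω ≠ 0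
  · rw [if_pos hω, indicator_of_mem (by exact hω)]
    exact ENNReal.one_le_ofReal.2 (by linarith [h.one_le (Z (k + r) ω)])
  · rw [if_neg hω, indicator_of_notMem (by exact hω)]

end DriftLemmas

/-! ### The Poisson equation -/

section Poisson

variable {κ : Kernel ℕ ℕ} [IsMarkovKernel κ] {V : ℕ → ℝ}

/-- The Green function of the kernel killed at zero. -/
lemma Drift.exists_green (h : Drift κ V) (h0 : ∀ z, κ z {0} ≠ 0) {g : ℕ → ℝ} {c : ℝ}
    (hg : ∀ z, |g z| ≤ c * V z) :
    ∃ (f : ℕ → ℝ) (C : ℝ), (∀ z, |f z| ≤ C * V z) ∧ (∀ z, f z = g z + ∫ y in {0}ᶜ, f y ∂κ z) ∧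
      ((∀ z, 0 ≤ g z) → ∀ z, g z ≤ f z) := by
  obtain ⟨A, ρ, hA, hρ0, hρ1, hQ⟩ := h.exists_killed h0
  have hc : 0 ≤ c := by
    have h1 := (abs_nonneg (g 0)).trans (hg 0)
    exact nonneg_of_mul_nonneg_left h1 (zero_lt_one.trans_le (h.one_le 0))
  have hW : ∀ z, V z ≤ A + V z := fun z => by linarith
  have hW0 : ∀ z, 0 ≤ A + V z := fun z => by linarith [h.one_le z]
  have hWi : ∀ z, Integrable (fun y => A + V y) (κ z) := fun z =>
    (integrable_const A).add (h.integrable z)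
  set F : ℕ → ℕ → ℝ := fun n =>
    Nat.rec g (fun _ f z => ∫ y in {0}ᶜ, f y ∂κ z) n with hF
  have hF0 : F 0 = g := rfl
  have hFs : ∀ n z, F (n + 1) z = ∫ y in {0}ᶜ, F n y ∂κ z := fun n z => rfl
  have hFb : ∀ n z, |F n z| ≤ c * ρ ^ n * (A + V z) := by
    intro n
    induction n with
    | zero =>
      intro z
      rw [hF0, pow_zero, mul_one]
      exact (hg z).trans (by gcongr; exact hW z)
    | succ n ih =>
      intro z
      rw [hFs]
      rw [← Real.norm_eq_abs]
      calc ‖∫ y in {0}ᶜ, F n y ∂κ z‖ ≤ ∫ y in {0}ᶜ, c * ρ ^ n * (A + V y) ∂κ z :=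
            norm_integral_le_of_norm_le ((hWi z).integrableOn.const_mul _) (ae_of_all _ ih)
        _ = c * ρ ^ n * ∫ y in {0}ᶜ, (A + V y) ∂κ z := integral_const_mul _ _
        _ ≤ c * ρ ^ n * (ρ * (A + V z)) := by gcongr; exact hQ z
        _ = _ := by ring
  have hFi : ∀ n z, IntegrableOn (F n) {0}ᶜ (κ z) := fun n z =>
    (((hWi z).const_mul (c * ρ ^ n)).mono' (measurable_of_countable _).aestronglyMeasurable
      (ae_of_all _ (hFb n))).integrableOn
  have hgeo : Summable fun n : ℕ => ρ ^ n := summable_geometric_of_lt_one hρ0.le hρ1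
  have hbs : ∀ z, Summable fun n : ℕ => c * ρ ^ n * (A + V z) := fun z =>
    (hgeo.mul_left c).mul_right _
  have hFsum : ∀ z, Summable fun n => F n z := fun z =>
    Summable.of_norm_bounded (hbs z) fun n => hFb n z
  refine ⟨fun z => ∑' n, F n z, c * (1 - ρ)⁻¹ * (A + 1), fun z => ?_, fun z => ?_,
    fun hg0 z => ?_⟩
  · rw [← Real.norm_eq_abs]
    calc ‖∑' n, F n z‖ ≤ ∑' n : ℕ, c * ρ ^ n * (A + V z) :=
          tsum_of_norm_bounded (hbs z).hasSum fun n => hFb n z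
      _ = c * (1 - ρ)⁻¹ * (A + V z) := by
          rw [tsum_mul_right, tsum_mul_left, tsum_geometric_of_lt_one hρ0.le hρ1]
      _ ≤ c * (1 - ρ)⁻¹ * ((A + 1) * V z) := by
          have := sub_pos.2 hρ1
          gcongr
          nlinarith [h.one_le z]
      _ = _ := by ring
  · dsimp only
    have h1 : HasSum (fun n => ∫ y in {0}ᶜ, F n y ∂κ z) (∫ y in {0}ᶜ, ∑' n, F n y ∂κ z) := by
      refine hasSum_integral_of_summable_integral_norm (fun n => hFi n z) ?_
      refine Summable.of_nonneg_of_le (fun n => integral_nonneg fun y => norm_nonneg _)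
        (fun n => ?_) (hbs z)
      calc ∫ y in {0}ᶜ, ‖F n y‖ ∂κ z ≤ ∫ y in {0}ᶜ, c * ρ ^ n * (A + V y) ∂κ z :=
            integral_mono (hFi n z).norm ((hWi z).integrableOn.const_mul _) (hFb n)
        _ = c * ρ ^ n * ∫ y in {0}ᶜ, (A + V y) ∂κ z := integral_const_mul _ _
        _ ≤ c * ρ ^ n * (A + V z) := by
            gcongr
            exact (hQ z).trans (mul_le_of_le_one_left (hW0 z) hρ1.le)
    rw [(hFsum z).tsum_eq_zero_add, ← h1.tsum_eq]
    rfl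
  · have hF0n : ∀ n z, 0 ≤ F n z := by
      intro n
      induction n with
      | zero => exact hg0
      | succ n ih => exact fun z => integral_nonneg ih
    exact (hFsum z).le_tsum 0 fun n _ => hF0n n z

/-- Solution of the Poisson equation, vanishing at zero. -/
lemma Drift.exists_poisson (h : Drift κ V) (h0 : ∀ z, κ z {0} ≠ 0) {g : ℕ → ℝ} {c : ℝ}
    (hg : ∀ z, |g z| ≤ c * V z) :
    ∃ (f : ℕ → ℝ) (a C : ℝ), 0 ≤ C ∧ (∀ z, |f z| ≤ C * V z) ∧ f 0 = 0 ∧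
      (∀ z, f z = g z - a + ∫ y, f y ∂κ z) ∧ ((∀ z, 0 ≤ g z) → 0 ≤ a ∧ (0 < g 0 → 0 < a)) := by
  obtain ⟨f, C, hfC, hf, hfp⟩ := h.exists_green h0 hg
  obtain ⟨e, D, heD, he, hep⟩ := h.exists_green h0 (g := fun _ => 1) (c := 1)
    (fun z => by simpa using h.one_le z)
  have he0 : 0 < e 0 := zero_lt_one.trans_le (hep (fun _ => zero_le_one) 0)
  set a := f 0 / e 0 with ha
  have hC : ∀ z, |f z - a * e z| ≤ (C + |a| * D) * V z := by
    intro z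
    calc |f z - a * e z| ≤ |f z| + |a * e z| := abs_sub _ _
      _ ≤ C * V z + |a| * (D * V z) := by
        rw [abs_mul]
        gcongr
        exacts [hfC z, heD z]
      _ = _ := by ring
  have hz : f 0 - a * e 0 = 0 := by rw [ha]; field_simp; ring
  refine ⟨fun z => f z - a * e z, a, C + |a| * D, ?_, hC, hz, fun z => ?_, fun hg0 => ⟨?_, ?_⟩⟩
  · exact nonneg_of_mul_nonneg_left ((abs_nonneg _).trans (hC 0))
      (zero_lt_one.trans_le (h.one_le 0))
  · have hi : Integrable (fun y => f y - a * e y) (κ z) := h.integrable_of_le hC z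
    have hfi : Integrable f (κ z) := h.integrable_of_le hfC z
    have hei : Integrable e (κ z) := h.integrable_of_le heD z
    have h1 : ∫ y, (f y - a * e y) ∂κ z = ∫ y in {0}ᶜ, (f y - a * e y) ∂κ z := by
      rw [setIntegral_eq_integral_of_forall_compl_eq_zero]
      intro y hy
      have : y = 0 := by simpa using hy
      rw [this, hz]
    rw [h1, integral_sub hfi.integrableOn (hei.integrableOn.const_mul a), integral_const_mul]
    linear_combination hf z - a * he z
  · exact div_nonneg ((hg0 0).trans (hfp hg0 0)) he0.le
  · exact fun h1 => div_pos (h1.trans_le (hfp hg0 0)) he0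

end Poisson

/-! ### Correctors for the additive functional -/

lemma Drift.exists_integral_le {κ : Kernel ℕ ℕ} {V : ℕ → ℝ} (h : Drift κ V) : ∃ D, 1 ≤ D ∧
    ∀ z, ∫ y, V y ∂κ z ≤ D * V z := by
  obtain ⟨C, hC⟩ := h.le
  refine ⟨1 + |C|, by linarith [abs_nonneg C], fun z => (hC z).trans ?_⟩
  have := h.one_le z
  nlinarith [le_abs_self C, abs_nonneg C]

lemma Drift.abs_integral_le {κ : Kernel ℕ ℕ} {V : ℕ → ℝ} (h : Drift κ V) {f : ℕ → ℝ} {c D : ℝ} (hc : 0 ≤ c)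
    (hf : ∀ z, |f z| ≤ c * V z) (hD : ∀ z, ∫ y, V y ∂κ z ≤ D * V z) (z : ℕ) :
    |∫ y, f y ∂κ z| ≤ c * D * V z := by
  rw [← Real.norm_eq_abs]
  calc ‖∫ y, f y ∂κ z‖ ≤ ∫ y, c * V y ∂κ z :=
        norm_integral_le_of_norm_le ((h.integrable z).const_mul _) (ae_of_all _ hf)
    _ = c * ∫ y, V y ∂κ z := integral_const_mul _ _
    _ ≤ c * (D * V z) := by gcongr; exact hD z
    _ = _ := by ring

section Corrector

variable {κ : Kernel ℕ ℕ} [IsMarkovKernel κ] {V : ℕ → ℝ}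

/-- First and second order correctors for the functional `∑ (Z k - a)`. -/
structure Corrector (κ : Kernel ℕ ℕ) (V f q : ℕ → ℝ) (a σ C : ℝ) : Prop where
  a_nonneg : 0 ≤ a
  σ_pos : 0 < σ
  one_le : 1 ≤ C
  σ_le : σ ^ 2 ≤ C
  cent_le : ∀ z : ℕ, |z - a| ≤ C * V z
  f_le : ∀ z, |f z| ≤ C * V z
  q_le : ∀ z, |q z| ≤ C * V z ^ 2
  pf_le : ∀ z, |∫ y, f y ∂κ z| ≤ C * V z
  pq_le : ∀ z, |∫ y, q y ∂κ z| ≤ C * V z ^ 2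
  f_zero : f 0 = 0
  q_zero : q 0 = 0
  f_eq : ∀ z, f z = z - a + ∫ y, f y ∂κ z
  q_eq : ∀ z, q z = (z - a) ^ 2 / 2 + (z - a) * ∫ y, f y ∂κ z - σ ^ 2 / 2 + ∫ y, q y ∂κ z

lemma integral_sub_const_sq {ν : Measure ℕ} [IsProbabilityMeasure ν] {f : ℕ → ℝ}
    (hf : Integrable f ν) (hf2 : Integrable (fun y => f y ^ 2) ν) :
    ∫ y, (f y - ∫ x, f x ∂ν) ^ 2 ∂ν = ∫ y, f y ^ 2 ∂ν - (∫ y, f y ∂ν) ^ 2 := by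
  set m := ∫ x, f x ∂ν with hm
  have : ∀ y, (f y - m) ^ 2 = f y ^ 2 - 2 * m * f y + m ^ 2 := fun y => by ring
  simp only [this]
  rw [integral_add (show Integrable (fun y => f y ^ 2 - 2 * m * f y) ν from
    hf2.sub (hf.const_mul _)) (integrable_const _),
    integral_sub hf2 (hf.const_mul _), integral_const_mul, integral_const, ← hm]
  simp
  ring

lemma Drift.exists_corrector (h1 : Drift κ V) (h2 : Drift κ fun z => V z ^ 2)
    (hpos : ∀ z y, κ z {y} ≠ 0) {c : ℝ} (hc : ∀ z : ℕ, (z : ℝ) ≤ c * V z) :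
    ∃ f q a σ C, Corrector κ V f q a σ C := by
  have h0 : ∀ z, κ z {0} ≠ 0 := fun z => hpos z 0
  obtain ⟨f, a, C, hC0, hfC, hf0, hf, hfa⟩ := h1.exists_poisson h0 (g := fun z => (z : ℝ)) (c := c)
    (fun z => by rw [abs_of_nonneg (Nat.cast_nonneg z)]; exact hc z)
  have ha : 0 ≤ a := (hfa fun z => Nat.cast_nonneg z).1
  have hV := h1.one_le
  obtain ⟨D1, hD1, hVD1⟩ := h1.exists_integral_le
  obtain ⟨D2, hD2, hVD2⟩ := h2.exists_integral_le
  have hf2C : ∀ z, |f z ^ 2| ≤ C ^ 2 * V z ^ 2 := by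
    intro z
    rw [abs_pow, ← mul_pow]
    gcongr
    exact hfC z
  have hfi : ∀ z, Integrable f (κ z) := h1.integrable_of_le hfC
  have hf2i : ∀ z, Integrable (fun y => f y ^ 2) (κ z) := h2.integrable_of_le hf2C
  have hPf := h1.abs_integral_le hC0 hfC hVD1
  have hPf2 := h2.abs_integral_le (sq_nonneg C) hf2C hVD2
  set w : ℕ → ℝ := fun z => (∫ y, (f y - ∫ x, f x ∂κ z) ^ 2 ∂κ z) / 2 with hwdef
  have hw : ∀ z, w z = (∫ y, f y ^ 2 ∂κ z - (∫ y, f y ∂κ z) ^ 2) / 2 := fun z => by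
    rw [hwdef]
    simp only
    rw [integral_sub_const_sq (hfi z) (hf2i z)]
  have hw0 : ∀ z, 0 ≤ w z := fun z => by
    have : 0 ≤ ∫ y, (f y - ∫ x, f x ∂κ z) ^ 2 ∂κ z := integral_nonneg fun y => sq_nonneg _
    rw [hwdef]
    positivity
  have hwle : ∀ z, |w z| ≤ C ^ 2 * D2 * V z ^ 2 := by
    intro z
    rw [abs_of_nonneg (hw0 z), hw]
    have h3 := hPf2 z
    have h4 := abs_nonneg (∫ y, f y ^ 2 ∂κ z)
    have h5 := le_abs_self (∫ y, f y ^ 2 ∂κ z)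
    nlinarith [sq_nonneg (∫ y, f y ∂κ z)]
  obtain ⟨q', e, C', hC'0, hqC', hq0, hq, hqe⟩ := h2.exists_poisson h0 hwle
  have he : 0 < e := by
    refine (hqe hw0).2 (lt_of_le_of_ne (hw0 0) fun hw00 => ?_)
    set m := ∫ x, f x ∂κ 0 with hm
    have h3 : ∫ y, (f y - m) ^ 2 ∂κ 0 = 0 := by
      simp only [hwdef] at hw00
      rw [← hm] at hw00
      linarith
    have h3i : Integrable (fun y => (f y - m) ^ 2) (κ 0) := by
      have : ∀ y, (f y - m) ^ 2 = f y ^ 2 - 2 * m * f y + m ^ 2 := fun y => by ring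
      simp only [this]
      exact ((hf2i 0).sub ((hfi 0).const_mul _)).add (integrable_const _)
    rw [integral_eq_zero_iff_of_nonneg (fun y => sq_nonneg _) h3i] at h3
    have h4 : ∀ y, f y = m := by
      intro y
      by_contra hy
      refine hpos 0 y (measure_mono_null ?_ (ae_iff.1 h3))
      rintro x rfl
      simpa [sub_eq_zero] using hy
    have hfz : ∀ y, f y = 0 := fun y => by rw [h4 y, ← h4 0, hf0]
    have h5 := hf 0
    have h6 := hf 1
    simp only [hfz, integral_zero, Nat.cast_zero, Nat.cast_one] at h5 h6
    linarith
  have hV2 : ∀ z, V z ≤ V z ^ 2 := fun z => by nlinarith [hV z]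
  have hq'i : ∀ z, Integrable q' (κ z) := h2.integrable_of_le hqC'
  have hPq' := h2.abs_integral_le hC'0 hqC' hVD2
  have hPq : ∀ z, ∫ y, (q' y + f y ^ 2 / 2) ∂κ z =
      ∫ y, q' y ∂κ z + (∫ y, f y ^ 2 ∂κ z) / 2 := fun z => by
    rw [integral_add (hq'i z) ((hf2i z).div_const 2), integral_div]
  have hc0 : 0 ≤ c := by
    have := hc 0
    rw [Nat.cast_zero] at this
    exact nonneg_of_mul_nonneg_left this (zero_lt_one.trans_le (hV 0))
  have hs : Real.sqrt (2 * e) ^ 2 = 2 * e := Real.sq_sqrt (by positivity)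
  set M := 1 + 2 * e + (c + a) + C + (C' + C ^ 2) + C * D1 + (C' * D2 + C ^ 2 * D2) with hM
  have hD10 : 0 ≤ D1 := by linarith
  have hD20 : 0 ≤ D2 := by linarith
  have hm1 : 0 ≤ C * D1 := by positivity
  have hm2 : 0 ≤ C' * D2 := by positivity
  have hm3 : 0 ≤ C ^ 2 * D2 := by positivity
  have hm4 : 0 ≤ C ^ 2 := by positivity
  have up : ∀ {x t u : ℝ}, x ≤ t * u → 1 ≤ u → t ≤ M → x ≤ M * u := fun hx hu ht =>
    hx.trans (by gcongr)
  have hVV : ∀ z, 1 ≤ V z ^ 2 := h2.one_le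
  refine ⟨f, fun z => q' z + f z ^ 2 / 2, a, Real.sqrt (2 * e), M, ha,
    Real.sqrt_pos.2 (by positivity), by linarith, by rw [hs]; linarith, fun z => ?_,
    fun z => up (hfC z) (hV z) (by linarith), fun z => ?_, fun z => up (hPf z) (hV z) (by linarith),
    fun z => ?_, hf0, by simp [hq0, hf0], hf, fun z => ?_⟩
  · refine up (t := c + a) ?_ (hV z) (by linarith)
    rw [abs_le]
    have := hc z
    have h3 := hV z
    have h4 : (0 : ℝ) ≤ z := Nat.cast_nonneg z
    constructor <;> nlinarith
  · refine up (t := C' + C ^ 2) ?_ (hVV z) (by linarith)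
    refine (abs_add_le _ _).trans ?_
    rw [abs_div, abs_two]
    have h3 := hqC' z
    have h4 := hf2C z
    have h5 := abs_nonneg (f z ^ 2)
    linarith
  · refine up (t := C' * D2 + C ^ 2 * D2) ?_ (hVV z) (by linarith)
    rw [hPq]
    refine (abs_add_le _ _).trans ?_
    rw [abs_div, abs_two]
    have h3 := hPq' z
    have h4 := hPf2 z
    have h5 := abs_nonneg (∫ y, f y ^ 2 ∂κ z)
    linarith
  · rw [hPq, hs]
    have h3 := hq z
    rw [hw] at h3
    have h4 := hf z
    set F := ∫ y, f y ∂κ z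
    have h5 : (z : ℝ) - a = f z - F := by linarith
    rw [h5]
    linear_combination h3

end Corrector

lemma norm_exp_mul_I_sub_le (x : ℝ) :
    ‖Complex.exp (x * Complex.I) - 1‖ ≤ |x| ∧
    ‖Complex.exp (x * Complex.I) - 1 - x * Complex.I‖ ≤ 3 * |x| ^ 2 ∧
    ‖Complex.exp (x * Complex.I) - 1 - x * Complex.I + x ^ 2 / 2‖ ≤ 4 * |x| ^ 3 := by
  have hx : ‖(x * Complex.I : ℂ)‖ = |x| := by simp
  have h0 : ‖Complex.exp (x * Complex.I) - 1‖ ≤ |x| := by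
    rw [mul_comm]
    exact Real.norm_exp_I_mul_ofReal_sub_one_le
  refine ⟨h0, ?_⟩
  rcases le_or_gt |x| 1 with h | h
  · have h2 := Complex.exp_bound (x := x * Complex.I) (by rw [hx]; exact h) (n := 2) (by norm_num)
    have h3 := Complex.exp_bound (x := x * Complex.I) (by rw [hx]; exact h) (n := 3) (by norm_num)
    rw [hx] at h2 h3
    simp only [Finset.sum_range_succ, Finset.sum_range_zero, Nat.factorial] at h2 h3
    have hI : (x * Complex.I) ^ 2 = -(x : ℂ) ^ 2 := by rw [mul_pow, Complex.I_sq]; ring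
    rw [hI] at h3
    constructor
    · refine le_trans (le_of_eq ?_) (h2.trans ?_)
      · congr 1
        push_cast
        ring
      · rw [mul_comm]
        gcongr
        norm_num
    · refine le_trans (le_of_eq ?_) (h3.trans ?_)
      · congr 1
        push_cast
        ring
      · rw [mul_comm]
        gcongr
        norm_num
  · have h4 : ‖Complex.exp (x * Complex.I) - 1 - x * Complex.I‖ ≤ |x| + |x| :=
      (norm_sub_le _ _).trans (by rw [hx]; gcongr)
    have h5 : |x| ≤ |x| ^ 2 := by nlinarith
    have h6 : |x| ^ 2 ≤ |x| ^ 3 := by nlinarith [sq_nonneg |x|]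
    refine ⟨by linarith, (norm_add_le _ _).trans ?_⟩
    have h7 : ‖((x : ℂ) ^ 2 / 2)‖ = |x| ^ 2 / 2 := by simp
    rw [h7]
    linarith

lemma corrector_remainder_le {s g F Q B σ2 : ℝ} (hs : |s| ≤ 1) (hB : 1 ≤ B) (hg : |g| ≤ B)
    (hF : |F| ≤ B) (hQ : |Q| ≤ B ^ 2) (hσ0 : 0 ≤ σ2) (hσ : σ2 ≤ B) :
    ‖Complex.exp ((s * g : ℝ) * Complex.I) * (1 + (s * F : ℝ) * Complex.I - (s ^ 2 * Q : ℝ)) -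
      (1 - σ2 * s ^ 2 / 2 : ℝ) * (1 + (s * (g + F) : ℝ) * Complex.I -
        (s ^ 2 * (g ^ 2 / 2 + g * F - σ2 / 2 + Q) : ℝ))‖ ≤ 12 * B ^ 3 * |s| ^ 3 := by
  obtain ⟨h1, h2, h3⟩ := norm_exp_mul_I_sub_le (s * g)
  set e := Complex.exp ((s * g : ℝ) * Complex.I)
  set f := g + F with hf
  set q := g ^ 2 / 2 + g * F - σ2 / 2 + Q with hq
  have hB0 : 0 ≤ B := by linarith
  have hq' : |q| ≤ 3 * B ^ 2 := by
    have e1 : |g ^ 2 / 2| ≤ B ^ 2 / 2 := by rw [abs_div, abs_pow, abs_two]; gcongr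
    have e2 : |g * F| ≤ B * B := by rw [abs_mul]; gcongr
    rw [abs_le] at e1 e2 hQ ⊢
    constructor <;> nlinarith
  have hf' : |f| ≤ 2 * B := (abs_add_le _ _).trans (by linarith)
  have key : e * (1 + (s * F : ℝ) * Complex.I - (s ^ 2 * Q : ℝ)) -
      (1 - σ2 * s ^ 2 / 2 : ℝ) * (1 + (s * f : ℝ) * Complex.I - (s ^ 2 * q : ℝ)) =
      (e - 1 - (s * g : ℝ) * Complex.I + (s * g : ℝ) ^ 2 / 2) +
      (s * F : ℝ) * Complex.I * (e - 1 - (s * g : ℝ) * Complex.I) -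
      (s ^ 2 * Q : ℝ) * (e - 1) +
      (σ2 * s ^ 2 / 2 : ℝ) * ((s * f : ℝ) * Complex.I - (s ^ 2 * q : ℝ)) := by
    have hI := Complex.I_sq
    rw [hq, hf]
    push_cast
    linear_combination ((s : ℂ) ^ 2 * g * F) * hI
  rw [key]
  have hs0 := abs_nonneg s
  have t1 : ‖e - 1 - (s * g : ℝ) * Complex.I + (s * g : ℝ) ^ 2 / 2‖ ≤ 4 * (|s| * B) ^ 3 := by
    refine h3.trans ?_
    rw [abs_mul]
    gcongr
  have t2 : ‖(s * F : ℝ) * Complex.I * (e - 1 - (s * g : ℝ) * Complex.I)‖ ≤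
      |s| * B * (3 * (|s| * B) ^ 2) := by
    rw [norm_mul, norm_mul, Complex.norm_I, Complex.norm_real, Real.norm_eq_abs, mul_one, abs_mul]
    gcongr
    refine h2.trans ?_
    rw [abs_mul]
    gcongr
  have t3 : ‖((s ^ 2 * Q : ℝ) : ℂ) * (e - 1)‖ ≤ |s| ^ 2 * B ^ 2 * (|s| * B) := by
    rw [norm_mul, Complex.norm_real, Real.norm_eq_abs, abs_mul, abs_pow]
    gcongr
    refine h1.trans ?_
    rw [abs_mul]
    gcongr
  have t4 : ‖((σ2 * s ^ 2 / 2 : ℝ) : ℂ) * ((s * f : ℝ) * Complex.I - (s ^ 2 * q : ℝ))‖ ≤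
      B * |s| ^ 2 / 2 * (|s| * (2 * B) + |s| * 1 * (3 * B ^ 2)) := by
    rw [norm_mul, Complex.norm_real, Real.norm_eq_abs, abs_div, abs_mul, abs_of_nonneg hσ0, abs_pow,
      abs_two]
    gcongr
    refine (norm_sub_le _ _).trans ?_
    rw [norm_mul, Complex.norm_I, Complex.norm_real, Complex.norm_real, Real.norm_eq_abs,
      Real.norm_eq_abs, mul_one, abs_mul, abs_mul, abs_pow, sq]
    gcongr
  refine (norm_add_le _ _).trans ?_
  refine (add_le_add ((norm_sub_le _ _).trans (add_le_add ((norm_add_le _ _).trans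
    (add_le_add t1 t2)) t3)) t4).trans ?_
  have hs3 : 0 ≤ |s| ^ 3 := by positivity
  have hB3 : B ^ 2 ≤ B ^ 3 := by nlinarith [sq_nonneg B]
  nlinarith [mul_le_mul_of_nonneg_right hB3 hs3]

/-! ### Characteristic functions of the additive functional -/

section CharFun

variable {Ω : Type*} [MeasurableSpace Ω] {P : Measure Ω} [IsProbabilityMeasure P]
  {κ : Kernel ℕ ℕ} [IsMarkovKernel κ] {V f q : ℕ → ℝ} {a σ C : ℝ}

/-- The centred additive functional of a trajectory. -/
def centSum (a : ℝ) (Z : ℕ → ℕ) (n : ℕ) : ℝ := ∑ k ∈ Finset.range n, ((Z k : ℝ) - a)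

lemma measurable_centSum {Ω : Type*} [MeasurableSpace Ω] {Z : ℕ → Ω → ℕ}
    (hZ : ∀ k, Measurable (Z k)) (a : ℝ) (n : ℕ) :
    Measurable fun ω => centSum a (fun k => Z k ω) n :=
  Finset.measurable_sum _ fun k _ =>
    ((measurable_of_countable fun z : ℕ => (z : ℝ)).comp (hZ k)).sub_const a

lemma Corrector.char_step (hc : Corrector κ V f q a σ C) (h1 : Drift κ V)
    (h2 : Drift κ fun z => V z ^ 2) (h3 : Drift κ fun z => V z ^ 3) :
    ∃ D : ℝ, 0 ≤ D ∧ ∀ Z : ℕ → Ω → ℕ, IsMarkovChain P κ Z → (∀ ω, Z 0 ω = 0) →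
      ∀ s : ℝ, |s| ≤ 1 → σ ^ 2 * s ^ 2 ≤ 2 → ∀ n : ℕ,
        ‖∫ ω, Complex.exp ((s * centSum a (fun k => Z k ω) n : ℝ) * Complex.I) ∂P -
          ((1 - σ ^ 2 * s ^ 2 / 2 : ℝ) : ℂ) ^ n‖ ≤ D * (|s| + n * |s| ^ 3) := by
  obtain ⟨M, hM1, hM⟩ := h3.integral_comp_le (P := P)
  have hC1 := hc.one_le
  have hC0 : 0 ≤ C := by linarith
  have hV := h1.one_le
  have hV2 : ∀ z, V z ^ 2 ≤ V z ^ 3 := fun z => by nlinarith [hV z, sq_nonneg (V z)]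
  have hV1 : ∀ z, V z ≤ V z ^ 2 := fun z => by nlinarith [hV z]
  refine ⟨12 * C ^ 3 * M, by positivity, fun Z hZ hZ0 s hs hσs n => ?_⟩
  have hs0 := abs_nonneg s
  set e : ℕ → Ω → ℂ := fun k ω =>
    Complex.exp ((s * centSum a (fun k => Z k ω) k : ℝ) * Complex.I) with he
  have he1 : ∀ k ω, ‖e k ω‖ = 1 := fun k ω => Complex.norm_exp_ofReal_mul_I _
  have hem : ∀ k, Measurable (e k) := fun k =>
    Complex.measurable_exp.comp ((Complex.measurable_ofReal.comp
      ((measurable_centSum hZ.measurable a k).const_mul s)).mul_const _)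
  set d : ℕ → ℂ := fun z => (s * f z : ℝ) * Complex.I - (s ^ 2 * q z : ℝ) with hd
  have hdb : ∀ z, ‖d z‖ ≤ 2 * C * |s| * V z ^ 3 := by
    intro z
    refine (norm_sub_le _ _).trans ?_
    rw [norm_mul, Complex.norm_I, Complex.norm_real, Complex.norm_real, Real.norm_eq_abs,
      Real.norm_eq_abs, mul_one, abs_mul, abs_mul, abs_pow]
    have e1 : |s| * |f z| ≤ |s| * (C * V z ^ 3) := by
      gcongr
      refine (hc.f_le z).trans ?_
      gcongr
      exact (hV1 z).trans (hV2 z)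
    have e2 : |s| ^ 2 * |q z| ≤ |s| * 1 * (C * V z ^ 3) := by
      rw [sq]
      gcongr
      exact (hc.q_le z).trans (mul_le_mul_of_nonneg_left (hV2 z) hC0)
    linarith
  have hVi : ∀ k, Integrable (fun ω => V (Z k ω) ^ 3) P := fun k =>
    h3.integrable_comp hZ hZ0 (f := fun z => V z ^ 3) (c := 1) (fun z => by
      rw [one_mul, Real.norm_of_nonneg (by have := hV z; positivity)]) k
  have hei : ∀ k {w : Ω → ℂ}, Integrable w P → Integrable (fun ω => e k ω * w ω) P :=
    fun k w hw => hw.bdd_mul (hem k).aestronglyMeasurable (c := 1)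
      (ae_of_all _ fun ω => (he1 k ω).le)
  have hdi : ∀ k, Integrable (fun ω => d (Z k ω)) P := fun k =>
    h3.integrable_comp hZ hZ0 hdb k
  have hui : ∀ k, Integrable (fun ω => 1 + d (Z k ω)) P := fun k =>
    (integrable_const 1).add (hdi k)
  set E : ℕ → ℂ := fun k => ∫ ω, e k ω * (1 + d (Z k ω)) ∂P with hE
  set lam : ℂ := ((1 - σ ^ 2 * s ^ 2 / 2 : ℝ) : ℂ) with hlam
  have hlam1 : ‖lam‖ ≤ 1 := by
    rw [hlam, Complex.norm_real, Real.norm_eq_abs, abs_le]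
    constructor
    · linarith
    · have : 0 ≤ σ ^ 2 * s ^ 2 := by positivity
      linarith
  have hstep : ∀ k, ‖E (k + 1) - lam * E k‖ ≤ 12 * C ^ 3 * M * |s| ^ 3 := by
    intro k
    have hdκ : ∀ z, ∫ y, (1 + d y) ∂κ z =
        1 + (s * ∫ y, f y ∂κ z : ℝ) * Complex.I - (s ^ 2 * ∫ y, q y ∂κ z : ℝ) := by
      intro z
      have hfi : Integrable (fun y => ((s * f y : ℝ) : ℂ) * Complex.I) (κ z) :=
        (((h1.integrable_of_le hc.f_le z).const_mul s).ofReal).mul_const _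
      have hqi : Integrable (fun y => ((s ^ 2 * q y : ℝ) : ℂ)) (κ z) :=
        ((h2.integrable_of_le hc.q_le z).const_mul (s ^ 2)).ofReal
      rw [integral_add (integrable_const _) (h3.integrable_of_le hdb z)]
      simp only [hd]
      rw [integral_sub hfi hqi, integral_mul_const, integral_complex_ofReal, integral_complex_ofReal,
        integral_const_mul, integral_const_mul]
      simp
      ring
    have h5 := hZ.integral_step k (fun ω y => e (k + 1) ω * (1 + d y)) (by
      intro ω ω' hω
      have : centSum a (fun k => Z k ω) (k + 1) = centSum a (fun k => Z k ω') (k + 1) :=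
        Finset.sum_congr rfl fun i hi => by
          dsimp only
          rw [hω i (by have := Finset.mem_range.1 hi; omega)]
      simp only [he, this]) (hei (k + 1) (hui (k + 1)))
    have h6 : ∀ ω, ∫ y, e (k + 1) ω * (1 + d y) ∂κ (Z k ω) = e k ω *
        (Complex.exp ((s * (Z k ω - a) : ℝ) * Complex.I) *
          (1 + (s * ∫ y, f y ∂κ (Z k ω) : ℝ) * Complex.I -
            (s ^ 2 * ∫ y, q y ∂κ (Z k ω) : ℝ))) := by
      intro ω
      rw [integral_const_mul, hdκ, ← mul_assoc]
      congr 1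
      simp only [he]
      rw [← Complex.exp_add, centSum, Finset.sum_range_succ, ← centSum]
      congr 1
      push_cast
      ring
    have h7 : ∀ z : ℕ, ‖Complex.exp ((s * (z - a) : ℝ) * Complex.I) *
          (1 + (s * ∫ y, f y ∂κ z : ℝ) * Complex.I -
            (s ^ 2 * ∫ y, q y ∂κ z : ℝ)) - lam * (1 + d z)‖ ≤
          12 * C ^ 3 * |s| ^ 3 * V z ^ 3 := by
      intro z
      have hCV : C ≤ C * V z := le_mul_of_one_le_right hC0 (hV z)
      have := corrector_remainder_le (s := s) (g := z - a) (F := ∫ y, f y ∂κ z)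
        (Q := ∫ y, q y ∂κ z) (B := C * V z) (σ2 := σ ^ 2) hs (hC1.trans hCV) (hc.cent_le z)
        (hc.pf_le z) ((hc.pq_le z).trans (by
          rw [mul_pow]
          have : C ≤ C ^ 2 := by nlinarith
          gcongr)) (sq_nonneg _) (hc.σ_le.trans hCV)
      rw [← hc.f_eq z, ← hc.q_eq z] at this
      refine le_trans (le_of_eq ?_) (this.trans (le_of_eq ?_))
      · rw [hlam, hd]
        congr 3
        ring
      · ring
    have h8 : E (k + 1) = ∫ ω, e k ω * (Complex.exp ((s * (Z k ω - a) : ℝ) * Complex.I) *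
          (1 + (s * ∫ y, f y ∂κ (Z k ω) : ℝ) * Complex.I -
            (s ^ 2 * ∫ y, q y ∂κ (Z k ω) : ℝ))) ∂P := by
      rw [hE]
      simp only
      rw [h5]
      exact integral_congr_ae (ae_of_all _ h6)
    have h9 : Integrable (fun ω => e k ω * (Complex.exp ((s * (Z k ω - a) : ℝ) * Complex.I) *
          (1 + (s * ∫ y, f y ∂κ (Z k ω) : ℝ) * Complex.I -
            (s ^ 2 * ∫ y, q y ∂κ (Z k ω) : ℝ)))) P := by
      refine hei k ?_
      refine h3.integrable_comp hZ hZ0 (f := fun z : ℕ =>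
        Complex.exp ((s * (z - a) : ℝ) * Complex.I) *
          (1 + (s * ∫ y, f y ∂κ z : ℝ) * Complex.I - (s ^ 2 * ∫ y, q y ∂κ z : ℝ)))
        (c := 12 * C ^ 3 * |s| ^ 3 + (1 + 2 * C * |s|)) (fun z => ?_) k
      have h10 : ‖lam * (1 + d z)‖ ≤ (1 + 2 * C * |s|) * V z ^ 3 := by
        rw [norm_mul]
        refine (mul_le_of_le_one_left (norm_nonneg _) hlam1).trans ?_
        refine (norm_add_le _ _).trans ?_
        rw [norm_one, add_mul]
        have := h3.one_le z
        linarith [hdb z]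
      have h11 := norm_sub_norm_le (Complex.exp ((s * (z - a) : ℝ) * Complex.I) *
          (1 + (s * ∫ y, f y ∂κ z : ℝ) * Complex.I - (s ^ 2 * ∫ y, q y ∂κ z : ℝ)))
          (lam * (1 + d z))
      rw [add_mul (12 * C ^ 3 * |s| ^ 3)]
      linarith [h7 z]
    rw [h8, hE]
    simp only
    rw [← integral_const_mul, ← integral_sub h9 ((hei k (hui k)).const_mul lam)]
    calc _ ≤ ∫ ω, 12 * C ^ 3 * |s| ^ 3 * V (Z k ω) ^ 3 ∂P := by
          refine norm_integral_le_of_norm_le ((hVi k).const_mul _) (ae_of_all _ fun ω => ?_)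
          refine le_trans (le_of_eq ?_) (h7 (Z k ω))
          rw [← one_mul ‖_ - lam * (1 + d (Z k ω))‖, ← he1 k ω, ← norm_mul]
          congr 1
          ring
      _ = 12 * C ^ 3 * |s| ^ 3 * ∫ ω, V (Z k ω) ^ 3 ∂P := integral_const_mul _ _
      _ ≤ 12 * C ^ 3 * |s| ^ 3 * M := by gcongr; exact hM Z hZ hZ0 k
      _ = _ := by ring
  have hE0 : E 0 = 1 := by
    have : ∀ ω, e 0 ω * (1 + d (Z 0 ω)) = 1 := fun ω => by
      simp [he, hd, centSum, hZ0, hc.f_zero, hc.q_zero]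
    simp [hE, this]
  have hEn : ‖E n - lam ^ n‖ ≤ n * (12 * C ^ 3 * M * |s| ^ 3) := by
    induction n with
    | zero => simp [hE0]
    | succ n ih =>
      calc ‖E (n + 1) - lam ^ (n + 1)‖ =
            ‖(E (n + 1) - lam * E n) + lam * (E n - lam ^ n)‖ := by congr 1; ring
        _ ≤ 12 * C ^ 3 * M * |s| ^ 3 + 1 * (n * (12 * C ^ 3 * M * |s| ^ 3)) := by
          refine (norm_add_le _ _).trans ?_
          rw [norm_mul]
          gcongr
          exact hstep n
        _ = _ := by push_cast; ring
  have hdif : ‖∫ ω, e n ω ∂P - E n‖ ≤ 12 * C ^ 3 * M * |s| := by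
    have hen : Integrable (e n) P := by
      have := hei n (integrable_const (1 : ℂ))
      simpa using this
    rw [hE]
    simp only
    rw [← integral_sub hen (hei n (hui n))]
    calc _ ≤ ∫ ω, 2 * C * |s| * V (Z n ω) ^ 3 ∂P := by
          refine norm_integral_le_of_norm_le ((hVi n).const_mul _) (ae_of_all _ fun ω => ?_)
          refine le_trans (le_of_eq ?_) (hdb (Z n ω))
          rw [← one_mul ‖d (Z n ω)‖, ← he1 n ω, ← norm_mul, ← norm_neg]
          congr 1
          ring
      _ = 2 * C * |s| * ∫ ω, V (Z n ω) ^ 3 ∂P := integral_const_mul _ _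
      _ ≤ 2 * C * |s| * M := by gcongr; exact hM Z hZ hZ0 n
      _ ≤ 12 * C ^ 3 * |s| * M := by
          have : C ≤ C ^ 3 := le_self_pow₀ hC1 (by norm_num)
          gcongr
          linarith
      _ = _ := by ring
  calc _ = ‖(∫ ω, e n ω ∂P - E n) + (E n - lam ^ n)‖ := by congr 1; ring
    _ ≤ _ := (norm_add_le _ _).trans (add_le_add hdif hEn)
    _ = _ := by ring

end CharFun

/-! ### Limit theorems for the additive functional -/

section LimitTheorems

variable {Ω : Type*} [MeasurableSpace Ω] {P : Measure Ω} [IsProbabilityMeasure P]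
  {κ : Kernel ℕ ℕ} [IsMarkovKernel κ] {V f q : ℕ → ℝ} {a σ C : ℝ}

lemma Corrector.measureReal_abs_ge_le (hc : Corrector κ V f q a σ C) (h1 : Drift κ V)
    (h2 : Drift κ fun z => V z ^ 2) :
    ∃ D : ℝ, 0 ≤ D ∧ ∀ Z : ℕ → Ω → ℕ, IsMarkovChain P κ Z → (∀ ω, Z 0 ω = 0) →
      ∀ (n : ℕ) (t : ℝ), 0 < t →
        P.real {ω | t ≤ |centSum a (fun k => Z k ω) n|} ≤ D * (n + 1) / t ^ 2 := by
  obtain ⟨M, hM1, hM⟩ := h2.integral_comp_le (P := P)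
  obtain ⟨D2, hD2, hVD2⟩ := h2.exists_integral_le
  have hC1 := hc.one_le
  have hC0 : 0 ≤ C := by linarith
  have hD20 : 0 ≤ D2 := by linarith
  have hV := h1.one_le
  have sq_le : ∀ {x : ℝ} {z : ℕ}, |x| ≤ C * V z → ‖x ^ 2‖ ≤ C ^ 2 * V z ^ 2 := by
    intro x z hx
    rw [Real.norm_eq_abs, abs_pow, ← mul_pow]
    gcongr
  have hfi : ∀ z, Integrable f (κ z) := h1.integrable_of_le hc.f_le
  have hf2i : ∀ z, Integrable (fun y => f y ^ 2) (κ z) :=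
    h2.integrable_of_le fun z => sq_le (hc.f_le z)
  have hPf2 := h2.abs_integral_le (sq_nonneg C) (fun z => sq_le (hc.f_le z)) hVD2
  refine ⟨2 * (C ^ 2 * D2 * M) + 2 * (C ^ 2 * M), by positivity, fun Z hZ hZ0 n t ht => ?_⟩
  have hVi : ∀ k, Integrable (fun ω => V (Z k ω) ^ 2) P := fun k =>
    h2.integrable_comp hZ hZ0 (f := fun z => V z ^ 2) (c := 1) (fun z => by
      rw [one_mul, Real.norm_of_nonneg (by have := hV z; positivity)]) k
  have hlp : ∀ {g : ℕ → ℝ}, (∀ z, |g z| ≤ C * V z) → ∀ k, MemLp (fun ω => g (Z k ω)) 2 P := by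
    intro g hg k
    refine (memLp_two_iff_integrable_sq
      ((measurable_of_countable g).comp (hZ.measurable k)).aestronglyMeasurable).2 ?_
    exact h2.integrable_comp hZ hZ0 (f := fun z => g z ^ 2) (fun z => sq_le (hg z)) k
  have hSlp : ∀ k, MemLp (fun ω => centSum a (fun k => Z k ω) k) 2 P := fun k =>
    memLp_finsetSum _ fun j _ => hlp (g := fun z : ℕ => (z : ℝ) - a) hc.cent_le j
  have hMlp : ∀ k, Integrable (fun ω => (centSum a (fun k => Z k ω) k + f (Z k ω)) ^ 2) P :=
    fun k => ((hSlp k).add (hlp hc.f_le k)).integrable_sq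
  have hstep : ∀ k, ∫ ω, (centSum a (fun k => Z k ω) k + f (Z k ω)) ^ 2 ∂P ≤
      k * (C ^ 2 * D2 * M) := by
    intro k
    induction k with
    | zero => simp [centSum, hZ0, hc.f_zero]
    | succ k ih =>
      rw [hZ.integral_step k (fun ω y => (centSum a (fun k => Z k ω) (k + 1) + f y) ^ 2) (by
        intro ω ω' hω
        have : centSum a (fun k => Z k ω) (k + 1) = centSum a (fun k => Z k ω') (k + 1) :=
          Finset.sum_congr rfl fun i hi => by
            dsimp only
            rw [hω i (by have := Finset.mem_range.1 hi; omega)]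
        simp only [this]) (hMlp (k + 1))]
      have h3 : ∀ ω, ∫ y, (centSum a (fun k => Z k ω) (k + 1) + f y) ^ 2 ∂κ (Z k ω) ≤
          (centSum a (fun k => Z k ω) k + f (Z k ω)) ^ 2 + C ^ 2 * D2 * V (Z k ω) ^ 2 := by
        intro ω
        set S := centSum a (fun k => Z k ω) (k + 1) with hS
        have h4 : S = centSum a (fun k => Z k ω) k + (Z k ω - a) := by
          rw [hS, centSum, Finset.sum_range_succ, ← centSum]
        have h5 : ∀ y, (S + f y) ^ 2 = S ^ 2 + 2 * S * f y + f y ^ 2 := fun y => by ring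
        simp only [h5]
        rw [integral_add (show Integrable (fun y => S ^ 2 + 2 * S * f y) (κ (Z k ω)) from
          (integrable_const _).add ((hfi _).const_mul _)) (hf2i _),
          integral_add (integrable_const _) ((hfi _).const_mul _), integral_const_mul,
          integral_const, probReal_univ, one_smul]
        have h6 := hc.f_eq (Z k ω)
        have h7 := (le_abs_self _).trans (hPf2 (Z k ω))
        set F := ∫ y, f y ∂κ (Z k ω)
        have h8 : centSum a (fun k => Z k ω) k + f (Z k ω) = S + F := by rw [h6, h4]; ring
        rw [h8]
        nlinarith [sq_nonneg F]
      calc _ ≤ ∫ ω, ((centSum a (fun k => Z k ω) k + f (Z k ω)) ^ 2 +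
            C ^ 2 * D2 * V (Z k ω) ^ 2) ∂P :=
            integral_mono_of_nonneg (ae_of_all _ fun ω => integral_nonneg fun y => sq_nonneg _)
              ((hMlp k).add ((hVi k).const_mul _)) (ae_of_all _ h3)
        _ ≤ k * (C ^ 2 * D2 * M) + C ^ 2 * D2 * M := by
            rw [integral_add (hMlp k) ((hVi k).const_mul _), integral_const_mul]
            gcongr
            exact hM Z hZ hZ0 k
        _ = _ := by push_cast; ring
  have hS2 : ∫ ω, centSum a (fun k => Z k ω) n ^ 2 ∂P ≤
      (2 * (C ^ 2 * D2 * M) + 2 * (C ^ 2 * M)) * (n + 1) := by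
    calc _ ≤ ∫ ω, (2 * (centSum a (fun k => Z k ω) n + f (Z n ω)) ^ 2 +
            2 * C ^ 2 * V (Z n ω) ^ 2) ∂P := by
          refine integral_mono (hSlp n).integrable_sq
            (((hMlp n).const_mul _).add ((hVi n).const_mul _)) fun ω => ?_
          have := (le_abs_self _).trans (sq_le (hc.f_le (Z n ω)))
          simp only
          nlinarith [sq_nonneg (centSum a (fun k => Z k ω) n + 2 * f (Z n ω))]
      _ ≤ 2 * (n * (C ^ 2 * D2 * M)) + 2 * C ^ 2 * M := by
          rw [integral_add ((hMlp n).const_mul _) ((hVi n).const_mul _), integral_const_mul,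
            integral_const_mul]
          gcongr
          · exact hstep n
          · exact hM Z hZ hZ0 n
      _ ≤ _ := by
          have : 0 ≤ C ^ 2 * D2 * M := by positivity
          have : 0 ≤ n * (C ^ 2 * M) := by positivity
          nlinarith
  have h6 := mul_meas_ge_le_integral_of_nonneg (μ := P)
    (f := fun ω => centSum a (fun k => Z k ω) n ^ 2) (ae_of_all _ fun ω => sq_nonneg _)
    (hSlp n).integrable_sq (t ^ 2)
  rw [le_div_iff₀ (by positivity), mul_comm]
  refine le_trans (le_of_eq ?_) (h6.trans hS2)
  congr 2
  ext ω
  simp only [mem_ofPred_eq]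
  rw [← sq_abs (centSum a (fun k => Z k ω) n), sq_le_sq₀ ht.le (abs_nonneg _)]

lemma stdGaussianCDF_eq (y : ℝ) :
    stdGaussianCDF y = (gaussianReal 0 1).real (Iic y) := by
  rw [measureReal_def, gaussianReal_apply_eq_integral _ one_ne_zero, ENNReal.toReal_ofReal
    (integral_nonneg fun x => gaussianPDFReal_nonneg _ _ _), stdGaussianCDF]
  simp [gaussianPDFReal]

lemma gaussianReal_neg_Iic (y : ℝ) :
    (gaussianReal (-y) 1).real (Iic 0) = stdGaussianCDF y := by
  have h := gaussianReal_map_add_const (μ := 0) (v := 1) (-y)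
  rw [zero_add] at h
  rw [← h, measureReal_def, Measure.map_apply (measurable_add_const (-y)) measurableSet_Iic,
    stdGaussianCDF_eq, measureReal_def]
  congr 2
  ext x
  simp

lemma Corrector.tendsto_measureReal (hc : Corrector κ V f q a σ C) (h1 : Drift κ V)
    (h2 : Drift κ fun z => V z ^ 2) (h3 : Drift κ fun z => V z ^ 3)
    {Z : ℕ → ℕ → Ω → ℕ} (hZ : ∀ n, IsMarkovChain P κ (Z n)) (hZ0 : ∀ n ω, Z n 0 ω = 0)
    {L : ℕ → ℕ} (hL : Tendsto L atTop atTop) {y : ℕ → ℝ} {y₀ : ℝ} (hy : Tendsto y atTop (nhds y₀)) :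
    Tendsto (fun n => P.real
      {ω | centSum a (fun k => Z n k ω) (L n) / (σ * √(L n)) - y n ≤ 0})
      atTop (nhds (stdGaussianCDF y₀)) ∧
    Tendsto (fun n => P.real
      {ω | centSum a (fun k => Z n k ω) (L n) / (σ * √(L n)) - y n < 0})
      atTop (nhds (stdGaussianCDF y₀)) := by
  have hσ := hc.σ_pos
  obtain ⟨D, hD0, hD⟩ := hc.char_step (P := P) h1 h2 h3
  set X : ℕ → Ω → ℝ := fun n ω => centSum a (fun k => Z n k ω) (L n) / (σ * √(L n)) - y n with hX
  have hXm : ∀ n, Measurable (X n) := fun n =>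
    ((measurable_centSum (hZ n).measurable a (L n)).div_const _).sub_const _
  let ν : ℕ → ProbabilityMeasure ℝ := fun n =>
    ⟨P.map (X n), Measure.isProbabilityMeasure_map (hXm n).aemeasurable⟩
  let ν₀ : ProbabilityMeasure ℝ := ⟨gaussianReal (-y₀) 1, inferInstance⟩
  have hsq : Tendsto (fun n => √(L n : ℝ)) atTop atTop :=
    Real.tendsto_sqrt_atTop.comp (tendsto_natCast_atTop_atTop.comp hL)
  have hconv : Tendsto ν atTop (nhds ν₀) := by
    rw [ProbabilityMeasure.tendsto_iff_tendsto_charFun]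
    intro t
    have hlim : charFun (gaussianReal (-y₀) 1) t =
        Complex.exp ((-(t * y₀) : ℝ) * Complex.I) * ((Real.exp (-t ^ 2 / 2) : ℝ) : ℂ) := by
      rw [charFun_gaussianReal, Complex.ofReal_exp, ← Complex.exp_add]
      congr 1
      push_cast
      ring
    have hs : Tendsto (fun n => t / (σ * √(L n : ℝ))) atTop (nhds 0) :=
      Tendsto.const_div_atTop (hsq.const_mul_atTop hσ) t
    have hchar : ∀ n, charFun (P.map (X n)) t = Complex.exp ((-(t * y n) : ℝ) * Complex.I) *
        ∫ ω, Complex.exp ((t / (σ * √(L n)) * centSum a (fun k => Z n k ω) (L n) : ℝ) *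
          Complex.I) ∂P := by
      intro n
      rw [charFun_apply_real, integral_map (hXm n).aemeasurable (by fun_prop),
        ← integral_const_mul]
      refine integral_congr_ae (ae_of_all _ fun ω => ?_)
      simp only
      rw [← Complex.exp_add]
      congr 1
      simp only [hX]
      push_cast
      ring
    change Tendsto (fun n => charFun (P.map (X n)) t) atTop (nhds (charFun (gaussianReal (-y₀) 1) t))
    simp only [hchar, hlim]
    refine Tendsto.mul ?_ ?_
    · have : Continuous fun u : ℝ => Complex.exp ((-(t * u) : ℝ) * Complex.I) := by fun_prop
      exact (this.tendsto y₀).comp hy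
    have hpow : Tendsto (fun n => (((1 - σ ^ 2 * (t / (σ * √(L n))) ^ 2 / 2 : ℝ) : ℂ)) ^ (L n))
        atTop (nhds ((Real.exp (-t ^ 2 / 2) : ℝ) : ℂ)) := by
      have h4 := ((Real.tendsto_one_add_div_pow_exp (-t ^ 2 / 2)).comp hL)
      have h5 := (Complex.continuous_ofReal.tendsto _).comp h4
      refine h5.congr' ?_
      filter_upwards [hL.eventually_gt_atTop 0] with n hn
      simp only [Function.comp]
      rw [Complex.ofReal_pow]
      congr 2
      have : (0 : ℝ) < L n := Nat.cast_pos.2 hn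
      have h6 : √(L n : ℝ) ^ 2 = L n := Real.sq_sqrt this.le
      rw [div_pow, mul_pow, h6]
      field_simp
      ring
    have hdiff : Tendsto (fun n => (∫ ω, Complex.exp ((t / (σ * √(L n)) *
          centSum a (fun k => Z n k ω) (L n) : ℝ) * Complex.I) ∂P) -
          (((1 - σ ^ 2 * (t / (σ * √(L n))) ^ 2 / 2 : ℝ) : ℂ)) ^ (L n)) atTop (nhds 0) := by
      have hsabs : Tendsto (fun n => |t / (σ * √(L n : ℝ))|) atTop (nhds 0) := by
        simpa using hs.abs
      have hb : Tendsto (fun n => D * (|t / (σ * √(L n))| + t ^ 2 / σ ^ 2 * |t / (σ * √(L n))|))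
          atTop (nhds 0) := by
        simpa using (hsabs.add (hsabs.const_mul (t ^ 2 / σ ^ 2))).const_mul D
      refine squeeze_zero_norm' ?_ hb
      have hs2 : Tendsto (fun n => σ ^ 2 * (t / (σ * √(L n : ℝ))) ^ 2) atTop (nhds 0) := by
        simpa using (hs.pow 2).const_mul (σ ^ 2)
      filter_upwards [hsabs.eventually_le_const one_pos, hs2.eventually_le_const two_pos,
        hL.eventually_gt_atTop 0] with n hn1 hn2 hn3
      refine (hD (Z n) (hZ n) (hZ0 n) _ hn1 hn2 (L n)).trans (le_of_eq ?_)
      have : (0 : ℝ) < L n := Nat.cast_pos.2 hn3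
      have h6 : √(L n : ℝ) ^ 2 = L n := Real.sq_sqrt this.le
      have h7 : (L n : ℝ) * |t / (σ * √(L n))| ^ 2 = t ^ 2 / σ ^ 2 := by
        rw [sq_abs, div_pow, mul_pow, h6]
        field_simp
      rw [pow_succ, ← mul_assoc, h7]
    simpa using hdiff.add hpow
  have : NullSingletonClass (ν₀ : Measure ℝ) := nullSingletonClass_gaussianReal one_ne_zero
  have hcdf : (ν₀ (Iic 0) : ℝ) = stdGaussianCDF y₀ := gaussianReal_neg_Iic y₀
  have hcdf' : (ν₀ (Iio 0) : ℝ) = stdGaussianCDF y₀ := by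
    rw [← gaussianReal_neg_Iic]
    exact congrArg ENNReal.toReal (measure_congr Iio_ae_eq_Iic)
  have hmap : ∀ n {s : Set ℝ}, MeasurableSet s → (ν n s : ℝ) = P.real (X n ⁻¹' s) := by
    intro n s hs
    change (P.map (X n)).real s = _
    rw [measureReal_def, Measure.map_apply (hXm n) hs, measureReal_def]
  constructor
  · have h4 := ProbabilityMeasure.tendsto_measure_of_null_frontier_of_tendsto hconv
      (E := Iic (0 : ℝ)) (by
        rw [frontier_Iic, ← ENNReal.coe_eq_zero, ProbabilityMeasure.ennreal_coeFn_eq_coeFn_toMeasure]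
        exact measure_singleton _)
    rw [← NNReal.tendsto_coe, hcdf] at h4
    exact h4.congr fun n => hmap n measurableSet_Iic
  · have h4 := ProbabilityMeasure.tendsto_measure_of_null_frontier_of_tendsto hconv
      (E := Iio (0 : ℝ)) (by
        rw [frontier_Iio, ← ENNReal.coe_eq_zero, ProbabilityMeasure.ennreal_coeFn_eq_coeFn_toMeasure]
        exact measure_singleton _)
    rw [← NNReal.tendsto_coe, hcdf'] at h4
    exact h4.congr fun n => hmap n measurableSet_Iio

end LimitTheorems

/-! ### Finite Markov chains -/

section FiniteChain

variable {n : Type*} [Fintype n] {K : Matrix n n ℝ} {μ : n → ℝ}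

lemma HasUniqueStationaryDist.eq_smul_of_nonneg (hμ : HasUniqueStationaryDist K μ) {v : n → ℝ}
    (hv : Matrix.vecMul v K = v) (h0 : ∀ i, 0 ≤ v i) : v = (∑ i, v i) • μ := by
  rcases (Finset.sum_nonneg fun i (_ : i ∈ Finset.univ) => h0 i).eq_or_lt with h | h
  · rw [← h, zero_smul]
    funext i
    exact (Finset.sum_eq_zero_iff_of_nonneg fun i _ => h0 i).1 h.symm i (Finset.mem_univ i)
  · rw [← hμ.2 ((∑ i, v i)⁻¹ • v) ⟨⟨fun i => mul_nonneg (inv_nonneg.2 h.le) (h0 i), ?_⟩, ?_⟩,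
      smul_inv_smul₀ h.ne']
    · simp only [Pi.smul_apply, smul_eq_mul, ← Finset.mul_sum]
      exact inv_mul_cancel₀ h.ne'
    · rw [Matrix.smul_vecMul, hv]

lemma HasUniqueStationaryDist.eq_smul (hK : IsStochastic K) (hμ : HasUniqueStationaryDist K μ)
    {v : n → ℝ} (hv : Matrix.vecMul v K = v) : ∃ c : ℝ, v = c • μ := by
  set u : n → ℝ := fun i => |v i| with hu
  have hle : ∀ j, u j ≤ Matrix.vecMul u K j := by
    intro j
    have : v j = ∑ i, v i * K i j := (congrFun hv j).symm
    simp only [hu]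
    rw [this]
    refine (Finset.abs_sum_le_sum_abs _ _).trans (le_of_eq ?_)
    exact Finset.sum_congr rfl fun i _ => by rw [abs_mul, abs_of_nonneg (hK.1 i j)]
  have hsum : ∑ j, Matrix.vecMul u K j = ∑ j, u j := by
    simp only [Matrix.vecMul, dotProduct]
    rw [Finset.sum_comm]
    exact Finset.sum_congr rfl fun i _ => by rw [← Finset.mul_sum, hK.2, mul_one]
  have huK : Matrix.vecMul u K = u := by
    funext j
    exact ((Finset.sum_eq_sum_iff_of_le fun j _ => hle j).1 hsum.symm j (Finset.mem_univ j)).symm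
  have h1 := hμ.eq_smul_of_nonneg (v := u + v) (by rw [Matrix.add_vecMul, huK, hv])
    fun i => by simp only [hu, Pi.add_apply]; linarith [neg_abs_le (v i)]
  have h2 := hμ.eq_smul_of_nonneg (v := u) huK fun i => abs_nonneg _
  refine ⟨(∑ i, (u + v) i) - ∑ i, u i, ?_⟩
  rw [sub_smul, ← h1, ← h2, add_sub_cancel_left]

lemma HasUniqueStationaryDist.exists_poisson (hK : IsStochastic K)
    (hμ : HasUniqueStationaryDist K μ) (g : n → ℝ) :
    ∃ h : n → ℝ, ∀ r, h r - ∑ j, K r j * h j = g r - ∑ i, μ i * g i := by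
  set A : (n → ℝ) →ₗ[ℝ] (n → ℝ) := LinearMap.id - Matrix.mulVecLin K with hA
  set x : n → ℝ := fun r => g r - ∑ i, μ i * g i with hx
  suffices x ∈ LinearMap.range A by
    obtain ⟨h, hh⟩ := this
    exact ⟨h, fun r => congrFun hh r⟩
  by_contra hxA
  obtain ⟨φ, hφx, hφ⟩ := Submodule.exists_le_ker_of_notMem hxA
  set v : n → ℝ := fun i => φ (Pi.single i 1) with hvdef
  have hφv : ∀ y : n → ℝ, φ y = ∑ i, y i * v i := fun y => by
    conv_lhs => rw [pi_eq_sum_univ' y]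
    rw [map_sum]
    exact Finset.sum_congr rfl fun i _ => by
      rw [map_smul, smul_eq_mul, hvdef]
  have hv : Matrix.vecMul v K = v := by
    funext j
    have h1 : φ (A (Pi.single j 1)) = 0 := hφ ⟨_, rfl⟩
    rw [hA, LinearMap.sub_apply, map_sub, LinearMap.id_apply, hφv (Matrix.mulVecLin K _)] at h1
    simp only [Matrix.mulVecLin_apply, Matrix.mulVec_single_one, Matrix.col_apply] at h1
    simp only [Matrix.vecMul, dotProduct]
    rw [sub_eq_zero] at h1
    change _ = φ _
    rw [h1]
    exact Finset.sum_congr rfl fun i _ => mul_comm _ _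
  obtain ⟨c, hc⟩ := hμ.eq_smul hK hv
  apply hφx
  rw [hφv, hc]
  simp only [hx, Pi.smul_apply, smul_eq_mul, sub_mul, Finset.sum_sub_distrib]
  rw [← Finset.mul_sum, ← Finset.mul_sum, hμ.1.1.2, mul_one, Finset.sum_mul, sub_eq_zero]
  exact Finset.sum_congr rfl fun i _ => by ring

lemma eventually_lt_of_hasDerivAt_neg {f : ℝ → ℝ} {f' x : ℝ} (h : HasDerivAt f f' x)
    (hf : f' < 0) : ∀ᶠ y in nhdsWithin x (Ioi x), f y < f x := by
  have h1 := (hasDerivWithinAt_iff_tendsto_slope' (lt_irrefl x)).1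
    (h.hasDerivWithinAt (s := Ioi x))
  filter_upwards [h1.eventually_lt_const hf, self_mem_nhdsWithin] with y hy hxy
  rw [slope_def_field, div_lt_iff₀ (sub_pos.2 hxy), zero_mul] at hy
  linarith

lemma HasUniqueStationaryDist.exists_exponential_rate (hK : IsStochastic K)
    (hμ : HasUniqueStationaryDist K μ) {p : n → ℝ} (hp : ∀ i, p i ∈ Ioo (0 : ℝ) 1)
    (hp2 : 1 / 2 < ∑ i, μ i * p i) :
    ∃ ρ θ₀ : ℝ, 0 < ρ ∧ ρ < 1 ∧ 0 < θ₀ ∧ ∃ h : n → ℝ, ∀ θ, 0 < θ → θ < θ₀ →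
      ∃ lam, 0 < lam ∧ lam < 1 ∧ ∀ r,
        (p r * Real.exp (-(θ * ρ)) + (1 - p r) * Real.exp θ) * ∑ j, K r j * Real.exp (θ * h j) ≤
          lam * Real.exp (θ * h r) := by
  set P := ∑ i, μ i * p i with hP
  obtain ⟨ρ, hρ, hρ1⟩ : ∃ ρ, (1 - P) / P < ρ ∧ ρ < 1 := by
    refine exists_between ?_
    rw [div_lt_one (by linarith)]
    linarith
  have hP1 : P ≤ 1 := by
    rw [hP, ← hμ.1.1.2]
    exact Finset.sum_le_sum fun i _ => mul_le_of_le_one_right (hμ.1.1.1 i) (hp i).2.le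
  have hρ0 : 0 < ρ := lt_of_le_of_lt (div_nonneg (by linarith) (by linarith)) hρ
  obtain ⟨h, hh⟩ := hμ.exists_poisson hK fun r => (1 - p r) - ρ * p r
  have hneg : ∑ i, μ i * ((1 - p i) - ρ * p i) < 0 := by
    have : ∑ i, μ i * ((1 - p i) - ρ * p i) = 1 - P - ρ * P := by
      calc _ = ∑ i, (μ i - μ i * p i - ρ * (μ i * p i)) :=
            Finset.sum_congr rfl fun i _ => by ring
        _ = _ := by
          rw [Finset.sum_sub_distrib, Finset.sum_sub_distrib, hμ.1.1.2, ← Finset.mul_sum]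
    rw [this]
    rw [div_lt_iff₀ (by linarith)] at hρ
    linarith
  set ψ : n → ℝ → ℝ := fun r θ => (p r * Real.exp (-(θ * ρ)) + (1 - p r) * Real.exp θ) *
    ∑ j, K r j * Real.exp (θ * (h j - h r)) with hψ
  have hψ0 : ∀ r, ψ r 0 = 1 := fun r => by simp [hψ, hK.2 r]
  have hder : ∀ r, HasDerivAt (ψ r) (∑ i, μ i * ((1 - p i) - ρ * p i)) 0 := by
    intro r
    have d1 : HasDerivAt (fun θ : ℝ => p r * Real.exp (-(θ * ρ)) + (1 - p r) * Real.exp θ)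
        (p r * (Real.exp (-(0 * ρ)) * (-(1 * ρ))) + (1 - p r) * Real.exp 0) 0 :=
      ((((hasDerivAt_id (0 : ℝ)).mul_const ρ).neg.exp).const_mul (p r)).add
        ((Real.hasDerivAt_exp 0).const_mul _)
    have d2 : HasDerivAt (fun θ : ℝ => ∑ j, K r j * Real.exp (θ * (h j - h r)))
        (∑ j, K r j * (Real.exp (0 * (h j - h r)) * (1 * (h j - h r)))) 0 := by
      refine HasDerivAt.fun_sum fun j _ => ?_
      exact (((hasDerivAt_id (0 : ℝ)).mul_const (h j - h r)).exp).const_mul (K r j)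
    refine (d1.mul d2).congr_deriv ?_
    simp only [zero_mul, neg_zero, Real.exp_zero, one_mul, mul_one]
    have h1 : ∑ j, K r j * (h j - h r) = ∑ j, K r j * h j - h r := by
      simp only [mul_sub, Finset.sum_sub_distrib]
      rw [← Finset.sum_mul, hK.2, one_mul]
    rw [h1, hK.2]
    linear_combination -hh r
  have hev : ∀ᶠ θ in nhdsWithin (0 : ℝ) (Ioi 0), ∀ r, ψ r θ < 1 := by
    rw [eventually_all]
    intro r
    rw [← hψ0 r]
    exact eventually_lt_of_hasDerivAt_neg (hder r) hneg
  obtain ⟨θ₀, hθ₀, hθ⟩ := mem_nhdsGT_iff_exists_Ioo_subset.1 hev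
  have hne : Nonempty n := by
    by_contra hne
    rw [not_nonempty_iff] at hne
    simpa using hμ.1.1.2
  refine ⟨ρ, θ₀, hρ0, hρ1, hθ₀, h, fun θ h0 h1 => ?_⟩
  obtain ⟨r₀, hr₀⟩ := Finite.exists_max fun r => ψ r θ
  have hψe : ∀ r, (p r * Real.exp (-(θ * ρ)) + (1 - p r) * Real.exp θ) *
      ∑ j, K r j * Real.exp (θ * h j) = ψ r θ * Real.exp (θ * h r) := by
    intro r
    rw [hψ]
    simp only
    rw [mul_assoc, Finset.sum_mul]
    congr 1
    refine Finset.sum_congr rfl fun j _ => ?_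
    rw [mul_assoc, ← Real.exp_add]
    congr 2
    ring
  refine ⟨max (ψ r₀ θ) (1 / 2), by positivity, max_lt (hθ ⟨h0, h1⟩ r₀) (by norm_num), fun r => ?_⟩
  rw [hψe]
  gcongr
  exact (hr₀ r).trans (le_max_left _ _)

end FiniteChain

/-! ### Cookie environments -/

section Environment

variable {N : ℕ} {Ω : Type*} [MeasurableSpace Ω] {P : Measure Ω} [IsProbabilityMeasure P]
  {K : Matrix (Fin N) (Fin N) ℝ} {p η : Fin N → ℝ} {Rc : ℤ → ℕ → Ω → Fin N}
  {ξ : ℤ → ℕ → Ω → Bool}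

/-- The coin tosses at distinct sites are independent and identically distributed. -/
lemma IsCookieEnv.measureReal_forall_mem (henv : IsCookieEnv P K p η Rc ξ) [Nonempty (Fin N)]
    (S : Finset ℤ) (M : ℕ) (B : ℤ → (ℕ → Bool) → Prop)
    (hB : ∀ x b b', (∀ j ≤ M, b j = b' j) → B x b → B x b') :
    P.real {ω | ∀ x ∈ S, B x fun j => ξ x j ω} =
      ∏ x ∈ S, P.real {ω | B x fun j => ξ 0 j ω} := by
  obtain ⟨hR, hξ, hcyl⟩ := henv
  set Y : ℤ → Ω → Fin (M + 1) → Fin N × Bool := fun x ω j => (Rc x j ω, ξ x j ω) with hY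
  have hYm : ∀ x, Measurable (Y x) := fun x =>
    measurable_pi_lambda _ fun j => (hR x j).prodMk (hξ x j)
  set F : Ω → S → Fin (M + 1) → Fin N × Bool := fun ω x => Y x ω with hF
  have hFm : Measurable F := measurable_pi_lambda _ fun x => hYm x
  have hν : IsProbabilityMeasure (P.map (Y 0)) :=
    Measure.isProbabilityMeasure_map (hYm 0).aemeasurable
  have hνF : IsProbabilityMeasure (P.map F) := Measure.isProbabilityMeasure_map hFm.aemeasurable
  have hpi : P.map F = Measure.pi fun _ : S => P.map (Y 0) := by
    refine Measure.ext_of_singleton fun w => ?_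
    rw [Measure.pi_singleton, Measure.map_apply hFm (measurableSet_singleton _)]
    simp only [Measure.map_apply (hYm 0) (measurableSet_singleton _)]
    rw [← ENNReal.toReal_eq_toReal_iff' (measure_ne_top _ _)
      (ENNReal.prod_ne_top fun _ _ => measure_ne_top _ _), ENNReal.toReal_prod]
    set f : ℤ → ℕ → Fin N × Bool := fun x j =>
      if hx : x ∈ S then w ⟨x, hx⟩ ⟨min j M, by omega⟩ else Classical.arbitrary _ with hf
    have hfw : ∀ (x : S) (j : Fin (M + 1)), f x j = w x j := fun x j => by
      have : min (j : ℕ) M = j := by omega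
      simp [hf, this]
    have h1 := hcyl S M (fun x j => (f x j).1) fun x j => (f x j).2
    rw [← Finset.prod_coe_sort] at h1
    have e1 : F ⁻¹' {w} =
        {ω | ∀ x ∈ S, ∀ j ≤ M, Rc x j ω = (f x j).1 ∧ ξ x j ω = (f x j).2} := by
      ext ω
      simp only [mem_preimage, mem_singleton_iff, mem_ofPred_eq]
      constructor
      · rintro rfl x hx j hj
        have := hfw ⟨x, hx⟩ ⟨j, by omega⟩
        simp only at this
        rw [this]
        exact ⟨rfl, rfl⟩
      · intro h
        funext x j
        rw [← hfw]
        have := h x x.2 j (by omega)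
        exact Prod.ext this.1 this.2
    rw [e1, h1]
    refine Finset.prod_congr rfl fun x _ => ?_
    have h2 := hcyl {0} M (fun _ j => (f x j).1) fun _ j => (f x j).2
    rw [Finset.prod_singleton] at h2
    rw [← h2]
    congr 2
    ext ω
    simp only [mem_preimage, mem_singleton_iff, mem_ofPred_eq, Finset.mem_singleton, forall_eq]
    constructor
    · intro h
      funext j
      rw [← hfw]
      have := h j (by omega)
      exact Prod.ext this.1 this.2
    · intro h j hj
      have := (congrFun h ⟨j, by omega⟩).trans (hfw x ⟨j, by omega⟩).symm
      exact ⟨congrArg Prod.fst this, congrArg Prod.snd this⟩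
  set ext : (Fin (M + 1) → Fin N × Bool) → ℕ → Bool := fun w j =>
    (w ⟨min j M, by omega⟩).2 with hext
  have hextY : ∀ x ω, ∀ j ≤ M, ext (Y x ω) j = ξ x j ω := fun x ω j hj => by
    simp [hext, hY, min_eq_left hj]
  have hiff : ∀ x y ω, B x (fun j => ξ y j ω) ↔ B x (ext (Y y ω)) := fun x y ω =>
    ⟨hB x _ _ fun j hj => (hextY y ω j hj).symm, hB x _ _ fun j hj => hextY y ω j hj⟩
  have h1 : {ω | ∀ x ∈ S, B x fun j => ξ x j ω} =
      F ⁻¹' (Set.univ.pi fun x : S => {w | B x (ext w)}) := by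
    ext ω
    simp [hiff, hF]
  rw [h1, measureReal_def, ← Measure.map_apply hFm (Set.toFinite _).measurableSet, hpi,
    Measure.pi_pi, ENNReal.toReal_prod, ← Finset.prod_coe_sort S]
  refine Finset.prod_congr rfl fun x _ => ?_
  rw [Measure.map_apply (hYm 0) (Set.toFinite _).measurableSet, measureReal_def]
  congr 2
  ext ω
  simp [hiff]

lemma IsProbVec.exists_pos {v : Fin N → ℝ} (hv : IsProbVec v) : ∃ i, 0 < v i := by
  by_contra! h
  have := Finset.sum_nonpos fun i (_ : i ∈ Finset.univ) => h i
  rw [hv.2] at this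
  linarith

/-- Every finite pattern of coin tosses has positive probability. -/
lemma IsCookieEnv.measureReal_pattern_pos (henv : IsCookieEnv P K p η Rc ξ) (hK : IsStochastic K)
    (hp : ∀ i, p i ∈ Ioo (0 : ℝ) 1) (hη : IsProbVec η) (M : ℕ) (b : ℕ → Bool) :
    0 < P.real {ω | ∀ j ≤ M, ξ 0 j ω = b j} := by
  obtain ⟨r₀, hr₀⟩ := hη.exists_pos
  choose next hnext using fun r => IsProbVec.exists_pos (v := K r) ⟨hK.1 r, hK.2 r⟩
  set f : ℕ → Fin N := fun j => next^[j] r₀ with hf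
  have h := henv.2.2 {0} M (fun _ => f) fun _ => b
  refine lt_of_lt_of_le ?_ (measureReal_mono (μ := P) (s₁ := {ω | ∀ x ∈ ({0} : Finset ℤ), ∀ j ≤ M,
    Rc x j ω = f j ∧ ξ x j ω = b j}) fun ω hω j hj => (hω 0 (Finset.mem_singleton_self 0) j hj).2)
  rw [measureReal_def, h, Finset.prod_singleton]
  refine mul_pos (mul_pos hr₀ (Finset.prod_pos fun j _ => ?_)) (Finset.prod_pos fun j _ => ?_)
  · simp only [hf, Function.iterate_succ_apply']
    exact hnext _
  · have := hp (f j)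
    split_ifs
    · exact this.1
    · exact sub_pos.2 this.2

/-- Transition kernel of the pair (cookie, toss) along a stack. -/
def stackKernel (K : Matrix (Fin N) (Fin N) ℝ) (p : Fin N → ℝ) :
    Kernel (Fin N × Bool) (Fin N × Bool) :=
  Kernel.ofFunOfCountable fun s =>
    ∑ s' : Fin N × Bool, ENNReal.ofReal (K s.1 s'.1 * if s'.2 then p s'.1 else 1 - p s'.1) •
      Measure.dirac s'

lemma stackKernel_singleton (s s' : Fin N × Bool) :
    stackKernel K p s {s'} = ENNReal.ofReal (K s.1 s'.1 * if s'.2 then p s'.1 else 1 - p s'.1) := by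
  change (∑ t : Fin N × Bool, ENNReal.ofReal (K s.1 t.1 * if t.2 then p t.1 else 1 - p t.1) •
    Measure.dirac t) {s'} = _
  rw [Measure.finsetSum_apply, Finset.sum_eq_single s']
  · simp
  · intro t _ ht
    simp [ht]
  · simp

lemma isMarkovKernel_stackKernel (hK : IsStochastic K) (hp : ∀ i, p i ∈ Ioo (0 : ℝ) 1) :
    IsMarkovKernel (stackKernel K p) := by
  refine ⟨fun s => ⟨?_⟩⟩
  rw [← Finset.coe_univ, ← sum_measure_singleton]
  simp only [stackKernel_singleton]
  rw [← ENNReal.ofReal_sum_of_nonneg, Fintype.sum_prod_type]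
  · simp only [Fintype.sum_bool, if_true, Bool.false_eq_true, if_false]
    rw [← ENNReal.ofReal_one]
    exact congrArg _ ((Finset.sum_congr rfl fun i _ => by ring).trans (hK.2 s.1))
  · intro t _
    have := hp t.1
    refine mul_nonneg (hK.1 _ _) ?_
    split_ifs
    · exact this.1.le
    · exact (sub_pos.2 this.2).le

lemma IsCookieEnv.isMarkovChain (henv : IsCookieEnv P K p η Rc ξ) (hK : IsStochastic K)
    (hp : ∀ i, p i ∈ Ioo (0 : ℝ) 1) (x : ℤ) :
    IsMarkovChain P (stackKernel K p) fun j ω => (Rc x j ω, ξ x j ω) := by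
  refine ⟨fun j => (henv.1 x j).prodMk (henv.2.1 x j), fun k w => ?_⟩
  have hset : ∀ m, {ω | ∀ i ≤ m, (Rc x i ω, ξ x i ω) = w i} =
      {ω | ∀ y ∈ ({x} : Finset ℤ), ∀ j ≤ m, Rc y j ω = (w j).1 ∧ ξ y j ω = (w j).2} := by
    intro m
    ext ω
    simp [Prod.ext_iff]
  rw [stackKernel_singleton, ← ENNReal.toReal_eq_toReal_iff' (measure_ne_top _ _)
    (ENNReal.mul_ne_top (measure_ne_top _ _) ENNReal.ofReal_ne_top), ENNReal.toReal_mul,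
    hset, hset, henv.2.2 {x} k (fun _ j => (w j).1) fun _ j => (w j).2,
    henv.2.2 {x} (k + 1) (fun _ j => (w j).1) fun _ j => (w j).2, Finset.prod_singleton,
    Finset.prod_singleton, Finset.prod_range_succ _ k, Finset.prod_range_succ _ (k + 1),
    ENNReal.toReal_ofReal]
  · ring
  · have := hp (w (k + 1)).1
    refine mul_nonneg (hK.1 _ _) ?_
    split_ifs
    · exact this.1.le
    · exact (sub_pos.2 this.2).le

end Environment

/-! ### Exponential moments along a stack -/

section StackTail

variable {N : ℕ} {Ω : Type*} [MeasurableSpace Ω] {P : Measure Ω} [IsProbabilityMeasure P]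
  {K : Matrix (Fin N) (Fin N) ℝ} {p η : Fin N → ℝ} {Rc : ℤ → ℕ → Ω → Fin N}
  {ξ : ℤ → ℕ → Ω → Bool}

/-- The excess `failCount - ρ * succCount` after `n` tosses. -/
def excess (ρ : ℝ) (b : ℕ → Bool) (n : ℕ) : ℝ := failCount b n - ρ * succCount b n

lemma excess_succ (ρ : ℝ) (b : ℕ → Bool) (n : ℕ) :
    excess ρ b (n + 1) = excess ρ b n + if b n then -ρ else 1 := by
  rw [excess, excess, failCount_succ, succCount_succ]
  cases b n <;> simp <;> ring

lemma excess_congr {ρ : ℝ} {b b' : ℕ → Bool} {n : ℕ} (h : ∀ i < n, b i = b' i) :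
    excess ρ b n = excess ρ b' n := by
  induction n with
  | zero => simp [excess, failCount_zero, succCount_zero]
  | succ n ih =>
    rw [excess_succ, excess_succ, ih fun i hi => h i (by omega), h n (by omega)]

lemma measurable_excess (ρ : ℝ) {b : ℕ → Ω → Bool} (hb : ∀ j, Measurable (b j)) (n : ℕ) :
    Measurable fun ω => excess ρ (fun j => b j ω) n := by
  induction n with
  | zero => simp [excess, failCount_zero, succCount_zero]
  | succ n ih =>
    simp only [excess_succ]
    exact ih.add ((measurable_of_countable fun c : Bool => if c then -ρ else 1).comp (hb n))

/-- Geometric decay of the exponential moments of the excess. -/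
lemma IsCookieEnv.exists_lintegral_tsum_le (henv : IsCookieEnv P K p η Rc ξ)
    (hK : IsStochastic K) (hp : ∀ i, p i ∈ Ioo (0 : ℝ) 1) {θ ρ lam : ℝ} (hlam : 0 < lam)
    (hlam1 : lam < 1) {h : Fin N → ℝ}
    (hstep : ∀ r, (p r * Real.exp (-(θ * ρ)) + (1 - p r) * Real.exp θ) *
      ∑ j, K r j * Real.exp (θ * h j) ≤ lam * Real.exp (θ * h r)) :
    ∃ C : ℝ, 0 ≤ C ∧ ∀ x, ∫⁻ ω, ∑' n : ℕ,
      ENNReal.ofReal (Real.exp (θ * excess ρ (fun j => ξ x j ω) (n + 1))) ∂P ≤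
        ENNReal.ofReal C := by
  have := isMarkovKernel_stackKernel hK hp
  set u : Fin N → ℝ := fun r => ∑ j, K r j * Real.exp (θ * h j) with hu
  have hu0 : ∀ r, 0 < u r := fun r => by
    obtain ⟨j, hj⟩ := IsProbVec.exists_pos (v := K r) ⟨hK.1 r, hK.2 r⟩
    exact Finset.sum_pos' (fun i _ => mul_nonneg (hK.1 r i) (Real.exp_pos _).le)
      ⟨j, Finset.mem_univ j, mul_pos hj (Real.exp_pos _)⟩
  set w : Bool → ℝ := fun b => Real.exp (θ * if b then -ρ else 1) with hw
  have hw0 : ∀ b, 0 < w b := fun b => Real.exp_pos _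
  set φ : Fin N × Bool → ℝ := fun s => w s.2 * u s.1 with hφ
  have hφ0 : ∀ s, 0 < φ s := fun s => mul_pos (hw0 _) (hu0 _)
  set M : ℝ := ∑ s, φ s with hM
  have hM0 : 0 ≤ M := Finset.sum_nonneg fun s _ => (hφ0 s).le
  set D : ℝ := ∑ r, (u r)⁻¹ with hD
  have hD0 : 0 ≤ D := Finset.sum_nonneg fun r _ => (inv_pos.2 (hu0 r)).le
  have hφκ : ∀ s : Fin N × Bool, ∑ t, φ t * (K s.1 t.1 * if t.2 then p t.1 else 1 - p t.1) ≤ lam * u s.1 := by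
    intro s
    rw [Fintype.sum_prod_type, hu, Finset.mul_sum]
    refine Finset.sum_le_sum fun j _ => ?_
    have := mul_le_mul_of_nonneg_left (hstep j) (hK.1 s.1 j)
    simp only [Fintype.sum_bool, hφ, hw, if_true, Bool.false_eq_true, if_false, mul_neg, mul_one]
    linarith
  have hκ0 : ∀ s t : Fin N × Bool, 0 ≤ K s.1 t.1 * if t.2 then p t.1 else 1 - p t.1 :=
    fun s t => by
      have := hp t.1
      refine mul_nonneg (hK.1 _ _) ?_
      split_ifs
      · exact this.1.le
      · exact (sub_pos.2 this.2).le
  refine ⟨D * M * (1 - lam)⁻¹, mul_nonneg (mul_nonneg hD0 hM0)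
    (inv_pos.2 (sub_pos.2 hlam1)).le, fun x => ?_⟩
  set H : ℕ → Ω → ℝ := fun n ω => excess ρ (fun j => ξ x j ω) n with hH
  have hHm : ∀ n, Measurable (H n) := fun n => measurable_excess ρ (henv.2.1 x) n
  have hchain := henv.isMarkovChain hK hp x
  have hHφ : ∀ n ω, Real.exp (θ * H (n + 1) ω) * u (Rc x n ω) =
      Real.exp (θ * H n ω) * φ (Rc x n ω, ξ x n ω) := fun n ω => by
    simp only [hH, excess_succ, mul_add, Real.exp_add, hφ, hw]
    ring
  set A : ℕ → ENNReal := fun n =>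
    ∫⁻ ω, ENNReal.ofReal (Real.exp (θ * H n ω) * φ (Rc x n ω, ξ x n ω)) ∂P with hA
  have hA0 : A 0 ≤ ENNReal.ofReal M := by
    calc A 0 ≤ ∫⁻ ω, ENNReal.ofReal M ∂P := lintegral_mono fun ω => by
          refine ENNReal.ofReal_le_ofReal ?_
          simp only [hH, excess, failCount_zero, succCount_zero, Nat.cast_zero, mul_zero, sub_zero,
            Real.exp_zero, one_mul]
          exact Finset.single_le_sum (f := φ) (fun s _ => (hφ0 s).le) (Finset.mem_univ _)
      _ = ENNReal.ofReal M := by simp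
  have hAs : ∀ n, A (n + 1) ≤ ENNReal.ofReal lam * A n := by
    intro n
    have h1 := hchain.lintegral_step n
      (fun ω y => ENNReal.ofReal (Real.exp (θ * H (n + 1) ω) * φ y)) fun ω ω' hω => by
        have : H (n + 1) ω = H (n + 1) ω' :=
          excess_congr fun i hi => (Prod.ext_iff.1 (hω i (by omega))).2
        rw [this]
    rw [hA]
    simp only
    rw [h1, ← lintegral_const_mul' _ _ ENNReal.ofReal_ne_top]
    refine lintegral_mono fun ω => ?_
    rw [lintegral_fintype]
    simp only [stackKernel_singleton]
    rw [← ENNReal.ofReal_mul hlam.le]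
    simp only [← ENNReal.ofReal_mul (mul_pos (Real.exp_pos _) (hφ0 _)).le]
    rw [← ENNReal.ofReal_sum_of_nonneg]
    · refine ENNReal.ofReal_le_ofReal ?_
      rw [← hHφ]
      calc _ = Real.exp (θ * H (n + 1) ω) * ∑ t : Fin N × Bool,
            φ t * (K (Rc x n ω) t.1 * if t.2 then p t.1 else 1 - p t.1) := by
            rw [Finset.mul_sum]
            exact Finset.sum_congr rfl fun t _ => by ring
        _ ≤ Real.exp (θ * H (n + 1) ω) * (lam * u (Rc x n ω)) :=
            mul_le_mul_of_nonneg_left (hφκ (Rc x n ω, ξ x n ω)) (Real.exp_pos _).le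
        _ = _ := by ring
    · intro t _
      exact mul_nonneg (mul_pos (Real.exp_pos _) (hφ0 _)).le (hκ0 (Rc x n ω, ξ x n ω) t)
  have hAn : ∀ n, A n ≤ ENNReal.ofReal (lam ^ n * M) := by
    intro n
    induction n with
    | zero => simpa using hA0
    | succ n ih =>
      refine (hAs n).trans ((mul_le_mul_right ih _).trans (le_of_eq ?_))
      rw [← ENNReal.ofReal_mul hlam.le]
      congr 1
      ring
  have hterm : ∀ n, ∫⁻ ω, ENNReal.ofReal (Real.exp (θ * H (n + 1) ω)) ∂P ≤
      ENNReal.ofReal (D * M * lam ^ n) := by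
    intro n
    calc ∫⁻ ω, ENNReal.ofReal (Real.exp (θ * H (n + 1) ω)) ∂P ≤ ENNReal.ofReal D * A n := by
          rw [hA, ← lintegral_const_mul' _ _ ENNReal.ofReal_ne_top]
          refine lintegral_mono fun ω => ?_
          rw [← ENNReal.ofReal_mul hD0, ← hHφ]
          refine ENNReal.ofReal_le_ofReal ?_
          have h2 : (u (Rc x n ω))⁻¹ ≤ D := Finset.single_le_sum (f := fun r => (u r)⁻¹)
            (fun r _ => (inv_pos.2 (hu0 r)).le) (Finset.mem_univ _)
          have h3 := mul_le_mul_of_nonneg_right h2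
            (mul_pos (Real.exp_pos (θ * H (n + 1) ω)) (hu0 (Rc x n ω))).le
          refine le_trans (le_of_eq ?_) h3
          have := (hu0 (Rc x n ω)).ne'
          field_simp
      _ ≤ ENNReal.ofReal D * ENNReal.ofReal (lam ^ n * M) := mul_le_mul_right (hAn n) _
      _ = _ := by
          rw [← ENNReal.ofReal_mul hD0]
          congr 1
          ring
  rw [lintegral_tsum fun n => ((hHm (n + 1)).const_mul θ).exp.ennreal_ofReal.aemeasurable]
  refine (ENNReal.tsum_le_tsum hterm).trans (le_of_eq ?_)
  rw [← ENNReal.ofReal_tsum_of_nonneg (fun n => by positivity)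
    ((summable_geometric_of_lt_one hlam.le hlam1).mul_left _), tsum_mul_left,
    tsum_geometric_of_lt_one hlam.le hlam1]

lemma infinite_of_tsum_lt_top {θ ρ : ℝ} (hθ : 0 < θ) (hρ1 : ρ ≤ 1) {b : ℕ → Bool}
    (h : ∑' n : ℕ, ENNReal.ofReal (Real.exp (θ * excess ρ b (n + 1))) ≠ ⊤) :
    {j | b j = true}.Infinite := by
  intro hfin
  have h1 := ENNReal.tendsto_atTop_zero_of_tsum_ne_top h
  have h2 := h1.eventually (gt_mem_nhds (show (0 : ENNReal) < 1 by simp))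
  obtain ⟨n, hn, hn2⟩ := (h2.and (eventually_ge_atTop (2 * hfin.toFinset.card))).exists
  rw [← ENNReal.ofReal_one, ENNReal.ofReal_lt_ofReal_iff one_pos, Real.exp_lt_one_iff] at hn
  have h3 : excess ρ b (n + 1) < 0 := by
    by_contra! h4
    exact absurd hn (not_lt.2 (mul_nonneg hθ.le h4))
  have h4 : succCount b (n + 1) ≤ hfin.toFinset.card := by
    rw [succCount, Nat.count_eq_card_filter_range]
    exact Finset.card_le_card fun j hj => by simpa using (Finset.mem_filter.1 hj).2
  have h5 := succCount_add_failCount b (n + 1)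
  rw [excess] at h3
  have h6 : (failCount b (n + 1) : ℝ) < succCount b (n + 1) := by
    nlinarith [(Nat.cast_nonneg (succCount b (n + 1)) : (0 : ℝ) ≤ _)]
  have h7 : failCount b (n + 1) < succCount b (n + 1) := by exact_mod_cast h6
  omega

lemma exp_failsBefore_le {θ ρ : ℝ} {b : ℕ → Bool} (hb : {j | b j = true}.Infinite) (z : ℕ) :
    ENNReal.ofReal (Real.exp (θ * failsBefore b z)) ≤
      ENNReal.ofReal (Real.exp (θ * ρ * (z + 1))) *
        ∑' n : ℕ, ENNReal.ofReal (Real.exp (θ * excess ρ b (n + 1))) := by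
  obtain ⟨h1, h2, h3⟩ := nth_success hb z
  refine le_trans (le_of_eq ?_) (mul_le_mul_right (ENNReal.le_tsum (z + failsBefore b z)) _)
  rw [← ENNReal.ofReal_mul (Real.exp_pos _).le, ← Real.exp_add, excess_succ, h3, excess, h1, h2]
  congr 2
  simp
  ring

end StackTail

/-! ### The branching process of failures is a Markov chain -/

lemma failsBefore_eq_iff {b : ℕ → Bool} (hb : {j | b j = true}.Infinite) {z y : ℕ} :
    failsBefore b z = y ↔ succCount b (z + y) = z ∧ b (z + y) = true := by
  constructor
  · rintro rfl
    obtain ⟨h1, -, h3⟩ := nth_success hb z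
    exact ⟨h1, h3⟩
  · rintro ⟨h1, h2⟩
    have h3 := Nat.nth_count (p := fun j => b j = true) h2
    have h4 : Nat.count (fun j => b j = true) (z + y) = z := h1
    rw [h4] at h3
    rw [failsBefore, h3]
    omega

lemma succCount_congr {b b' : ℕ → Bool} {n : ℕ} (h : ∀ i < n, b i = b' i) :
    succCount b n = succCount b' n := by
  induction n with
  | zero => rw [succCount_zero, succCount_zero]
  | succ n ih =>
    rw [succCount_succ, succCount_succ, ih fun i hi => h i (by omega), h n (by omega)]

section Branching

variable {N : ℕ} {Ω : Type*} [MeasurableSpace Ω] {P : Measure Ω}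
  {K : Matrix (Fin N) (Fin N) ℝ} {p η : Fin N → ℝ} {Rc : ℤ → ℕ → Ω → Fin N}
  {ξ : ℤ → ℕ → Ω → Bool}

lemma measurableSet_succCount {b : ℕ → Ω → Bool} (hb : ∀ j, Measurable (b j)) (z y : ℕ) :
    MeasurableSet {ω | succCount (fun j => b j ω) (z + y) = z ∧ b (z + y) ω = true} := by
  have h1 : ∀ n, Measurable fun ω => succCount (fun j => b j ω) n := by
    intro n
    induction n with
    | zero => simp [succCount_zero]
    | succ n ih =>
      simp only [succCount_succ]
      exact ih.add ((measurable_of_countable fun c : Bool => if c = true then 1 else 0).comp (hb n))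
  exact (h1 _ (measurableSet_singleton z)).inter (hb _ (measurableSet_singleton true))

lemma measurable_failsBefore {b : ℕ → Ω → Bool} (hb : ∀ j, Measurable (b j))
    (hinf : ∀ ω, {j | b j ω = true}.Infinite) (z : ℕ) :
    Measurable fun ω => failsBefore (fun j => b j ω) z := by
  refine measurable_to_countable' fun y => ?_
  have : (fun ω => failsBefore (fun j => b j ω) z) ⁻¹' {y} =
      {ω | succCount (fun j => b j ω) (z + y) = z ∧ b (z + y) ω = true} := by
    ext ω
    exact failsBefore_eq_iff (hinf ω)
  rw [this]
  exact measurableSet_succCount hb z y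

/-- The law of the number of failures before the `(z + 1)`-st success. -/
def failsKernel (P : Measure Ω) (b : ℕ → Ω → Bool) : Kernel ℕ ℕ :=
  Kernel.ofFunOfCountable fun z => P.map fun ω => failsBefore (fun j => b j ω) z

lemma failsKernel_singleton {b : ℕ → Ω → Bool} (hb : ∀ j, Measurable (b j))
    (hinf : ∀ ω, {j | b j ω = true}.Infinite) (z y : ℕ) :
    failsKernel P b z {y} =
      P {ω | succCount (fun j => b j ω) (z + y) = z ∧ b (z + y) ω = true} := by
  change P.map (fun ω => failsBefore (fun j => b j ω) z) {y} = _
  rw [Measure.map_apply (measurable_failsBefore hb hinf z) (measurableSet_singleton y)]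
  congr 1
  ext ω
  exact failsBefore_eq_iff (hinf ω)

variable [IsProbabilityMeasure P]

lemma isMarkovKernel_failsKernel {b : ℕ → Ω → Bool} (hb : ∀ j, Measurable (b j))
    (hinf : ∀ ω, {j | b j ω = true}.Infinite) : IsMarkovKernel (failsKernel P b) :=
  ⟨fun z => Measure.isProbabilityMeasure_map (measurable_failsBefore hb hinf z).aemeasurable⟩

lemma succCount_of_eq_decide {b : ℕ → Bool} {z : ℕ} :
    ∀ {n : ℕ}, (∀ j < n, b j = decide (j < z)) → succCount b n = min n z := by
  intro n
  induction n with
  | zero => simp [succCount_zero]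
  | succ n ih =>
    intro h
    rw [succCount_succ, ih fun j hj => h j (by omega), h n (by omega)]
    by_cases hn : n < z <;> simp [hn] <;> omega

lemma IsCookieEnv.failsKernel_ne_zero (henv : IsCookieEnv P K p η Rc ξ) (hK : IsStochastic K)
    (hp : ∀ i, p i ∈ Ioo (0 : ℝ) 1) (hη : IsProbVec η)
    (hinf : ∀ ω, {j | ξ 0 j ω = true}.Infinite) (z y : ℕ) : failsKernel P (ξ 0) z {y} ≠ 0 := by
  rw [failsKernel_singleton (henv.2.1 0) hinf]
  have h1 := henv.measureReal_pattern_pos hK hp hη (z + y)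
    fun j => if j = z + y then true else decide (j < z)
  intro h2
  refine h1.ne' ((measureReal_eq_zero_iff (measure_ne_top _ _)).2 (measure_mono_null ?_ h2))
  intro ω hω
  refine ⟨?_, by simpa using hω (z + y) le_rfl⟩
  rw [succCount_of_eq_decide (z := z) fun j hj => by simpa [hj.ne] using hω j hj.le]
  exact min_eq_right (Nat.le_add_right z y)

lemma branching_path_iff {ζ : ℤ → ℕ → Bool} (hζ : ∀ x, {j | ζ x j = true}.Infinite) (m : ℤ)
    (w : ℕ → ℕ) (k : ℕ) :
    (∀ i ≤ k, branching ζ m i = w i) ↔ w 0 = 0 ∧ ∀ i < k,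
      succCount (ζ (m - 1 - i)) (w i + w (i + 1)) = w i ∧
        ζ (m - 1 - i) (w i + w (i + 1)) = true := by
  simp only [← failsBefore_eq_iff (hζ _)]
  induction k with
  | zero => simp [branching, eq_comm]
  | succ k ih =>
    have h1 : (∀ i ≤ k + 1, branching ζ m i = w i) ↔
        (∀ i ≤ k, branching ζ m i = w i) ∧ branching ζ m (k + 1) = w (k + 1) := by
      refine ⟨fun h => ⟨fun i hi => h i (by omega), h _ le_rfl⟩, fun h i hi => ?_⟩
      rcases Nat.lt_or_ge k i with h2 | h2
      · rw [show i = k + 1 by omega, h.2]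
      · exact h.1 i h2
    rw [h1, Nat.forall_lt_succ_right, ← and_assoc, ← ih]
    refine and_congr_right fun h2 => ?_
    rw [← h2 k le_rfl]
    rfl

lemma IsCookieEnv.isMarkovChain_branching (henv : IsCookieEnv P K p η Rc ξ) [Nonempty (Fin N)]
    (hinf : ∀ ω x, {j | ξ x j ω = true}.Infinite) (m : ℤ) :
    IsMarkovChain P (failsKernel P (ξ 0)) fun k ω => branching (fun x j => ξ x j ω) m k := by
  constructor
  · intro k
    induction k with
    | zero => exact measurable_const
    | succ k ih =>
      have h1 : Measurable fun q : ℕ × Ω => failsBefore (fun j => ξ (m - 1 - k) j q.2) q.1 :=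
        measurable_from_prod_countable_right fun z =>
          measurable_failsBefore (henv.2.1 _) (fun ω => hinf ω _) z
      exact h1.comp (ih.prodMk measurable_id)
  · intro k w
    by_cases hw : w 0 = 0
    swap
    · have h1 : ∀ n, {ω | ∀ i ≤ n, branching (fun x j => ξ x j ω) m i = w i} = ∅ := fun n => by
        ext ω
        simp only [mem_ofPred_eq, mem_empty_iff_false, iff_false]
        exact fun h => hw (h 0 (Nat.zero_le _)).symm
      rw [h1, h1, measure_empty, zero_mul]
    set B : ℤ → (ℕ → Bool) → Prop := fun x b =>
      succCount b (w (m - 1 - x).toNat + w ((m - 1 - x).toNat + 1)) = w (m - 1 - x).toNat ∧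
        b (w (m - 1 - x).toNat + w ((m - 1 - x).toNat + 1)) = true with hB
    have hBi : ∀ (i : ℕ) b, B (m - 1 - i) b ↔
        succCount b (w i + w (i + 1)) = w i ∧ b (w i + w (i + 1)) = true := fun i b => by
      simp only [hB]
      rw [show (m - 1 - (m - 1 - (i : ℤ))).toNat = i by omega]
    set S : ℕ → Finset ℤ := fun n => (Finset.range n).image fun i : ℕ => m - 1 - i with hS
    have hinj : Function.Injective fun i : ℕ => m - 1 - (i : ℤ) := fun i j hij => by
      simp only at hij
      omega
    have hpath : ∀ n, P.real {ω | ∀ i ≤ n, branching (fun x j => ξ x j ω) m i = w i} =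
        ∏ i ∈ Finset.range n, P.real {ω | succCount (fun j => ξ 0 j ω) (w i + w (i + 1)) = w i ∧
          ξ 0 (w i + w (i + 1)) ω = true} := by
      intro n
      have h1 := henv.measureReal_forall_mem (S n) (∑ i ∈ Finset.range n, (w i + w (i + 1)))
        (fun x b => x ∈ S n → B x b) ?_
      · have h2 : {ω | ∀ i ≤ n, branching (fun x j => ξ x j ω) m i = w i} =
            {ω | ∀ x ∈ S n, x ∈ S n → B x fun j => ξ x j ω} := by
          ext ω
          simp only [mem_ofPred_eq, branching_path_iff (hinf ω), hw, true_and, hS,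
            Finset.forall_mem_image, Finset.mem_range, hBi]
          refine forall₂_congr fun i hi => ?_
          rw [imp_iff_right (Finset.mem_image_of_mem _ (Finset.mem_range.2 hi))]
        rw [h2, h1, hS, Finset.prod_image fun i _ j _ hij => hinj hij]
        refine Finset.prod_congr rfl fun i hi => ?_
        congr 1
        ext ω
        rw [mem_ofPred_eq, imp_iff_right (Finset.mem_image_of_mem _ hi), hBi]
        rfl
      · intro x b b' hbb h hx
        obtain ⟨i, hi, rfl⟩ := Finset.mem_image.1 hx
        have hle : w i + w (i + 1) ≤ ∑ i ∈ Finset.range n, (w i + w (i + 1)) :=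
          Finset.single_le_sum (f := fun i => w i + w (i + 1)) (fun _ _ => Nat.zero_le _) hi
        have h3 := (hBi i b).1 (h hx)
        rw [hBi, ← hbb _ hle, ← succCount_congr fun j hj => hbb j (hj.le.trans hle)]
        exact h3
    rw [failsKernel_singleton (henv.2.1 0) fun ω => hinf ω 0,
      ← ENNReal.toReal_eq_toReal_iff' (measure_ne_top _ _)
      (ENNReal.mul_ne_top (measure_ne_top _ _) (measure_ne_top _ _)), ENNReal.toReal_mul]
    have h1 := hpath (k + 1)
    rw [Finset.prod_range_succ, ← hpath k] at h1
    exact h1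

end Branching

/-! ### Environments with infinitely many successes, and their drift -/

section Regular

variable {N : ℕ} {Ω : Type*} [MeasurableSpace Ω] {P : Measure Ω}
  {K : Matrix (Fin N) (Fin N) ℝ} {μ p η : Fin N → ℝ} {Rc : ℤ → ℕ → Ω → Fin N}
  {ξ : ℤ → ℕ → Ω → Bool}

lemma IsCookieEnv.congr (henv : IsCookieEnv P K p η Rc ξ) {ξ' : ℤ → ℕ → Ω → Bool}
    (hm : ∀ x j, Measurable (ξ' x j)) (h : ∀ᵐ ω ∂P, ∀ x j, ξ' x j ω = ξ x j ω) :
    IsCookieEnv P K p η Rc ξ' := by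
  refine ⟨henv.1, hm, fun S m f b => ?_⟩
  rw [← henv.2.2 S m f b]
  congr 1
  refine measure_congr ?_
  filter_upwards [h] with ω hω
  refine propext ?_
  change (∀ x ∈ S, ∀ j ≤ m, _) ↔ (∀ x ∈ S, ∀ j ≤ m, _)
  simp only [hω]

lemma Drift.of_exp {κ : Kernel ℕ ℕ} [IsMarkovKernel κ] {θ ρ C : ℝ} (hθ : 0 < θ) (hρ : ρ < 1)
    (hC : 0 ≤ C) (h : ∀ z : ℕ, ∫⁻ y : ℕ, ENNReal.ofReal (Real.exp (θ * y)) ∂κ z ≤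
      ENNReal.ofReal (C * Real.exp (θ * ρ * (z + 1)))) :
    Drift κ fun z : ℕ => Real.exp (θ * z) := by
  have h_int : ∀ z : ℕ, Integrable (fun y : ℕ => Real.exp (θ * y)) (κ z) := fun z =>
    ⟨(measurable_of_countable _).aestronglyMeasurable, by
      rw [hasFiniteIntegral_iff_ofReal (ae_of_all _ fun y => (Real.exp_pos _).le)]
      exact (h z).trans_lt ENNReal.ofReal_lt_top⟩
  have hcast : Tendsto (fun z : ℕ => (z : ℝ)) atTop atTop := tendsto_natCast_atTop_atTop
  refine ⟨fun z => Real.one_le_exp (by positivity),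
    Real.tendsto_exp_atTop.comp (hcast.const_mul_atTop hθ), h_int, ?_⟩
  have hlim : Tendsto (fun z : ℕ => Real.exp (θ * (1 - ρ) * z)) atTop atTop :=
    Real.tendsto_exp_atTop.comp (hcast.const_mul_atTop (mul_pos hθ (sub_pos.2 hρ)))
  obtain ⟨z₀, hz₀⟩ := eventually_atTop.1
    (hlim.eventually_ge_atTop (2 * (C * Real.exp (θ * ρ))))
  refine ⟨∑ i ∈ Finset.range z₀, C * Real.exp (θ * ρ * (i + 1)), fun z => ?_⟩
  have h1 : ∫ y : ℕ, Real.exp (θ * y) ∂κ z ≤ C * Real.exp (θ * ρ * (z + 1)) := by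
    rw [integral_eq_lintegral_of_nonneg_ae (ae_of_all _ fun y => (Real.exp_pos _).le)
      (h_int z).aestronglyMeasurable]
    exact ENNReal.toReal_le_of_le_ofReal (by positivity) (h z)
  have h0 : ∀ i : ℕ, 0 ≤ C * Real.exp (θ * ρ * (i + 1)) := fun i => by positivity
  rcases lt_or_ge z z₀ with hz | hz
  · have := Finset.single_le_sum (f := fun i : ℕ => C * Real.exp (θ * ρ * (i + 1)))
      (fun i _ => h0 i) (Finset.mem_range.2 hz)
    linarith [Real.exp_pos (θ * z)]
  · have h2 := mul_le_mul_of_nonneg_right (hz₀ z hz) (Real.exp_pos (θ * ρ * z)).le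
    rw [← Real.exp_add, mul_assoc, mul_assoc, ← Real.exp_add] at h2
    have e1 : θ * ρ + θ * ρ * z = θ * ρ * (z + 1) := by ring
    have e2 : θ * (1 - ρ) * z + θ * ρ * z = θ * z := by ring
    rw [e1, e2] at h2
    have := Finset.sum_nonneg fun i (_ : i ∈ Finset.range z₀) => h0 i
    linarith

variable [IsProbabilityMeasure P]

/-- One may assume that every site has infinitely many successes. -/
lemma IsCookieEnv.exists_regular (henv : IsCookieEnv P K p η Rc ξ) (hK : IsStochastic K)
    (hμ : HasUniqueStationaryDist K μ) (hp : ∀ i, p i ∈ Ioo (0 : ℝ) 1)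
    (hp2 : 1 / 2 < ∑ i, μ i * p i) :
    ∃ ξ' : ℤ → ℕ → Ω → Bool, IsCookieEnv P K p η Rc ξ' ∧
      (∀ ω x, {j | ξ' x j ω = true}.Infinite) ∧ ∀ᵐ ω ∂P, ∀ x j, ξ' x j ω = ξ x j ω := by
  obtain ⟨ρ, θ₀, -, hρ1, hθ₀, h, hh⟩ := hμ.exists_exponential_rate hK hp hp2
  obtain ⟨lam, hlam, hlam1, hstep⟩ := hh (θ₀ / 2) (by linarith) (by linarith)
  obtain ⟨C, -, hC⟩ := henv.exists_lintegral_tsum_le hK hp hlam hlam1 hstep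
  have hinf : ∀ᵐ ω ∂P, ∀ x, {j | ξ x j ω = true}.Infinite := by
    refine ae_all_iff.2 fun x => ?_
    have hm : Measurable fun ω => ∑' n : ℕ,
        ENNReal.ofReal (Real.exp (θ₀ / 2 * excess ρ (fun j => ξ x j ω) (n + 1))) :=
      Measurable.tsum fun n =>
        ((measurable_excess ρ (henv.2.1 x) (n + 1)).const_mul _).exp.ennreal_ofReal
    filter_upwards [ae_lt_top hm ((hC x).trans_lt ENNReal.ofReal_lt_top).ne] with ω hω
    exact infinite_of_tsum_lt_top (by linarith) hρ1.le hω.ne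
  set T := toMeasurable P {ω | ¬ ∀ x, {j | ξ x j ω = true}.Infinite} with hT
  have hT0 : P T = 0 := by rw [hT, measure_toMeasurable]; exact hinf
  have hTsub : ∀ ω ∉ T, ∀ x, {j | ξ x j ω = true}.Infinite := fun ω hω => by
    by_contra h1
    exact hω (subset_toMeasurable _ _ h1)
  have hae : ∀ᵐ ω ∂P, ∀ x j, (if ω ∈ T then true else ξ x j ω) = ξ x j ω := by
    filter_upwards [measure_eq_zero_iff_ae_notMem.1 hT0] with ω hω x j
    rw [if_neg hω]
  refine ⟨fun x j ω => if ω ∈ T then true else ξ x j ω, henv.congr (fun x j =>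
    Measurable.ite (measurableSet_toMeasurable _ _) measurable_const (henv.2.1 x j)) hae,
    fun ω x => ?_, hae⟩
  by_cases hω : ω ∈ T
  · simp [hω, Set.infinite_univ]
  · simpa [hω] using hTsub ω hω x

/-- Geometric drift of the branching process for three powers of an exponential weight. -/
lemma IsCookieEnv.exists_drift (henv : IsCookieEnv P K p η Rc ξ) (hK : IsStochastic K)
    (hμ : HasUniqueStationaryDist K μ) (hp : ∀ i, p i ∈ Ioo (0 : ℝ) 1)
    (hp2 : 1 / 2 < ∑ i, μ i * p i) (hinf : ∀ ω, {j | ξ 0 j ω = true}.Infinite) :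
    ∃ (V : ℕ → ℝ) (c : ℝ), Drift (failsKernel P (ξ 0)) V ∧
      Drift (failsKernel P (ξ 0)) (fun z => V z ^ 2) ∧
      Drift (failsKernel P (ξ 0)) (fun z => V z ^ 3) ∧ ∀ z : ℕ, (z : ℝ) ≤ c * V z := by
  have := isMarkovKernel_failsKernel (P := P) (henv.2.1 0) hinf
  obtain ⟨ρ, θ₀, hρ0, hρ1, hθ₀, h, hh⟩ := hμ.exists_exponential_rate hK hp hp2
  have key : ∀ θ, 0 < θ → θ < θ₀ →
      Drift (failsKernel P (ξ 0)) fun z : ℕ => Real.exp (θ * z) := by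
    intro θ hθ hθ1
    obtain ⟨lam, hlam, hlam1, hstep⟩ := hh θ hθ hθ1
    obtain ⟨C, hC0, hC⟩ := henv.exists_lintegral_tsum_le hK hp hlam hlam1 hstep
    refine Drift.of_exp hθ hρ1 hC0 fun z => ?_
    change ∫⁻ y : ℕ, ENNReal.ofReal (Real.exp (θ * y))
      ∂(P.map fun ω => failsBefore (fun j => ξ 0 j ω) z) ≤ _
    rw [lintegral_map (measurable_of_countable _) (measurable_failsBefore (henv.2.1 0) hinf z)]
    refine (lintegral_mono fun ω => exp_failsBefore_le (ρ := ρ) (hinf ω) z).trans ?_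
    rw [lintegral_const_mul' _ _ ENNReal.ofReal_ne_top, mul_comm C,
      ENNReal.ofReal_mul (Real.exp_pos _).le]
    exact mul_le_mul_right (hC 0) _
  have hpow : ∀ k : ℕ, (fun z : ℕ => Real.exp (θ₀ / 4 * z) ^ k) =
      fun z : ℕ => Real.exp (k * (θ₀ / 4) * z) := fun k => by
    funext z
    rw [← Real.exp_nat_mul, mul_assoc]
  refine ⟨fun z => Real.exp (θ₀ / 4 * z), (θ₀ / 4)⁻¹, key _ (by linarith) (by linarith), ?_, ?_,
    fun z => ?_⟩
  · rw [hpow 2]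
    exact key _ (by push_cast; linarith) (by push_cast; linarith)
  · rw [hpow 3]
    exact key _ (by push_cast; linarith) (by push_cast; linarith)
  · have h1 := Real.add_one_le_exp (θ₀ / 4 * z)
    rw [inv_mul_eq_div, le_div_iff₀ (by linarith)]
    linarith

end Regular

/-! ### Deterministic asymptotics -/

lemma stdGaussianCDF_add_neg (x : ℝ) : stdGaussianCDF x + stdGaussianCDF (-x) = 1 := by
  have h1 : (gaussianReal 0 1).real (Iic (-x)) = (gaussianReal 0 1).real (Ioi x) := by
    have h2 : (gaussianReal 0 1).map (fun y => -y) = gaussianReal 0 1 := by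
      simpa using gaussianReal_map_neg (μ := 0) (v := 1)
    have h3 : (fun y : ℝ => -y) ⁻¹' Iic (-x) = Ici x := by
      ext y
      simp
    conv_lhs => rw [← h2]
    rw [measureReal_def, Measure.map_apply measurable_neg measurableSet_Iic, h3, measureReal_def]
    have := nullSingletonClass_gaussianReal (μ := 0) (v := 1) one_ne_zero
    rw [measure_congr Ioi_ae_eq_Ici]
  rw [stdGaussianCDF_eq, stdGaussianCDF_eq, h1, ← compl_Iic,
    probReal_compl_eq_one_sub measurableSet_Iic]
  ring

lemma tendsto_inv_sqrt_natCast : Tendsto (fun n : ℕ => (√(n : ℝ))⁻¹) atTop (nhds 0) :=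
  (Real.tendsto_sqrt_atTop.comp tendsto_natCast_atTop_atTop).inv_tendsto_atTop

lemma tendsto_threshold {a v σ c : ℝ} (hv0 : 0 < v) (hv : v * (1 + 2 * a) = 1) (hσ : 0 < σ)
    {m r : ℕ → ℕ} (hm : Tendsto (fun n : ℕ => ((m n : ℝ) - n * v) / √n) atTop (nhds c))
    (hr : Tendsto (fun n : ℕ => (r n : ℝ) / √n) atTop (nhds 0)) :
    Tendsto (fun n => m n + r n + 1) atTop atTop ∧
      Tendsto (fun n : ℕ => (((n : ℝ) - m n) / 2 - a * ((m n + r n + 1 : ℕ) : ℝ)) /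
        (σ * √((m n + r n + 1 : ℕ) : ℝ))) atTop (nhds (-((1 + 2 * a) * c / (2 * (σ * √v))))) := by
  have hL : Tendsto (fun n : ℕ => ((m n + r n + 1 : ℕ) : ℝ) / n) atTop (nhds v) := by
    have h1 := ((hm.mul tendsto_inv_sqrt_natCast).add (hr.mul tendsto_inv_sqrt_natCast)).add
      (tendsto_inv_sqrt_natCast.mul tendsto_inv_sqrt_natCast)
    have h2 := h1.const_add v
    simp only [mul_zero, add_zero] at h2
    refine h2.congr' ?_
    filter_upwards [eventually_gt_atTop 0] with n hn
    have hn0 : (0 : ℝ) < n := Nat.cast_pos.2 hn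
    have hs : 0 < √(n : ℝ) := Real.sqrt_pos.2 hn0
    have hs2 : √(n : ℝ) ^ 2 = n := Real.sq_sqrt hn0.le
    push_cast
    field_simp
    rw [hs2]
    field_simp
    ring
  refine ⟨?_, ?_⟩
  · have h1 := hL.pos_mul_atTop hv0 (tendsto_natCast_atTop_atTop (R := ℝ))
    rw [← tendsto_natCast_atTop_iff (R := ℝ)]
    refine h1.congr' ?_
    filter_upwards [eventually_gt_atTop 0] with n hn
    exact div_mul_cancel₀ _ (Nat.cast_pos.2 hn).ne'
  · have hden := hL.sqrt.const_mul σ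
    have hnum := ((hm.const_mul (-((1 + 2 * a) / 2))).sub (hr.const_mul a)).sub
      (tendsto_inv_sqrt_natCast.const_mul a)
    have h1 := hnum.div hden (mul_pos hσ (Real.sqrt_pos.2 hv0)).ne'
    have e1 : (-((1 + 2 * a) / 2) * c - a * 0 - a * 0) / (σ * √v) =
        -((1 + 2 * a) * c / (2 * (σ * √v))) := by
      field_simp
      ring
    rw [e1] at h1
    refine h1.congr' ?_
    filter_upwards [eventually_gt_atTop 0] with n hn
    have hn0 : (0 : ℝ) < n := Nat.cast_pos.2 hn
    have hs : 0 < √(n : ℝ) := Real.sqrt_pos.2 hn0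
    have hl : 0 < √((m n + r n + 1 : ℕ) : ℝ) := Real.sqrt_pos.2 (Nat.cast_pos.2 (Nat.succ_pos _))
    simp only [Pi.div_apply]
    rw [Real.sqrt_div (Nat.cast_nonneg _), ← mul_div_assoc σ, div_div_eq_mul_div]
    congr 1
    have h2 : (n : ℝ) * (v * (1 + 2 * a)) = n := by rw [hv, mul_one]
    field_simp
    push_cast
    linarith

lemma tendsto_natSqrt_atTop : Tendsto Nat.sqrt atTop atTop :=
  tendsto_atTop.2 fun b => (eventually_ge_atTop (b * b)).mono fun _ hn => Nat.le_sqrt.2 hn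

lemma tendsto_natFloor_threshold {v c : ℝ} (hv : 0 < v) {t : ℕ → ℝ}
    (ht : Tendsto (fun n : ℕ => (t n - n * v) / √n) atTop (nhds c)) :
    (∀ᶠ n in atTop, 0 ≤ t n) ∧
      Tendsto (fun n : ℕ => ((⌊t n⌋₊ : ℝ) - n * v) / √n) atTop (nhds c) := by
  have h0 : ∀ᶠ n in atTop, 0 ≤ t n := by
    have h1 := ((Real.tendsto_sqrt_atTop.comp (tendsto_natCast_atTop_atTop (R := ℝ))).atTop_mul_const
      hv).atTop_add ht
    filter_upwards [h1.eventually_ge_atTop 0, eventually_gt_atTop 0] with n hn hn0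
    have hs : 0 < √(n : ℝ) := Real.sqrt_pos.2 (Nat.cast_pos.2 hn0)
    have hs2 : √(n : ℝ) * √(n : ℝ) = n := Real.mul_self_sqrt (Nat.cast_nonneg n)
    have e : t n = √(n : ℝ) * (√(n : ℝ) * v + (t n - n * v) / √n) := by
      rw [mul_add, mul_div_cancel₀ _ hs.ne', ← mul_assoc, hs2]
      ring
    rw [e]
    exact mul_nonneg hs.le hn
  refine ⟨h0, ?_⟩
  have hlow : Tendsto (fun n : ℕ => (t n - n * v) / √n - (√(n : ℝ))⁻¹) atTop (nhds c) := by
    simpa using ht.sub tendsto_inv_sqrt_natCast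
  refine tendsto_of_tendsto_of_tendsto_of_le_of_le' hlow ht ?_ ?_
  · refine Eventually.of_forall fun n => ?_
    rw [← one_div, ← sub_div]
    refine div_le_div_of_nonneg_right ?_ (Real.sqrt_nonneg _)
    linarith [Nat.lt_floor_add_one (t n)]
  · filter_upwards [h0] with n hn
    gcongr
    exact Nat.floor_le hn

lemma tendsto_sqrt_sqrt_div :
    Tendsto (fun n : ℕ => ((Nat.sqrt (Nat.sqrt n) : ℕ) : ℝ) / √n) atTop (nhds 0) := by
  have hsq := tendsto_natSqrt_atTop
  have h1 : Tendsto (fun n : ℕ => ((Nat.sqrt (Nat.sqrt n) : ℕ) : ℝ)⁻¹) atTop (nhds 0) :=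
    (tendsto_natCast_atTop_atTop.comp (hsq.comp hsq)).inv_tendsto_atTop
  refine squeeze_zero' (Eventually.of_forall fun n => by positivity) ?_ h1
  filter_upwards [(hsq.comp hsq).eventually_gt_atTop 0] with n hn
  simp only [Function.comp_apply] at hn
  have h2 : (Nat.sqrt (Nat.sqrt n) * Nat.sqrt (Nat.sqrt n)) *
      (Nat.sqrt (Nat.sqrt n) * Nat.sqrt (Nat.sqrt n)) ≤ n :=
    (Nat.mul_le_mul (Nat.sqrt_le _) (Nat.sqrt_le _)).trans (Nat.sqrt_le _)
  set s := Nat.sqrt (Nat.sqrt n)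
  have hs : (0 : ℝ) < s := Nat.cast_pos.2 hn
  have h3 : (s : ℝ) * s ≤ √n := by
    refine Real.le_sqrt_of_sq_le ?_
    have : ((s * s * (s * s) : ℕ) : ℝ) ≤ n := Nat.cast_le.2 h2
    push_cast at this
    nlinarith
  rw [div_le_iff₀ (lt_of_lt_of_le (mul_pos hs hs) h3), inv_mul_eq_div, le_div_iff₀ hs]
  exact h3

/-- A sequence with bounded increments inherits its speed from the subsequence of squares. -/
lemma tendsto_div_of_squares {X : ℕ → ℤ} (hX : ∀ n, |X (n + 1) - X n| ≤ 1) {v : ℝ}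
    (h : Tendsto (fun k : ℕ => (X (k ^ 2) : ℝ) / ((k ^ 2 : ℕ) : ℝ)) atTop (nhds v)) :
    Tendsto (fun n : ℕ => (X n : ℝ) / n) atTop (nhds v) := by
  have hsq := tendsto_natSqrt_atTop
  have hstep : ∀ n d : ℕ, |(X (n + d) : ℝ) - X n| ≤ d := by
    intro n d
    induction d with
    | zero => simp
    | succ d ih =>
      have h1 : |(X (n + (d + 1)) : ℝ) - X (n + d)| ≤ 1 := by exact_mod_cast hX (n + d)
      have := abs_sub_le (X (n + (d + 1)) : ℝ) (X (n + d)) (X n)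
      push_cast
      linarith
  have h1 : Tendsto (fun n : ℕ => |(X (Nat.sqrt n ^ 2) : ℝ) / ((Nat.sqrt n ^ 2 : ℕ) : ℝ) - v| +
      2 * (1 + |v|) * ((Nat.sqrt n : ℕ) : ℝ)⁻¹) atTop (nhds 0) := by
    have h2 := ((h.comp hsq).sub_const v).abs
    have h3 := ((tendsto_natCast_atTop_atTop (R := ℝ)).comp hsq).inv_tendsto_atTop.const_mul
      (2 * (1 + |v|))
    simpa using h2.add h3
  rw [tendsto_iff_dist_tendsto_zero]
  refine squeeze_zero' (Eventually.of_forall fun n => dist_nonneg) ?_ h1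
  filter_upwards [hsq.eventually_gt_atTop 0] with n hn
  set k := Nat.sqrt n with hk
  have hkn : k ^ 2 ≤ n := by rw [hk, sq]; exact Nat.sqrt_le n
  have hkn2 : n ≤ k ^ 2 + 2 * k := by
    have := Nat.sqrt_le_add n
    rw [← hk] at this
    nlinarith
  obtain ⟨d, hd⟩ := Nat.exists_eq_add_of_le hkn
  have hd2 : (d : ℝ) ≤ 2 * k := by exact_mod_cast (by omega : d ≤ 2 * k)
  have hk0 : (0 : ℝ) < k := Nat.cast_pos.2 hn
  have hn0 : ((k ^ 2 : ℕ) : ℝ) ≤ n := Nat.cast_le.2 hkn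
  have hn1 : (n : ℝ) = ((k ^ 2 : ℕ) : ℝ) + d := by rw [hd]; push_cast; ring
  have h3 := hstep (k ^ 2) d
  rw [← hd] at h3
  have hk2 : (0 : ℝ) < ((k ^ 2 : ℕ) : ℝ) := by positivity
  have hnpos : (0 : ℝ) < n := lt_of_lt_of_le hk2 hn0
  set A : ℝ := (X (k ^ 2) : ℝ) - v * ((k ^ 2 : ℕ) : ℝ) with hA
  have h4 : |(X n : ℝ) - v * n| ≤ |A| + 2 * k * (1 + |v|) := by
    have e : (X n : ℝ) - v * n = (X n - X (k ^ 2)) + A + -(v * d) := by rw [hA, hn1]; ring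
    rw [e]
    refine (abs_add_three _ _ _).trans ?_
    rw [abs_neg, abs_mul, abs_of_nonneg (Nat.cast_nonneg d : (0 : ℝ) ≤ d)]
    nlinarith [abs_nonneg v]
  have e1 : (X n : ℝ) / n - v = (X n - v * n) / n := by field_simp
  have e2 : (X (k ^ 2) : ℝ) / ((k ^ 2 : ℕ) : ℝ) - v = A / ((k ^ 2 : ℕ) : ℝ) := by
    rw [hA]
    field_simp
  rw [Real.dist_eq, e1, e2, abs_div, abs_div, abs_of_pos hnpos, abs_of_pos hk2]
  have e3 : |A| / ((k ^ 2 : ℕ) : ℝ) + 2 * (1 + |v|) * (k : ℝ)⁻¹ =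
      (|A| + 2 * k * (1 + |v|)) / ((k ^ 2 : ℕ) : ℝ) := by
    push_cast
    field_simp
  rw [e3]
  exact div_le_div₀ (by positivity) h4 hk2 hn0

/-! ### Limit theorems for the walk, in the case of a drift to the right -/

section RightDrift

variable {Ω : Type*} [MeasurableSpace Ω] {P : Measure Ω}

/-- Limit behaviour of the branching processes associated with the tosses `ξ`. -/
structure BranchingLimit (P : Measure Ω) (ξ : ℤ → ℕ → Ω → Bool) (a σ D E ρ : ℝ) : Prop where
  infinite : ∀ ω x, {j | ξ x j ω = true}.Infinite
  a_nonneg : 0 ≤ a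
  σ_pos : 0 < σ
  D_nonneg : 0 ≤ D
  E_nonneg : 0 ≤ E
  ρ_pos : 0 < ρ
  ρ_lt_one : ρ < 1
  measurable : ∀ (m : ℤ) k, Measurable fun ω => branching (fun x j => ξ x j ω) m k
  concentration : ∀ (m : ℤ) (n : ℕ) (t : ℝ), 0 < t →
    P.real {ω | t ≤ |centSum a (branching (fun x j => ξ x j ω) m) n|} ≤ D * (n + 1) / t ^ 2
  excursion : ∀ (m : ℤ) (k r : ℕ), P.real
    {ω | ∀ i, k ≤ i → i ≤ k + r → branching (fun x j => ξ x j ω) m i ≠ 0} ≤ E * ρ ^ r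
  clt : ∀ (m : ℕ → ℤ) (L : ℕ → ℕ) (y : ℕ → ℝ) (y₀ : ℝ), Tendsto L atTop atTop →
    Tendsto y atTop (nhds y₀) →
    Tendsto (fun n => P.real
      {ω | centSum a (branching (fun x j => ξ x j ω) (m n)) (L n) / (σ * √(L n)) - y n ≤ 0})
      atTop (nhds (stdGaussianCDF y₀)) ∧
    Tendsto (fun n => P.real
      {ω | centSum a (branching (fun x j => ξ x j ω) (m n)) (L n) / (σ * √(L n)) - y n < 0})
      atTop (nhds (stdGaussianCDF y₀))

lemma centSum_eq (a : ℝ) (Z : ℕ → ℕ) (n : ℕ) :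
    centSum a Z n = (∑ k ∈ Finset.range n, Z k : ℕ) - a * n := by
  rw [centSum, Finset.sum_sub_distrib, Finset.sum_const, Finset.card_range, nsmul_eq_mul,
    Nat.cast_sum, mul_comm]

lemma threshold_eq {a v σ x : ℝ} (hv0 : 0 < v) (hv : v * (1 + 2 * a) = 1) (hσ : 0 < σ) :
    -((1 + 2 * a) * (2 * (σ * √v) * v * x) / (2 * (σ * √v))) = -x := by
  have hs : 0 < √v := Real.sqrt_pos.2 hv0
  rw [show (1 + 2 * a) * (2 * (σ * √v) * v * x) = v * (1 + 2 * a) * (2 * (σ * √v) * x) by ring, hv]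
  field_simp

namespace BranchingLimit

variable {ξ : ℤ → ℕ → Ω → Bool} {a σ D E ρ : ℝ}

lemma centSum_le_of_le_walk (h : BranchingLimit P ξ a σ D E ρ) {m n : ℕ} {ω : Ω}
    (hw : (m : ℤ) ≤ walk (fun x j => ξ x j ω) n) :
    centSum a (branching (fun x j => ξ x j ω) m) (m + 1) ≤
      ((n : ℝ) - m) / 2 - a * ((m + 1 : ℕ) : ℝ) := by
  have h1 := sum_branching_le (h.infinite ω) hw
  have h2 : (m : ℝ) + 2 * ((∑ k ∈ Finset.range (m + 1),
    branching (fun x j => ξ x j ω) m k : ℕ) : ℝ) ≤ n := by exact_mod_cast h1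
  rw [centSum_eq]
  linarith

variable [IsProbabilityMeasure P]

lemma measureReal_walk_lt_le (h : BranchingLimit P ξ a σ D E ρ) (n m r : ℕ) :
    P.real {ω | walk (fun x j => ξ x j ω) n < (m : ℤ) - r} ≤
      P.real {ω | ((n : ℝ) - m) / 2 - a * ((m + r + 1 : ℕ) : ℝ) ≤
        centSum a (branching (fun x j => ξ x j ω) m) (m + r + 1)} + 2 * (E * ρ ^ r) := by
  set A := {ω | ((n : ℝ) - m) / 2 - a * ((m + r + 1 : ℕ) : ℝ) ≤
        centSum a (branching (fun x j => ξ x j ω) m) (m + r + 1)}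
  set B := {ω | ∀ i, m ≤ i → i ≤ m + r → branching (fun x j => ξ x j ω) m i ≠ 0}
  set C := {ω | ∀ i, n + 1 - m ≤ i → i ≤ n + 1 - m + r →
    branching (fun x j => ξ x j ω) ((n + 1 : ℕ) : ℤ) i ≠ 0}
  have hsub : {ω | walk (fun x j => ξ x j ω) n < (m : ℤ) - r} ⊆ A ∪ (B ∪ C) := by
    intro ω hω
    rcases walk_lt_imp (h.infinite ω) hω with h1 | h1 | h1
    · left
      have h2 : (n : ℝ) ≤ m + 2 * ((∑ k ∈ Finset.range (m + r + 1),
        branching (fun x j => ξ x j ω) m k : ℕ) : ℝ) := by exact_mod_cast h1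
      change _ ≤ centSum _ _ _
      rw [centSum_eq]
      linarith
    · exact Or.inr (Or.inl h1)
    · exact Or.inr (Or.inr h1)
  have h1 : P.real (A ∪ (B ∪ C)) ≤ P.real A + (P.real B + P.real C) :=
    (measureReal_union_le _ _).trans (by gcongr; exact measureReal_union_le _ _)
  have hB : P.real B ≤ E * ρ ^ r := h.excursion m m r
  have hC : P.real C ≤ E * ρ ^ r := h.excursion _ (n + 1 - m) r
  linarith [measureReal_mono hsub (μ := P)]

/-- The deviations from the speed are summable along the squares. -/
lemma summable_measureReal (h : BranchingLimit P ξ a σ D E ρ) {v : ℝ} (hv0 : 0 < v)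
    (hv : v * (1 + 2 * a) = 1) {ε : ℝ} (hε : 0 < ε) (hεv : ε < v) :
    Summable fun k : ℕ => P.real {ω | ε * ((k ^ 2 : ℕ) : ℝ) ≤
      |(walk (fun x j => ξ x j ω) (k ^ 2) : ℝ) - v * ((k ^ 2 : ℕ) : ℝ)|} := by
  have ha := h.a_nonneg
  have hD := h.D_nonneg
  have hv1 : v ≤ 1 := by nlinarith
  have hg : Summable fun k : ℕ => 200 * D / ε ^ 2 * (1 / (k : ℝ) ^ 2) + 2 * E * ρ ^ k :=
    ((Real.summable_one_div_nat_pow.2 one_lt_two).mul_left _).add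
      ((summable_geometric_of_lt_one h.ρ_pos.le h.ρ_lt_one).mul_left _)
  refine hg.of_norm_bounded_eventually_nat ?_
  filter_upwards [eventually_gt_atTop 0,
    (tendsto_natCast_atTop_atTop (R := ℝ)).eventually_ge_atTop (4 * (1 + 4 * a) / ε)] with k hk hk2
  rw [Real.norm_of_nonneg measureReal_nonneg]
  have hk0 : (1 : ℝ) ≤ k := by exact_mod_cast hk
  rw [div_le_iff₀ hε] at hk2
  set n : ℕ := k ^ 2 with hn
  have hnk : (n : ℝ) = (k : ℝ) ^ 2 := by rw [hn]; push_cast; ring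
  have hk3 : (k : ℝ) ≤ k ^ 2 := by nlinarith
  have htail : ∀ (m : ℤ) (L : ℕ), (L : ℝ) + 1 ≤ 6 * (k : ℝ) ^ 2 →
      P.real {ω | ε * (k : ℝ) ^ 2 / 4 ≤ |centSum a (branching (fun x j => ξ x j ω) m) L|} ≤
        100 * D / ε ^ 2 * (1 / (k : ℝ) ^ 2) := by
    intro m L hL
    refine (h.concentration m L _ (by positivity)).trans ?_
    have h1 : D * ((L : ℝ) + 1) ≤ D * (6 * (k : ℝ) ^ 2) := by gcongr
    calc D * ((L : ℝ) + 1) / (ε * (k : ℝ) ^ 2 / 4) ^ 2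
        ≤ D * (6 * (k : ℝ) ^ 2) / (ε * (k : ℝ) ^ 2 / 4) ^ 2 := by gcongr
      _ = 96 * (D / ε ^ 2 * (1 / (k : ℝ) ^ 2)) := by field_simp; ring
      _ ≤ 100 * (D / ε ^ 2 * (1 / (k : ℝ) ^ 2)) := by gcongr; norm_num
      _ = _ := by ring
  have hup : P.real {ω | (v + ε) * n ≤ (walk (fun x j => ξ x j ω) n : ℝ)} ≤
      100 * D / ε ^ 2 * (1 / (k : ℝ) ^ 2) := by
    set m := ⌈(v + ε) * n⌉₊ with hm
    have hm1 : (v + ε) * n ≤ m := Nat.le_ceil _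
    have hm2 : (m : ℝ) < (v + ε) * n + 1 := Nat.ceil_lt_add_one (by positivity)
    refine le_trans (measureReal_mono ?_) (htail m (m + 1) ?_)
    · intro ω hω
      have h1 : (m : ℤ) ≤ walk (fun x j => ξ x j ω) n := by
        have h4 : (v + ε) * n ≤ (walk (fun x j => ξ x j ω) n : ℝ) := hω
        have hpos : (0 : ℝ) ≤ (walk (fun x j => ξ x j ω) n : ℝ) :=
          le_trans (by positivity) h4
        have h3 : (0 : ℤ) ≤ walk (fun x j => ξ x j ω) n := by exact_mod_cast hpos
        obtain ⟨w, hw⟩ := Int.eq_ofNat_of_zero_le h3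
        rw [hw] at h4 ⊢
        exact_mod_cast Nat.ceil_le.2 (by exact_mod_cast h4)
      have h2 := h.centSum_le_of_le_walk h1
      change ε * (k : ℝ) ^ 2 / 4 ≤ |centSum a (branching (fun x j => ξ x j ω) m) (m + 1)|
      refine le_trans ?_ (neg_le_abs _)
      push_cast at h2
      have h5 : (1 + 2 * a) * ((v + ε) * n) ≤ (1 + 2 * a) * m := by gcongr
      rw [← hnk]
      have h6 : 0 ≤ a * ε * n := by positivity
      have h7 : 0 ≤ ε * n := by positivity
      nlinarith
    · push_cast
      nlinarith
  have hlow : P.real {ω | (walk (fun x j => ξ x j ω) n : ℝ) ≤ (v - ε) * n} ≤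
      100 * D / ε ^ 2 * (1 / (k : ℝ) ^ 2) + 2 * (E * ρ ^ k) := by
    have hve : 0 < v - ε := sub_pos.2 hεv
    set m := ⌊(v - ε) * n⌋₊ + 1 with hm
    have hm1 : (v - ε) * n < m := by rw [hm]; push_cast; exact Nat.lt_floor_add_one _
    have hm2 : (m : ℝ) ≤ (v - ε) * n + 1 := by
      rw [hm]; push_cast; linarith [Nat.floor_le (show 0 ≤ (v - ε) * n by positivity)]
    refine le_trans (measureReal_mono ?_) ((h.measureReal_walk_lt_le n (m + k) k).trans
      (add_le_add_left (le_trans (measureReal_mono ?_) (htail ((m + k : ℕ) : ℤ) (m + k + k + 1) ?_)) _))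
    · intro ω hω
      have h4 : (walk (fun x j => ξ x j ω) n : ℝ) ≤ (v - ε) * n := hω
      have h1 : (walk (fun x j => ξ x j ω) n : ℝ) < (m : ℤ) :=
        lt_of_le_of_lt h4 (by exact_mod_cast hm1)
      have h2 : walk (fun x j => ξ x j ω) n < (m : ℤ) := by exact_mod_cast h1
      change walk (fun x j => ξ x j ω) n < ((m + k : ℕ) : ℤ) - k
      push_cast
      linarith
    · intro ω hω
      have h4 : ((n : ℝ) - (m + k : ℕ)) / 2 - a * ((m + k + k + 1 : ℕ) : ℝ) ≤
        centSum a (branching (fun x j => ξ x j ω) ((m + k : ℕ) : ℤ)) (m + k + k + 1) := hω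
      refine le_trans ?_ (le_trans h4 (le_abs_self _))
      push_cast
      have h5 : (1 + 2 * a) * m ≤ (1 + 2 * a) * ((v - ε) * n + 1) := by gcongr
      have h6 : 0 ≤ a * ε * n := by positivity
      rw [← hnk]
      rw [← hnk] at hk3
      nlinarith
    · push_cast
      nlinarith
  calc _ ≤ P.real ({ω | (v + ε) * n ≤ (walk (fun x j => ξ x j ω) n : ℝ)} ∪
        {ω | (walk (fun x j => ξ x j ω) n : ℝ) ≤ (v - ε) * n}) := by
        refine measureReal_mono fun ω hω => ?_
        have h2 : ε * (n : ℝ) ≤ |(walk (fun x j => ξ x j ω) n : ℝ) - v * n| := hω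
        rcases le_abs.1 h2 with h1 | h1
        · exact Or.inl (show (v + ε) * (n : ℝ) ≤ (walk (fun x j => ξ x j ω) n : ℝ) by linarith)
        · exact Or.inr (show (walk (fun x j => ξ x j ω) n : ℝ) ≤ (v - ε) * n by linarith)
    _ ≤ _ := measureReal_union_le _ _
    _ ≤ _ := add_le_add hup hlow
    _ = _ := by ring

/-- The speed of the walk. -/
lemma ae_tendsto_walk_div (h : BranchingLimit P ξ a σ D E ρ) {v : ℝ} (hv0 : 0 < v)
    (hv : v * (1 + 2 * a) = 1) : ∀ᵐ ω ∂P,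
    Tendsto (fun n : ℕ => (walk (fun x j => ξ x j ω) n : ℝ) / n) atTop (nhds v) := by
  have hev : ∀ᵐ ω ∂P, ∀ j : ℕ, ∀ᶠ k : ℕ in atTop,
      |(walk (fun x j => ξ x j ω) (k ^ 2) : ℝ) - v * ((k ^ 2 : ℕ) : ℝ)| <
        v / (j + 2) * ((k ^ 2 : ℕ) : ℝ) := by
    refine ae_all_iff.2 fun j => ?_
    have hj : v / ((j : ℝ) + 2) < v := by
      rw [div_lt_iff₀ (by positivity)]
      nlinarith [(Nat.cast_nonneg j : (0 : ℝ) ≤ j)]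
    have hs := (h.summable_measureReal hv0 hv (by positivity) hj).tsum_ofReal_ne_top
    have he : ∀ s : Set Ω, ENNReal.ofReal (P.real s) = P s := fun s => ofReal_measureReal
    simp_rw [he] at hs
    filter_upwards [ae_eventually_notMem hs] with ω hω
    filter_upwards [hω] with k hk
    exact not_le.1 hk
  filter_upwards [hev] with ω hω
  refine tendsto_div_of_squares (fun n => ?_) (Metric.tendsto_atTop.2 fun ε hε => ?_)
  · rw [walk_succ, add_sub_cancel_left]
    split_ifs <;> simp
  · obtain ⟨j, hj⟩ := exists_nat_gt (v / ε)
    obtain ⟨k₀, hk₀⟩ := eventually_atTop.1 ((hω j).and (eventually_gt_atTop 0))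
    refine ⟨k₀, fun k hk => ?_⟩
    obtain ⟨h1, h2⟩ := hk₀ k hk
    have h3 : (0 : ℝ) < ((k ^ 2 : ℕ) : ℝ) := by exact_mod_cast pow_pos h2 2
    have h4 : v / ((j : ℝ) + 2) < ε := by
      rw [div_lt_iff₀ hε] at hj
      rw [div_lt_iff₀ (by positivity)]
      nlinarith
    rw [Real.dist_eq, div_sub' h3.ne', abs_div, abs_of_pos h3, div_lt_iff₀ h3, mul_comm _ v]
    exact h1.trans (by gcongr)

lemma limsup_measureReal_le_le (h : BranchingLimit P ξ a σ D E ρ) {v : ℝ} (hv0 : 0 < v)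
    (hv : v * (1 + 2 * a) = 1) {x : ℝ} {t : ℕ → ℝ}
    (ht : Tendsto (fun n : ℕ => (t n - n * v) / √n) atTop (nhds (2 * (σ * √v) * v * x))) :
    ∃ u : ℕ → ℝ, Tendsto u atTop (nhds (stdGaussianCDF x)) ∧
      ∀ᶠ n in atTop, P.real {ω | (walk (fun x j => ξ x j ω) n : ℝ) ≤ t n} ≤ u n := by
  obtain ⟨ht0, htf⟩ := tendsto_natFloor_threshold hv0 ht
  set r : ℕ → ℕ := fun n => Nat.sqrt (Nat.sqrt n) with hr
  set m : ℕ → ℕ := fun n => ⌊t n⌋₊ + 1 + r n with hm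
  have hσ := h.σ_pos
  have hmt : Tendsto (fun n : ℕ => ((m n : ℝ) - n * v) / √n) atTop
      (nhds (2 * (σ * √v) * v * x)) := by
    have h1 := (htf.add tendsto_inv_sqrt_natCast).add tendsto_sqrt_sqrt_div
    simp only [add_zero] at h1
    refine h1.congr fun n => ?_
    simp only [hm, hr]
    push_cast
    ring
  obtain ⟨hL, hy⟩ := tendsto_threshold hv0 hv hσ hmt tendsto_sqrt_sqrt_div
  rw [threshold_eq hv0 hv hσ] at hy
  have hclt := (h.clt (fun n => m n) _ _ _ hL hy).2
  have hρ : Tendsto (fun n => 2 * (E * ρ ^ r n)) atTop (nhds 0) := by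
    have h1 := (tendsto_pow_atTop_nhds_zero_of_lt_one h.ρ_pos.le h.ρ_lt_one).comp
      (tendsto_natSqrt_atTop.comp tendsto_natSqrt_atTop)
    simpa using (h1.const_mul E).const_mul 2
  have hsum := (hclt.const_sub 1).add hρ
  rw [add_zero, show 1 - stdGaussianCDF (-x) = stdGaussianCDF x by
    linarith [stdGaussianCDF_add_neg x]] at hsum
  refine ⟨_, hsum, Eventually.of_forall fun n => ?_⟩
  refine le_trans (measureReal_mono ?_) ((h.measureReal_walk_lt_le n (m n) (r n)).trans
    (add_le_add_left ?_ _))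
  · intro ω hω
    have h1 : (walk (fun x j => ξ x j ω) n : ℝ) ≤ t n := hω
    have h2 : (walk (fun x j => ξ x j ω) n : ℝ) < ((⌊t n⌋₊ + 1 : ℕ) : ℤ) := by
      push_cast
      exact h1.trans_lt (Nat.lt_floor_add_one _)
    have h3 : walk (fun x j => ξ x j ω) n < ((⌊t n⌋₊ + 1 : ℕ) : ℤ) := by exact_mod_cast h2
    change walk (fun x j => ξ x j ω) n < (m n : ℤ) - r n
    simp only [hm]
    push_cast at h3 ⊢
    linarith
  · have hmeas : MeasurableSet {ω | centSum a (branching (fun x j => ξ x j ω) (m n))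
        (m n + r n + 1) / (σ * √((m n + r n + 1 : ℕ) : ℝ)) -
        (((n : ℝ) - m n) / 2 - a * ((m n + r n + 1 : ℕ) : ℝ)) /
        (σ * √((m n + r n + 1 : ℕ) : ℝ)) < 0} :=
      measurableSet_lt (((measurable_centSum (h.measurable (m n)) a _).div_const _).sub_const _)
        measurable_const
    rw [← probReal_compl_eq_one_sub hmeas]
    refine measureReal_mono fun ω hω => ?_
    have h1 : ((n : ℝ) - m n) / 2 - a * ((m n + r n + 1 : ℕ) : ℝ) ≤
      centSum a (branching (fun x j => ξ x j ω) (m n)) (m n + r n + 1) := hω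
    have h2 := div_nonneg (sub_nonneg.2 h1)
      (show 0 ≤ σ * √((m n + r n + 1 : ℕ) : ℝ) by positivity)
    rw [sub_div] at h2
    exact fun h3 => absurd h3 (not_lt.2 h2)

lemma limsup_measureReal_ge_le (h : BranchingLimit P ξ a σ D E ρ) {v : ℝ} (hv0 : 0 < v)
    (hv : v * (1 + 2 * a) = 1) {x : ℝ} {t : ℕ → ℝ}
    (ht : Tendsto (fun n : ℕ => (t n - n * v) / √n) atTop (nhds (2 * (σ * √v) * v * x))) :
    ∃ u : ℕ → ℝ, Tendsto u atTop (nhds (stdGaussianCDF (-x))) ∧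
      ∀ᶠ n in atTop, P.real {ω | t n ≤ (walk (fun x j => ξ x j ω) n : ℝ)} ≤ u n := by
  obtain ⟨ht0, hmt⟩ := tendsto_natFloor_threshold hv0 ht
  set m : ℕ → ℕ := fun n => ⌊t n⌋₊ with hm
  have hσ := h.σ_pos
  obtain ⟨hL, hy⟩ := tendsto_threshold (r := fun _ => 0) hv0 hv hσ hmt (by simp)
  rw [threshold_eq hv0 hv hσ] at hy
  simp only [add_zero] at hL hy
  refine ⟨_, (h.clt (fun n => m n) _ _ _ hL hy).1, ?_⟩
  filter_upwards [ht0] with n hn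
  refine measureReal_mono fun ω hω => ?_
  have h1 : t n ≤ (walk (fun x j => ξ x j ω) n : ℝ) := hω
  have h2 : ((m n : ℤ) : ℝ) ≤ (walk (fun x j => ξ x j ω) n : ℝ) := by
    push_cast
    exact (Nat.floor_le hn).trans h1
  have h3 := h.centSum_le_of_le_walk (Int.cast_le.1 h2)
  change centSum a (branching (fun x j => ξ x j ω) (m n)) (m n + 1) /
    (σ * √((m n + 1 : ℕ) : ℝ)) - (((n : ℝ) - m n) / 2 - a * ((m n + 1 : ℕ) : ℝ)) /
      (σ * √((m n + 1 : ℕ) : ℝ)) ≤ 0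
  rw [← sub_div]
  exact div_nonpos_of_nonpos_of_nonneg (sub_nonpos.2 h3) (by positivity)

/-- Convergence of the lower and upper tails of the walk to Gaussian tails. -/
lemma tendsto_measureReal_walk (h : BranchingLimit P ξ a σ D E ρ) {v : ℝ} (hv0 : 0 < v)
    (hv : v * (1 + 2 * a) = 1) {x : ℝ} {t : ℕ → ℝ}
    (ht : Tendsto (fun n : ℕ => (t n - n * v) / √n) atTop (nhds (2 * (σ * √v) * v * x))) :
    Tendsto (fun n => P.real {ω | (walk (fun x j => ξ x j ω) n : ℝ) ≤ t n}) atTop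
      (nhds (stdGaussianCDF x)) ∧
    Tendsto (fun n => P.real {ω | t n ≤ (walk (fun x j => ξ x j ω) n : ℝ)}) atTop
      (nhds (stdGaussianCDF (-x))) := by
  obtain ⟨u, hu, hu'⟩ := h.limsup_measureReal_le_le hv0 hv ht
  obtain ⟨w, hw, hw'⟩ := h.limsup_measureReal_ge_le hv0 hv ht
  have hone : ∀ n, 1 ≤ P.real {ω | (walk (fun x j => ξ x j ω) n : ℝ) ≤ t n} +
      P.real {ω | t n ≤ (walk (fun x j => ξ x j ω) n : ℝ)} := fun n => by
    refine le_trans (le_of_eq ?_) (measureReal_union_le _ _)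
    rw [eq_comm, ← probReal_univ (μ := P)]
    congr 1
    exact eq_univ_of_forall fun ω => le_total (walk (fun x j => ξ x j ω) n : ℝ) (t n)
  have hx := stdGaussianCDF_add_neg x
  constructor
  · have hw2 : Tendsto (fun n => 1 - w n) atTop (nhds (stdGaussianCDF x)) := by
      rw [show stdGaussianCDF x = 1 - stdGaussianCDF (-x) by linarith]
      exact hw.const_sub 1
    refine tendsto_of_tendsto_of_tendsto_of_le_of_le' hw2 hu ?_ hu'
    filter_upwards [hw'] with n hn
    linarith [hone n]
  · have hu2 : Tendsto (fun n => 1 - u n) atTop (nhds (stdGaussianCDF (-x))) := by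
      rw [show stdGaussianCDF (-x) = 1 - stdGaussianCDF x by linarith]
      exact hu.const_sub 1
    refine tendsto_of_tendsto_of_tendsto_of_le_of_le' hu2 hw ?_ hw'
    filter_upwards [hu'] with n hn
    linarith [hone n]

end BranchingLimit

end RightDrift

/-! ### The excited random walk -/

section ExcitedWalk

variable {N : ℕ} {Ω : Type*} [MeasurableSpace Ω] {P : Measure Ω} {K : Matrix (Fin N) (Fin N) ℝ}
  {μ p η : Fin N → ℝ} {Rc : ℤ → ℕ → Ω → Fin N} {ξ : ℤ → ℕ → Ω → Bool}

/-- The reflected cookie environment. -/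
lemma IsCookieEnv.reflect (henv : IsCookieEnv P K p η Rc ξ) :
    IsCookieEnv P K (fun i => 1 - p i) η (fun x => Rc (-x)) (fun x j ω => !ξ (-x) j ω) := by
  refine ⟨fun x j => henv.1 (-x) j, fun x j => (measurable_of_countable Bool.not).comp (henv.2.1 (-x) j),
    fun S m f b => ?_⟩
  have h := henv.2.2 (S.map (Equiv.neg ℤ).toEmbedding) m (fun x => f (-x)) (fun x j => !b (-x) j)
  rw [Finset.prod_map] at h
  convert h using 2
  · congr 1
    ext ω
    change (∀ x ∈ S, ∀ j ≤ m, _) ↔ (∀ x ∈ _, ∀ j ≤ m, _)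
    simp only [Finset.forall_mem_map, Equiv.coe_toEmbedding, Equiv.neg_apply, neg_neg,
      Bool.not_eq_eq_eq_not]
  · simp only [Equiv.coe_toEmbedding, Equiv.neg_apply, neg_neg]
    congr 1
    refine Finset.prod_congr rfl fun j _ => ?_
    cases b _ j <;> simp

variable [IsProbabilityMeasure P]

lemma IsCookieEnv.exists_branchingLimit (henv : IsCookieEnv P K p η Rc ξ) (hK : IsStochastic K)
    (hμ : HasUniqueStationaryDist K μ) (hp : ∀ i, p i ∈ Ioo (0 : ℝ) 1) (hη : IsProbVec η)
    (hp2 : 1 / 2 < ∑ i, μ i * p i) (hinf : ∀ ω x, {j | ξ x j ω = true}.Infinite) :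
    ∃ a σ D E ρ, BranchingLimit P ξ a σ D E ρ := by
  obtain ⟨i, -⟩ := hη.exists_pos
  have : Nonempty (Fin N) := ⟨i⟩
  have := isMarkovKernel_failsKernel (P := P) (henv.2.1 0) fun ω => hinf ω 0
  obtain ⟨V, c, h1, h2, h3, hc⟩ := henv.exists_drift hK hμ hp hp2 fun ω => hinf ω 0
  have hpos := henv.failsKernel_ne_zero hK hp hη fun ω => hinf ω 0
  obtain ⟨f, q, a, σ, C, hcor⟩ := h1.exists_corrector h2 hpos hc
  obtain ⟨E, ρ, hE, hρ0, hρ1, hex⟩ := h1.excursion_le (P := P) fun z => hpos z 0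
  obtain ⟨D, hD, hcon⟩ := hcor.measureReal_abs_ge_le (P := P) h1 h2
  have hZ := henv.isMarkovChain_branching hinf
  exact ⟨a, σ, D, E, ρ, hinf, hcor.a_nonneg, hcor.σ_pos, hD, hE, hρ0, hρ1,
    fun m => (hZ m).measurable, fun m => hcon _ (hZ m) fun _ => rfl,
    fun m => hex _ (hZ m) fun _ => rfl,
    fun m L y y₀ hL hy => hcor.tendsto_measureReal h1 h2 h3 (fun n => hZ (m n)) (fun _ _ => rfl) hL hy⟩

/-- Speed and Gaussian limits of the excited random walk with `p̄ > 1/2`. -/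
lemma IsCookieEnv.exists_speed (henv : IsCookieEnv P K p η Rc ξ) (hK : IsStochastic K)
    (hμ : HasUniqueStationaryDist K μ) (hp : ∀ i, p i ∈ Ioo (0 : ℝ) 1) (hη : IsProbVec η)
    (hp2 : 1 / 2 < ∑ i, μ i * p i) :
    ∃ v b : ℝ, 0 < v ∧ 0 < b ∧
      (∀ᵐ ω ∂P, Tendsto (fun n : ℕ => (walk (fun x j => ξ x j ω) n : ℝ) / n) atTop (nhds v)) ∧
      ∀ (x : ℝ) (t : ℕ → ℝ),
        Tendsto (fun n : ℕ => (t n - n * v) / √n) atTop (nhds (b * x)) →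
        Tendsto (fun n => P.real {ω | (walk (fun x j => ξ x j ω) n : ℝ) ≤ t n}) atTop
          (nhds (stdGaussianCDF x)) ∧
        Tendsto (fun n => P.real {ω | t n ≤ (walk (fun x j => ξ x j ω) n : ℝ)}) atTop
          (nhds (stdGaussianCDF (-x))) := by
  obtain ⟨ξ', henv', hinf, hae⟩ := henv.exists_regular hK hμ hp hp2
  obtain ⟨a, σ, D, E, ρ, h⟩ := henv'.exists_branchingLimit hK hμ hp hη hp2 hinf
  have ha := h.a_nonneg
  have hσ := h.σ_pos
  have hv0 : 0 < (1 + 2 * a)⁻¹ := by positivity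
  have hv : (1 + 2 * a)⁻¹ * (1 + 2 * a) = 1 := inv_mul_cancel₀ (by positivity)
  have hw : ∀ᵐ ω ∂P, ∀ n, walk (fun x j => ξ' x j ω) n = walk (fun x j => ξ x j ω) n := by
    filter_upwards [hae] with ω hω n
    simp only [hω]
  refine ⟨(1 + 2 * a)⁻¹, 2 * (σ * √((1 + 2 * a)⁻¹)) * (1 + 2 * a)⁻¹, hv0,
    mul_pos (mul_pos two_pos (mul_pos hσ (Real.sqrt_pos.2 hv0))) hv0, ?_, fun x t ht => ?_⟩
  · filter_upwards [h.ae_tendsto_walk_div hv0 hv, hw] with ω h1 h2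
    simpa only [h2] using h1
  · have key : ∀ (n : ℕ) (s : Set ℝ), P.real {ω | (walk (fun x j => ξ' x j ω) n : ℝ) ∈ s} =
        P.real {ω | (walk (fun x j => ξ x j ω) n : ℝ) ∈ s} := by
      intro n s
      refine measureReal_congr ?_
      filter_upwards [hw] with ω hω
      refine propext ?_
      change (walk _ _ : ℝ) ∈ s ↔ (walk _ _ : ℝ) ∈ s
      rw [hω]
    obtain ⟨h1, h2⟩ := h.tendsto_measureReal_walk hv0 hv ht
    exact ⟨h1.congr fun n => key n (Iic (t n)), h2.congr fun n => key n (Ici (t n))⟩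

/-- A walk with positive speed is transient to the right. -/
lemma tendsto_atTop_of_speed {X : ℕ → ℤ} {v : ℝ} (hv : 0 < v)
    (h : Tendsto (fun n : ℕ => (X n : ℝ) / n) atTop (nhds v)) : Tendsto X atTop atTop := by
  rw [← tendsto_intCast_atTop_iff (R := ℝ)]
  refine (h.pos_mul_atTop hv (tendsto_natCast_atTop_atTop (R := ℝ))).congr' ?_
  filter_upwards [eventually_gt_atTop 0] with n hn
  exact div_mul_cancel₀ _ (Nat.cast_pos.2 hn).ne'

lemma tendsto_gaussian_threshold (v c : ℝ) :
    Tendsto (fun n : ℕ => (n * v + c * √n - n * v) / √(n : ℝ)) atTop (nhds c) := by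
  refine tendsto_const_nhds.congr' ?_
  filter_upwards [eventually_gt_atTop 0] with n hn
  have hs : 0 < √(n : ℝ) := Real.sqrt_pos.2 (Nat.cast_pos.2 hn)
  rw [add_sub_cancel_left, mul_div_cancel_right₀ _ hs.ne']

lemma div_le_iff_le_threshold {b v x w : ℝ} (hb : 0 < b) {n : ℕ} (hn : 0 < n) :
    (w - n * v) / (b * √(n : ℝ)) ≤ x ↔ w ≤ n * v + b * x * √n := by
  have hs : 0 < √(n : ℝ) := Real.sqrt_pos.2 (Nat.cast_pos.2 hn)
  rw [div_le_iff₀ (mul_pos hb hs), sub_le_iff_le_add', mul_left_comm, mul_assoc]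

end ExcitedWalk

/-- **Theorem 1.2 (non-critical case).** If `p̄ = μ·𝐩 ≠ 1/2` then the excited random walk with
Markovian cookie stacks is transient (to the right if `p̄ > 1/2`, to the left if `p̄ < 1/2`),
ballistic with deterministic nonzero speed `v₀` of the same sign as `p̄ − 1/2`, and satisfies a
central limit theorem with some scaling constant `b > 0`. -/
theorem noncritical_transience_ballisticity_gaussian_limit
    {N : ℕ} {Ω : Type*} [MeasurableSpace Ω] (Pm : Measure Ω) [IsProbabilityMeasure Pm]
    (K : Matrix (Fin N) (Fin N) ℝ) (μ p η : Fin N → ℝ)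
    (Rc : ℤ → ℕ → Ω → Fin N) (ξ : ℤ → ℕ → Ω → Bool)
    (hK : IsStochastic K) (hμ : HasUniqueStationaryDist K μ)
    (hp : ∀ i, p i ∈ Set.Ioo (0 : ℝ) 1) (hη : IsProbVec η)
    (henv : IsCookieEnv Pm K p η Rc ξ)
    (hnoncrit : ∑ i, μ i * p i ≠ 1 / 2) :
    ((1 / 2 < ∑ i, μ i * p i →
        Pm {ω | Tendsto (fun n => walk (fun x j => ξ x j ω) n) atTop atTop} = 1) ∧
      (∑ i, μ i * p i < 1 / 2 →
        Pm {ω | Tendsto (fun n => walk (fun x j => ξ x j ω) n) atTop atBot} = 1)) ∧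
    ∃ v₀ : ℝ,
      Pm {ω | Tendsto (fun n : ℕ => (walk (fun x j => ξ x j ω) n : ℝ) / n) atTop (nhds v₀)} = 1 ∧
      (1 / 2 < ∑ i, μ i * p i → 0 < v₀) ∧
      (∑ i, μ i * p i < 1 / 2 → v₀ < 0) ∧
      ∃ b : ℝ, 0 < b ∧
        ∀ x : ℝ,
          Tendsto
            (fun n : ℕ =>
              (Pm {ω |
                  ((walk (fun x' j => ξ x' j ω) n : ℝ) - n * v₀) / (b * Real.sqrt n) ≤ x}).toReal)
            atTop (nhds (stdGaussianCDF x)) := by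
  have hone : ∀ {q : Ω → Prop}, (∀ᵐ ω ∂Pm, q ω) → Pm {ω | q ω} = 1 := fun h =>
    (measure_congr (eventuallyEq_univ.2 h)).trans measure_univ
  rcases hnoncrit.lt_or_gt with hlt | hgt
  · have hp' : ∀ i, 1 - p i ∈ Set.Ioo (0 : ℝ) 1 := fun i =>
      ⟨by linarith [(hp i).2], by linarith [(hp i).1]⟩
    have hp2 : 1 / 2 < ∑ i, μ i * (1 - p i) := by
      have h1 : ∑ i, μ i = 1 := hμ.1.1.2
      simp only [mul_sub, mul_one, Finset.sum_sub_distrib]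
      linarith
    obtain ⟨v, b, hv, hb, hspeed, hclt⟩ := henv.reflect.exists_speed hK hμ hp' hη hp2
    have hr : ∀ ω n, walk (fun x j => !ξ (-x) j ω) n = -walk (fun x j => ξ x j ω) n := fun ω n =>
      (walk_reflect (fun x j => ξ x j ω) n).1
    simp only [hr, Int.cast_neg] at hspeed hclt
    have hlim : ∀ᵐ ω ∂Pm, Tendsto (fun n : ℕ => (walk (fun x j => ξ x j ω) n : ℝ) / n) atTop
        (nhds (-v)) := by
      filter_upwards [hspeed] with ω hω
      simpa only [neg_div, neg_neg] using hω.neg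
    refine ⟨⟨fun h => absurd h hlt.not_gt, fun _ => hone ?_⟩, -v, hone hlim,
      fun h => absurd h hlt.not_gt, fun _ => neg_lt_zero.2 hv, b, hb, fun x => ?_⟩
    · filter_upwards [hspeed] with ω hω
      exact tendsto_neg_atTop_iff.1 (tendsto_atTop_of_speed (X := fun n => -walk _ n) hv
        (by simpa only [Int.cast_neg] using hω))
    · have h1 := (hclt (-x) _ (tendsto_gaussian_threshold v (b * -x))).2
      rw [neg_neg] at h1
      refine h1.congr' ?_
      filter_upwards [eventually_gt_atTop 0] with n hn
      simp only [div_le_iff_le_threshold hb hn]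
      congr 2
      ext ω
      change _ ≤ -(walk _ _ : ℝ) ↔ (walk _ _ : ℝ) ≤ _
      constructor <;> intro h <;> linarith
  · obtain ⟨v, b, hv, hb, hspeed, hclt⟩ := henv.exists_speed hK hμ hp hη hgt
    refine ⟨⟨fun _ => hone ?_, fun h => absurd h hgt.not_gt⟩, v, hone hspeed, fun _ => hv,
      fun h => absurd h hgt.not_gt, b, hb, fun x => ?_⟩
    · filter_upwards [hspeed] with ω hω
      exact tendsto_atTop_of_speed hv hω
    · refine (hclt x _ (tendsto_gaussian_threshold v (b * x))).1.congr' ?_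
      filter_upwards [eventually_gt_atTop 0] with n hn
      simp only [div_le_iff_le_threshold hb hn]
      rfl

end
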